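/- There exists a constant C > 0 such that the following holds: for all real x, y with 2 ≤ y ≤ x, if α > 0 satisfies φ₁(α,y) + log x = 0, then |Ψ(x,y) − HT(x,y,α)| ≤ C·(1/u + (log y)/y)·HT(x,y,α), where u := log x/log y and HT(x,y,s) := x^s·ζ(s,y)/(s·√(2π·φ₂(s,y))). -/

import Mathlib

set_option linter.all false
/-- `smoothCount x y` = Ψ(x,y), the number of positive integers `n ≤ x`
all of whose prime factors are `≤ y`. -/
noncomputable def smoothCount (x y : ℝ) : ℕ :=
  Nat.card {n : ℕ // 0 < n ∧ (n : ℝ) ≤ x ∧ ∀ p : ℕ, p.Prime → p ∣ n → (p : ℝ) ≤ y}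

/-- The finite set of primes `p ≤ y`. -/
noncomputable def primesLE (y : ℝ) : Finset ℕ :=
  (Finset.range (⌊y⌋₊ + 1)).filter Nat.Prime

/-- `ζ(s,y) := ∏_{p ≤ y} (1 − p^{−s})^{-1}`. -/
noncomputable def zetaSmooth (s y : ℝ) : ℝ :=
  ∏ p ∈ primesLE y, (1 - (p : ℝ) ^ (-s))⁻¹

/-- `φ₁(s,y) := −∑_{p ≤ y} log p/(p^s − 1)`. -/
noncomputable def phi1 (s y : ℝ) : ℝ :=
  -∑ p ∈ primesLE y, Real.log p / ((p : ℝ) ^ s - 1)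

/-- `φ₂(s,y) := ∑_{p ≤ y} p^s (log p)²/(p^s − 1)²`. -/
noncomputable def phi2 (s y : ℝ) : ℝ :=
  ∑ p ∈ primesLE y, (p : ℝ) ^ s * (Real.log p) ^ 2 / ((p : ℝ) ^ s - 1) ^ 2

/-- `HT(x,y,s) := x^s ζ(s,y)/(s √(2π φ₂(s,y)))`. -/
noncomputable def HT (x y s : ℝ) : ℝ :=
  x ^ s * zetaSmooth s y / (s * Real.sqrt (2 * Real.pi * phi2 s y))


notation "li!" => (by linarith)
notation "po!" => (by positivity)
notation "nn!" => (by norm_num)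
notation:75 p:76 "^~" a:75 => ((p : ℝ) ^ (-a))
notation "cex" => Complex.exp
namespace HTP
section
open Real MeasureTheory
open Complex (I)
/-- gamma density -/
noncomputable def gam (m : ℕ) (β : ℝ) (z : ℝ) : ℝ :=
  Set.indicator (Set.Ioi 0) (fun z => z ^ m * exp (-(z / β)) / (m.factorial * β ^ (m+1))) z
noncomputable def hh (α : ℝ) (w : ℝ) : ℝ := Set.indicator (Set.Ici 0) (fun w => exp (-(α * w))) w
lemma tend_aux (c : ℂ) (hc : 0 < c.re) (m : ℕ) :
    Filter.Tendsto (fun z : ℝ => (z:ℂ)^m * cex (-(c * z))) Filter.atTop (nhds 0) := by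
  rw [tendsto_zero_iff_norm_tendsto_zero]
  have h := tendsto_pow_mul_exp_neg_atTop_nhds_zero m
  have h2 := (h.comp (Filter.tendsto_id.const_mul_atTop hc)).const_mul ((c.re ^ m)⁻¹)
  rw [mul_zero] at h2
  refine h2.congr' ?_
  filter_upwards [Filter.eventually_ge_atTop 0] with z hz
  have h1 : c.re ^ m ≠ 0 := by positivity
  simp [Complex.norm_exp, abs_of_nonneg hz, mul_pow]
  field_simp
lemma int_aux (c : ℂ) (hc : 0 < c.re) (m : ℕ) :
    IntegrableOn (fun z : ℝ => (z:ℂ)^m * cex (-(c * z))) (Set.Ioi 0) := by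
  have h := Real.GammaIntegral_convergent (s := m + 1) po!
  have h2 : IntegrableOn (fun z : ℝ => z ^ m * exp (-(c.re*z))) (Set.Ioi 0) := by
    have h3 : IntegrableOn (fun z : ℝ => z ^ (m:ℝ) * exp (-c.re*z)) (Set.Ioi 0) := by
      have := integrableOn_rpow_mul_exp_neg_mul_rpow (s := (m:ℝ)) (p := 1) (b := c.re) (by
        have : (0:ℝ) ≤ m := Nat.cast_nonneg m
        linarith) one_pos hc
      simpa using this
    refine h3.congr_fun (fun z hz => ?_) measurableSet_Ioi
    simp
  refine Integrable.mono' h2 (by fun_prop) ?_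
  refine (ae_restrict_iff' measurableSet_Ioi).2 (Filter.Eventually.of_forall fun z hz => ?_)
  have hz' : (0:ℝ) < z := hz
  simp [Complex.norm_exp, abs_of_pos hz']
lemma lap_aux (c : ℂ) (hc : 0 < c.re) (m : ℕ) :
    ∫ z in Set.Ioi (0:ℝ), (z:ℂ)^m * cex (-(c * z)) = m.factorial / c^(m+1) := by
  have hc0 : c ≠ 0 := by rintro rfl; simp at hc
  induction m with
  | zero =>
    have := integral_exp_mul_complex_Ioi (a := -c) (by simpa using hc) 0
    simpa using this
  | succ m ih =>
    have key := integral_Ioi_of_hasDerivAt_of_tendsto' (a := (0:ℝ)) (m := (0:ℂ))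
      (f := fun z : ℝ => (z:ℂ)^(m+1) * cex (-(c * z)))
      (f' := fun z : ℝ => (m+1) * ((z:ℂ)^m * cex (-(c * z))) - c * ((z:ℂ)^(m+1) * cex (-(c * z))))
      (fun z _ => by
        have h1 : HasDerivAt (fun z : ℝ => (z:ℂ)) 1 z := Complex.ofRealCLM.hasDerivAt
        have h2 := (h1.pow (m+1)).mul (((h1.const_mul c).neg).cexp)
        refine h2.congr_deriv ?_
        simp
        ring)
      (((int_aux c hc m).const_mul _).sub ((int_aux c hc (m+1)).const_mul _)) (tend_aux c hc (m+1))
    rw [integral_sub ((int_aux c hc m).const_mul _) ((int_aux c hc (m+1)).const_mul _),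
      integral_const_mul, integral_const_mul, ih] at key
    simp only [Complex.ofReal_zero, zero_pow (Nat.succ_ne_zero m), zero_mul, sub_zero] at key
    have := sub_eq_zero.1 key
    have h2 : ∫ z in Set.Ioi (0:ℝ), (z:ℂ)^(m+1) * cex (-(c * z)) =
      c⁻¹ * ((m+1) * (m.factorial / c^(m+1))) := by rw [this]; field_simp
    rw [h2, Nat.factorial_succ]; push_cast; field_simp; ring
lemma lap_gam (m : ℕ) (β : ℝ) (hβ : 0 < β) (a : ℂ) (ha : -(1/β) < a.re) :
    Integrable (fun z : ℝ => cex (-(a * z)) * (gam m β z : ℂ)) ∧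
    ∫ z : ℝ, cex (-(a * z)) * (gam m β z : ℂ) = ((1 + a * β) ^ (m+1))⁻¹ := by
  have hc : 0 < (a + 1/β : ℂ).re := by
    have h1 : ((1:ℂ)/β).re = 1/β := by rw [← Complex.ofReal_one, ← Complex.ofReal_div, Complex.ofReal_re]
    simp only [Complex.add_re, h1]; linarith
  have e : (fun z : ℝ => cex (-(a * z)) * (gam m β z : ℂ)) =
    Set.indicator (Set.Ioi 0) (fun z : ℝ => ((m.factorial * β^(m+1) : ℝ) : ℂ)⁻¹ * ((z:ℂ)^m * cex (-((a + 1/β) * z)))) := by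
    funext z
    unfold gam
    by_cases hz : z ∈ Set.Ioi (0:ℝ)
    · rw [Set.indicator_of_mem hz, Set.indicator_of_mem hz, add_mul, neg_add, Complex.exp_add]
      push_cast
      have : (1/(β:ℂ) * z) = z / β := by ring
      rw [this]; ring
    · rw [Set.indicator_of_notMem hz, Set.indicator_of_notMem hz]; simp
  rw [e]
  constructor
  · exact (integrable_indicator_iff measurableSet_Ioi).2 ((int_aux _ hc m).const_mul _)
  · rw [integral_indicator measurableSet_Ioi, integral_const_mul, lap_aux _ hc]
    have hβ' : (β:ℂ) ≠ 0 := by exact_mod_cast hβ.ne'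
    have h2 : (a + 1/β : ℂ) = (1 + a*β)/β := by field_simp; ring
    have h3 : (1 + a*β : ℂ) ≠ 0 := by
      intro h; rw [h2, h] at hc; simp at hc
    have hf : (m.factorial : ℂ) ≠ 0 := by exact_mod_cast m.factorial_ne_zero
    rw [h2]; push_cast; rw [div_pow]; field_simp
lemma gam_nonneg (m : ℕ) (β : ℝ) (hβ : 0 < β) (z : ℝ) : 0 ≤ gam m β z := by
  unfold gam
  refine Set.indicator_nonneg (fun z hz => ?_) z
  have : (0:ℝ) < z := hz
  positivity
lemma gam_neg (m : ℕ) (β : ℝ) (z : ℝ) (hz : z ≤ 0) : gam m β z = 0 := by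
  unfold gam; rw [Set.indicator_of_notMem]; simpa using hz
lemma gam_cont (m : ℕ) (hm : 1 ≤ m) (β : ℝ) : Continuous (gam m β) := by
  have : gam m β = fun z => if z ≤ 0 then 0 else z ^ m * exp (-(z / β)) / (m.factorial * β ^ (m+1)) := by
    funext z; unfold gam Set.indicator; simp only [Set.mem_Ioi]; split_ifs <;> first | rfl | linarith
  rw [this]
  refine Continuous.if_le (by fun_prop) (by fun_prop) (by fun_prop) (by fun_prop) (fun z hz => ?_)
  subst hz; simp [show m ≠ 0 by omega]
lemma gam_bdd (m : ℕ) (hm : 1 ≤ m) (β : ℝ) (hβ : 0 < β) : ∃ B, ∀ z, gam m β z ≤ B := by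
  have hpos : 0 < m.factorial * β ^ (m+1) := by positivity
  refine ⟨m.factorial * β^m / (m.factorial * β ^ (m+1)), fun z => ?_⟩
  by_cases hz : z ∈ Set.Ioi (0:ℝ)
  · unfold gam
    rw [Set.indicator_of_mem hz]
    have hz' : 0 < z := hz
    refine div_le_div_of_nonneg_right ?_ hpos.le
    have h1 := pow_div_factorial_le_exp (z/β) po! m
    rw [exp_neg, ← div_eq_mul_inv, div_le_iff₀ (exp_pos _)]
    rw [div_le_iff₀ po!, div_pow, div_le_iff₀ po!] at h1
    linarith
  · unfold gam
    rw [Set.indicator_of_notMem hz]; positivity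
end
end HTP

namespace HTP
section
open Real MeasureTheory
open Complex (I)
open scoped FourierTransform Convolution
noncomputable def fac (q θ : ℝ) : ℂ := (1 - q) / (1 - q * cex (-(θ * I)))
noncomputable def Phi (α y x t : ℝ) : ℂ :=
  cex (t * log x * I) * ∏ p ∈ primesLE y, fac (p^~α) (t * log p)
noncomputable def ker (α b : ℝ) (r : ℕ) (t : ℝ) : ℂ :=
  ((α + t * I) * (1 + b * t * I) ^ r)⁻¹
lemma norm_one_add (b t : ℝ) : ‖(1 + b * t * I : ℂ)‖ ^ 2 = 1 + (b*t)^2 := by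
  rw [← Complex.normSq_eq_norm_sq, Complex.normSq_apply]; simp; ring
lemma one_le_norm (b t : ℝ) : 1 ≤ ‖(1 + b * t * I : ℂ)‖ := by
  have := norm_one_add b t
  nlinarith [sq_nonneg (b*t), norm_nonneg (1 + b * t * I : ℂ)]
lemma norm_al (α t : ℝ) : ‖(α + t * I : ℂ)‖ ^ 2 = α^2 + t^2 := by
  rw [← Complex.normSq_eq_norm_sq, Complex.normSq_apply]; simp; ring
lemma le_norm_al (α t : ℝ) (hα : 0 < α) : α ≤ ‖(α + t * I : ℂ)‖ := by
  have := norm_al α t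
  nlinarith [sq_nonneg t, norm_nonneg (α + t * I : ℂ)]
lemma le_norm_al' (α t : ℝ) : |t| ≤ ‖(α + t * I : ℂ)‖ := by
  have := norm_al α t
  rw [← sq_abs t] at this
  nlinarith [sq_nonneg α, norm_nonneg (α + t * I : ℂ), abs_nonneg t]
lemma ker_norm_le (α b : ℝ) (hα : 0 < α) (r : ℕ) (hr : 2 ≤ r) (t : ℝ) :
    ‖ker α b r t‖ ≤ α⁻¹ * (1 + (b*t)^2)⁻¹ := by
  unfold ker
  rw [norm_inv, norm_mul, norm_pow, mul_inv]
  have h1 := le_norm_al α t hα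
  have h2 := one_le_norm b t
  rw [← norm_one_add]
  have h3 := pow_le_pow_right₀ h2 hr
  gcongr
lemma ker_cont (α b : ℝ) (hα : 0 < α) (r : ℕ) : Continuous (ker α b r) := by
  unfold ker
  refine Continuous.inv₀ (by fun_prop) (fun t => ?_)
  have h1 := le_norm_al α t hα
  have h2 := one_le_norm b t
  refine mul_ne_zero (norm_pos_iff.1 li!) (pow_ne_zero _ (norm_pos_iff.1 li!))
lemma ker_int (α b : ℝ) (hα : 0 < α) (hb : b ≠ 0) (r : ℕ) (hr : 2 ≤ r) :
    Integrable (ker α b r) := by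
  refine Integrable.mono' (g := fun t => α⁻¹ * (1 + (b*t)^2)⁻¹) ?_
    (ker_cont α b hα r).aestronglyMeasurable
    (Filter.Eventually.of_forall fun t => ker_norm_le α b hα r hr t)
  exact (integrable_inv_one_add_sq.comp_mul_left' hb).const_mul _
lemma hh_nonneg (α w : ℝ) : 0 ≤ hh α w := by
  unfold hh; exact Set.indicator_nonneg (fun _ _ => (exp_pos _).le) _
lemma hh_le (α w : ℝ) : hh α w ≤ exp (-(α*w)) := by
  unfold hh; exact Set.indicator_le_self' (fun _ _ => (exp_pos _).le) _
lemma hh_ft (α : ℝ) (hα : 0 < α) : Integrable (fun w => (hh α w : ℂ)) ∧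
    ∀ t : ℝ, ∫ w : ℝ, cex (-(t * w * I)) * (hh α w : ℂ) = (α + t * I)⁻¹ := by
  have e : ∀ t : ℝ, (fun w : ℝ => cex (-(t * w * I)) * (hh α w : ℂ)) =
    Set.indicator (Set.Ici 0) (fun w : ℝ => cex ((-(α + t * I)) * w)) := by
    intro t; funext w; unfold hh
    by_cases hw : w ∈ Set.Ici (0:ℝ)
    · rw [Set.indicator_of_mem hw, Set.indicator_of_mem hw, Complex.ofReal_exp, ← Complex.exp_add]
      congr 1; push_cast; ring
    · rw [Set.indicator_of_notMem hw, Set.indicator_of_notMem hw]; simp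
  have hre : ∀ t : ℝ, (-(α + t * I) : ℂ).re < 0 := by intro t; simpa using hα
  constructor
  · have h0 := e 0
    simp only [Complex.ofReal_zero, zero_mul, neg_zero, Complex.exp_zero, one_mul] at h0
    rw [h0, integrable_indicator_iff measurableSet_Ici, integrableOn_Ici_iff_integrableOn_Ioi]
    have := integrableOn_exp_mul_complex_Ioi (hre 0) 0
    simpa using this
  · intro t
    rw [e t, integral_indicator measurableSet_Ici, integral_Ici_eq_integral_Ioi,
      integral_exp_mul_complex_Ioi (hre t) 0]
    simp only [Complex.ofReal_zero, mul_zero, Complex.exp_zero]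
    rw [neg_div_neg_eq, one_div]
lemma fourier_expr (f : ℝ → ℂ) (v : ℝ) :
    𝓕 f v = ∫ w : ℝ, cex (-(((2*π*v : ℝ):ℂ) * w * I)) * f w := by
  rw [fourier_real_eq_integral_exp_smul]
  simp only [smul_eq_mul]
  congr 1; funext w; congr 2; push_cast; ring
lemma ker_inv (α b : ℝ) (hα : 0 < α) (hb : b ≠ 0) (r : ℕ) (hr : 2 ≤ r) (G : ℝ → ℝ)
    (hGc : Continuous G) (hGb : ∃ B, ∀ z, |G z| ≤ B) (hGi : Integrable (fun z => (G z : ℂ)))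
    (hGf : ∀ t : ℝ, ∫ z : ℝ, cex (-(t * z * I)) * (G z : ℂ) = ((1 + b * t * I) ^ r)⁻¹)
    (w : ℝ) : ((∫ s, hh α s * G (w - s) : ℝ) : ℂ) =
      ((1 / (2 * π) : ℝ) : ℂ) * ∫ t : ℝ, cex (t * w * I) * ker α b r t := by
  obtain ⟨hi, hft⟩ := hh_ft α hα
  set f : ℝ → ℂ := (fun w => (hh α w : ℂ)) ⋆[ContinuousLinearMap.mul ℂ ℂ] (fun z => (G z : ℂ)) with hf
  have hF : ∀ v, 𝓕 f v = ker α b r (2*π*v) := by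
    intro v
    rw [hf, fourier_mul_convolution_eq hi hGi, fourier_expr, fourier_expr, hft, hGf, ker, mul_inv]
  have hfi : Integrable f := hi.integrable_convolution _ hGi
  have hfc : Continuous f := by
    obtain ⟨B, hB⟩ := hGb
    refine BddAbove.continuous_convolution_right_of_integrable _ ⟨B, ?_⟩ hi (by fun_prop)
    rintro _ ⟨z, rfl⟩; simpa using hB z
  have h2pi : (2*π) ≠ 0 := by positivity
  have hFi : Integrable (𝓕 f) := by
    have : 𝓕 f = fun v => ker α b r (2*π*v) := funext hF
    rw [this]
    exact (ker_int α b hα hb r hr).comp_mul_left' h2pi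
  have key := congrFun (hfc.fourierInv_fourier_eq hfi hFi) w
  have e1 : f w = ((∫ s, hh α s * G (w - s) : ℝ) : ℂ) := by
    rw [hf, convolution_def, ← integral_complex_ofReal]
    congr 1; funext s; simp
  rw [← e1, ← key, fourierInv_eq']
  have := Measure.integral_comp_mul_left (fun t : ℝ => cex (t * w * I) * ker α b r t) (2*π)
  rw [abs_of_pos po!] at this
  rw [← Complex.real_smul, one_div, ← this]
  congr 1; funext v
  rw [hF, smul_eq_mul]; congr 2; simp; ring
end
end HTP

namespace HTP
section
open Real MeasureTheory
open Complex (I)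
lemma cpow_split (α t : ℝ) (n : ℕ) (hn : n ≠ 0) : (n:ℂ) ^ (-(α + t * I : ℂ)) =
    ((n^~α : ℝ) : ℂ) * cex (-(((t * log n : ℝ):ℂ) * I)) := by
  have hn' : (0:ℝ) < n := by positivity
  rw [Complex.cpow_def_of_ne_zero (by exact_mod_cast hn), rpow_def_of_pos hn', Complex.ofReal_exp, ← Complex.exp_add,
    ← Complex.ofReal_natCast, ← Complex.ofReal_log hn'.le]
  congr 1; push_cast; ring
lemma prime_q_lt (p : ℕ) (hp : p.Prime) (α : ℝ) (hα : 0 < α) : p^~α < 1 :=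
  rpow_lt_one_of_one_lt_of_neg (by exact_mod_cast hp.one_lt) li!
lemma mem_primesLE {y : ℝ} {p : ℕ} : p ∈ primesLE y ↔ p ≤ ⌊y⌋₊ ∧ p.Prime := by
  simp [primesLE]
lemma euler_sum (α y t : ℝ) (hα : 0 < α) :
    Summable (fun n : Nat.smoothNumbers (⌊y⌋₊+1) => ((n:ℕ):ℝ)^(-α)) ∧
    HasSum (fun n : Nat.smoothNumbers (⌊y⌋₊+1) => ((((n:ℕ):ℝ)^(-α) : ℝ) : ℂ) * cex (-(((t * log (n:ℕ) : ℝ):ℂ) * I)))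
      ((zetaSmooth α y : ℂ) * ∏ p ∈ primesLE y, fac (p^~α) (t * log p)) := by
  have hs : (α + t * I : ℂ) ≠ 0 := norm_pos_iff.1 (lt_of_lt_of_le hα (le_norm_al α t hα))
  have hne : ∀ n : Nat.smoothNumbers (⌊y⌋₊+1), (n:ℕ) ≠ 0 := fun n => Nat.ne_zero_of_mem_smoothNumbers n.2
  have hnorm : ∀ n : ℕ, n ≠ 0 → ‖(n:ℂ) ^ (-(α + t * I : ℂ))‖ = n^~α := by
    intro n hn
    rw [Complex.norm_natCast_cpow_of_pos (Nat.pos_of_ne_zero hn)]; simp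
  have key := EulerProduct.summable_and_hasSum_smoothNumbers_prod_primesBelow_geometric
    (f := (riemannZetaSummandHom hs : ℕ →* ℂ)) (fun {p} hp => by
      change ‖(p:ℂ) ^ (-(α + t * I : ℂ))‖ < 1
      rw [hnorm p hp.ne_zero]; exact prime_q_lt p hp α hα) (⌊y⌋₊+1)
  obtain ⟨k1, k2⟩ := key
  constructor
  · refine k1.congr (fun n => ?_)
    exact (hnorm n (hne n))
  · convert k2 using 1
    · rfl
    · funext n
      exact (cpow_split α t n (hne n)).symm
    · unfold zetaSmooth
      push_cast
      rw [← Finset.prod_mul_distrib]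
      refine Finset.prod_congr rfl (fun p hp => ?_)
      have hp' := (mem_primesLE.1 hp).2
      have h1 : (1 - ((p^~α : ℝ):ℂ)) ≠ 0 := by
        have := prime_q_lt p hp' α hα
        exact_mod_cast (by linarith : (1 - p^~α) ≠ 0)
      change _ = (1 - (p:ℂ) ^ (-(α + t * I : ℂ)))⁻¹
      rw [cpow_split α t p hp'.ne_zero, fac, div_eq_mul_inv, ← mul_assoc, inv_mul_cancel₀ h1, one_mul]
lemma zetaSmooth_pos (α y : ℝ) (hα : 0 < α) : 0 < zetaSmooth α y :=
  Finset.prod_pos fun p hp => by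
    have := prime_q_lt p (mem_primesLE.1 hp).2 α hα
    exact inv_pos.2 li!
lemma sum_ker (α y x b : ℝ) (hα : 0 < α) (hb : b ≠ 0) (r : ℕ) (hr : 2 ≤ r) (K : ℝ → ℝ)
    (hK : ∀ w, (K w : ℂ) = ((1 / (2 * π) : ℝ) : ℂ) * ∫ t : ℝ, cex (t * w * I) * ker α b r t) :
    HasSum (fun n : Nat.smoothNumbers (⌊y⌋₊+1) => ((n:ℕ):ℝ)^(-α) * K (log x - log (n:ℕ)))
      (zetaSmooth α y * ((1 / (2 * π)) * (∫ t : ℝ, Phi α y x t * ker α b r t).re)) := by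
  have hki := ker_int α b hα hb r hr
  have hkc := ker_cont α b hα r
  have hnn : ∀ n : Nat.smoothNumbers (⌊y⌋₊+1), 0 ≤ ((n:ℕ):ℝ)^(-α) := fun n => by positivity
  have hnorm : ∀ (n : Nat.smoothNumbers (⌊y⌋₊+1)) (t : ℝ),
     ‖((((n:ℕ):ℝ)^(-α) : ℝ) : ℂ) * (cex (t * ((log x - log (n:ℕ) : ℝ) : ℂ) * I) * ker α b r t)‖ =
      ((n:ℕ):ℝ)^(-α) * ‖ker α b r t‖ := by
    intro n t
    rw [norm_mul, norm_mul, ← Complex.ofReal_mul, Complex.norm_exp_ofReal_mul_I, Complex.norm_real, norm_of_nonneg (hnn n), one_mul]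
  have key := hasSum_integral_of_summable_integral_norm (μ := volume)
    (F := fun (n : Nat.smoothNumbers (⌊y⌋₊+1)) (t : ℝ) => ((((n:ℕ):ℝ)^(-α) : ℝ) : ℂ) *
      (cex (t * ((log x - log (n:ℕ) : ℝ) : ℂ) * I) * ker α b r t))
    (fun n => by
      refine Integrable.mono' (hki.norm.const_mul (((n:ℕ):ℝ)^(-α))) (by fun_prop) ?_
      exact Filter.Eventually.of_forall fun t => (hnorm n t).le)
    (by
      simp only [hnorm, integral_const_mul]
      exact (euler_sum α y 0 hα).1.mul_right _)
  have e2 : ∀ t : ℝ, ∑' (n : Nat.smoothNumbers (⌊y⌋₊+1)), ((((n:ℕ):ℝ)^(-α) : ℝ) : ℂ) *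
      (cex (t * ((log x - log (n:ℕ) : ℝ) : ℂ) * I) * ker α b r t) =
      (zetaSmooth α y : ℂ) * (Phi α y x t * ker α b r t) := by
    intro t
    have h := ((euler_sum α y t hα).2.mul_left (cex (t * log x * I) * ker α b r t)).tsum_eq
    have : (zetaSmooth α y : ℂ) * (Phi α y x t * ker α b r t) = (cex (t * log x * I) * ker α b r t) * ((zetaSmooth α y : ℂ) * ∏ p ∈ primesLE y, fac (p^~α) (t * log p)) := by
      unfold Phi; ring
    rw [this, ← h]
    congr 1; funext n
    have : cex (t * ((log x - log (n:ℕ) : ℝ) : ℂ) * I) = cex (t * log x * I) *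
       cex (-(((t * log (n:ℕ) : ℝ):ℂ) * I)) := by
      rw [← Complex.exp_add]; congr 1; push_cast; ring
    rw [this]; ring
  simp only [e2, integral_const_mul] at key
  have key2 := (key.mul_left ((1 / (2 * π) : ℝ) : ℂ))
  have key3 := Complex.reCLM.hasSum key2
  convert key3 using 1
  · funext n
    change _ = (_ : ℂ).re
    rw [mul_left_comm, ← hK, ← Complex.ofReal_mul, Complex.ofReal_re]
  · change _ = (_ : ℂ).re
    rw [mul_left_comm, Complex.re_ofReal_mul, Complex.re_ofReal_mul]
lemma smooth_hasSum (α y x : ℝ) (hx : 0 < x) (hy : 0 ≤ y) :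
    HasSum (fun n : Nat.smoothNumbers (⌊y⌋₊+1) => ((n:ℕ):ℝ)^(-α) * hh α (log x - log (n:ℕ)))
      (x ^ (-α) * smoothCount x y) := by
  classical
  have e : ∀ n : Nat.smoothNumbers (⌊y⌋₊+1), ((n:ℕ):ℝ)^(-α) * hh α (log x - log (n:ℕ)) =
      if ((n:ℕ):ℝ) ≤ x then x^(-α) else 0 := by
    intro n
    have hn : (0:ℝ) < ((n:ℕ):ℝ) := by
      exact_mod_cast Nat.pos_of_ne_zero (Nat.ne_zero_of_mem_smoothNumbers n.2)
    unfold hh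
    by_cases h : ((n:ℕ):ℝ) ≤ x
    · rw [if_pos h, Set.indicator_of_mem (by simpa using log_le_log hn h), rpow_def_of_pos hn, rpow_def_of_pos hx, ← exp_add]
      congr 1; ring
    · rw [if_neg h, Set.indicator_of_notMem, mul_zero]
      simp only [Set.mem_Ici, sub_nonneg, not_le]
      exact log_lt_log hx (not_le.1 h)
  simp only [e]
  set A : Finset ℕ := (Finset.range (⌊x⌋₊+1)).filter (fun n => n ∈ Nat.smoothNumbers (⌊y⌋₊+1)) with hA
  have hfl : ∀ n : ℕ, n < ⌊x⌋₊ + 1 ↔ (n:ℝ) ≤ x := fun n => by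
    rw [Nat.lt_succ_iff, Nat.le_floor_iff hx.le]
  have hcard : smoothCount x y = A.card := by
    refine Nat.subtype_card A (fun n => ?_)
    rw [hA, Finset.mem_filter, Finset.mem_range, hfl, Nat.mem_smoothNumbers']
    constructor
    · rintro ⟨h1, h2⟩
      refine ⟨?_, h1, fun p hp hpn => ?_⟩
      · by_contra h0
        have h0' : n = 0 := by omega
        obtain ⟨p, hp1, hp2⟩ := Nat.exists_infinite_primes (⌊y⌋₊+1)
        have := h2 p hp2 (by simp [h0'])
        omega
      · have := h2 p hp hpn
        rwa [Nat.lt_succ_iff, Nat.le_floor_iff hy] at this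
    · rintro ⟨h1, h2, h3⟩
      refine ⟨h2, fun p hp hpn => ?_⟩
      rw [Nat.lt_succ_iff, Nat.le_floor_iff hy]; exact h3 p hp hpn
  have h1 := hasSum_sum_of_ne_finset_zero (s := A) (L := SummationFilter.unconditional ℕ)
    (f := Set.indicator (Nat.smoothNumbers (⌊y⌋₊+1)) (fun n : ℕ => if (n:ℝ) ≤ x then x^(-α) else 0)) (by
      intro n hn
      rw [hA, Finset.mem_filter, Finset.mem_range, hfl, not_and_or] at hn
      rcases hn with hn | hn
      · by_cases h : n ∈ Nat.smoothNumbers (⌊y⌋₊+1)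
        · rw [Set.indicator_of_mem h, if_neg hn]
        · rw [Set.indicator_of_notMem h]
      · rw [Set.indicator_of_notMem hn])
  have h2 : ∑ n ∈ A, Set.indicator (Nat.smoothNumbers (⌊y⌋₊+1)) (fun n : ℕ => if (n:ℝ) ≤ x then x^(-α) else 0) n = x^(-α) * smoothCount x y := by
    rw [hcard, Finset.sum_congr rfl (g := fun _ => x^(-α))]
    · simp [mul_comm]
    · intro n hn
      rw [hA, Finset.mem_filter, Finset.mem_range, hfl] at hn
      rw [Set.indicator_of_mem hn.2, if_pos hn.1]
  rw [h2] at h1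
  exact hasSum_subtype_iff_indicator.2 h1
lemma lap_real (m : ℕ) (β : ℝ) (hβ : 0 < β) (a : ℝ) (ha : -(1/β) < a) :
    Integrable (fun z : ℝ => exp (-(a * z)) * gam m β z) ∧
    ∫ z : ℝ, exp (-(a * z)) * gam m β z = ((1 + a * β) ^ (m+1))⁻¹ := by
  obtain ⟨h1, h2⟩ := lap_gam m β hβ a (by simpa using ha)
  have e : (fun z : ℝ => cex (-((a:ℂ) * z)) * (gam m β z : ℂ)) =
      fun z : ℝ => ((exp (-(a * z)) * gam m β z : ℝ) : ℂ) := by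
    funext z; push_cast; rfl
  rw [e] at h1 h2
  refine ⟨h1.re, ?_⟩
  rw [integral_complex_ofReal] at h2
  exact_mod_cast h2
theorem reduction (α y x β : ℝ) (hα : 0 < α) (hx : 0 < x) (hy : 0 ≤ y) (hβ : 0 < β) (hαβ : α * β < 1)
    (r : ℕ) (hr : 2 ≤ r) :
    x ^ α * zetaSmooth α y * ((1 - α * β) ^ r * ((1 / (2 * π)) * (∫ t : ℝ, Phi α y x t * ker α β r t).re))
      ≤ smoothCount x y ∧
    (smoothCount x y : ℝ) ≤
      x ^ α * zetaSmooth α y * ((1 + α * β) ^ r * ((1 / (2 * π)) * (∫ t : ℝ, Phi α y x t * ker α (-β) r t).re)) := by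
  obtain ⟨m, rfl⟩ : ∃ m, r = m + 1 := ⟨r - 1, by omega⟩
  have hm : 1 ≤ m := by omega
  have hS := smooth_hasSum α y x hx hy
  have hxx : x ^ α * x ^ (-α) = 1 := by rw [← rpow_add hx]; simp
  have hz := zetaSmooth_pos α y hα
  have hxa : 0 < x ^ α := by positivity
  have hgi : Integrable (fun z => (gam m β z : ℂ)) := by
    have := (lap_gam m β hβ 0 (by simpa using hβ)).1
    simpa using this
  obtain ⟨B, hB⟩ := gam_bdd m hm β hβ
  have hBabs : ∀ z, |gam m β z| ≤ B := fun z => by rw [abs_of_nonneg (gam_nonneg m β hβ z)]; exact hB z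
  have h1b : α < 1/β := by rw [lt_div_iff₀ hβ]; exact hαβ
  constructor
  · have hK := ker_inv α β hα hβ.ne' (m+1) hr (gam m β) (gam_cont m hm β) ⟨B, hBabs⟩ hgi (fun t => by
      have := (lap_gam m β hβ (t * I) (by simpa using hβ)).2
      rw [show (1 + β * t * I : ℂ) = 1 + t * I * β by ring, ← this]
      congr 1; funext z; congr 3; ring)
    have hsum := (sum_ker α y x β hα hβ.ne' (m+1) hr _ hK).mul_left ((1 - α * β)^(m+1))
    have hle : ∀ w, (1 - α * β)^(m+1) * ∫ s, hh α s * gam m β (w - s) ≤ hh α w := by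
      intro w
      have hpos : 0 < (1 - α*β)^(m+1) := pow_pos li! _
      by_cases hw : 0 ≤ w
      · have h2 : ∫ s, hh α s * gam m β (w - s) ≤ ∫ s, exp (-(α * s)) * gam m β (w - s) := by
          obtain ⟨hi, _⟩ := lap_real m β hβ (-α) li!
          refine integral_mono_of_nonneg (Filter.Eventually.of_forall fun s => ?_) ?_
            (Filter.Eventually.of_forall fun s => ?_)
          · exact mul_nonneg (hh_nonneg _ _) (gam_nonneg m β hβ _)
          · have := (hi.comp_sub_left w).const_mul (exp (-(α*w)))
            refine this.congr (Filter.Eventually.of_forall fun s => ?_)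
            simp only
            rw [← mul_assoc, ← exp_add]; congr 2; ring
          · exact mul_le_mul_of_nonneg_right (hh_le _ _) (gam_nonneg m β hβ _)
        have h3 : ∫ s, exp (-(α * s)) * gam m β (w - s) = exp (-(α*w)) * ((1 - α*β)^(m+1))⁻¹ := by
          have h4 := integral_sub_left_eq_self (fun z => exp (-(-α * z)) * gam m β z) volume w
          rw [(lap_real m β hβ (-α) li!).2] at h4
          rw [show (1 - α*β) = 1 + -α * β by ring, ← h4, ← integral_const_mul]
          congr 1; funext s
          rw [← mul_assoc, ← exp_add]; congr 2; ring
        have h5 : hh α w = exp (-(α * w)) := by unfold hh; rw [Set.indicator_of_mem (by simpa using hw)]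
        rw [h5]
        calc _ ≤ (1 - α * β)^(m+1) * (exp (-(α*w)) * ((1 - α*β)^(m+1))⁻¹) := by
              rw [← h3]; exact mul_le_mul_of_nonneg_left h2 hpos.le
          _ = _ := by field_simp
      · have h2 : (fun s => hh α s * gam m β (w - s)) = fun _ => 0 := by
          funext s
          by_cases hs : 0 ≤ s
          · rw [gam_neg m β _ li!, mul_zero]
          · unfold hh; rw [Set.indicator_of_notMem (by simpa using hs), zero_mul]
        rw [h2]; simp [hh_nonneg]
    have := hasSum_le (fun n : Nat.smoothNumbers (⌊y⌋₊+1) => by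
      have h6 := mul_le_mul_of_nonneg_left (hle (log x - log (n:ℕ))) (by positivity : 0 ≤ ((n:ℕ):ℝ)^(-α))
      rw [mul_left_comm] at h6; exact h6) hsum hS
    have h7 := mul_le_mul_of_nonneg_left this hxa.le
    rw [← mul_assoc (x^α) (x^(-α)), hxx, one_mul] at h7
    refine le_trans (le_of_eq ?_) h7
    ring
  · have hK := ker_inv α (-β) hα li! (m+1) hr (fun z => gam m β (-z)) ((gam_cont m hm β).comp continuous_neg)
      ⟨B, fun z => hBabs (-z)⟩ hgi.comp_neg (fun t => by
      have := (lap_gam m β hβ (-(t * I)) (by simpa using hβ)).2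
      rw [show (1 + ((-β : ℝ):ℂ) * t * I : ℂ) = 1 + -(t * I) * β by push_cast; ring, ← this,
        ← integral_neg_eq_self]
      congr 1; funext z; simp only [neg_neg]; congr 3; push_cast; ring)
    have hsum := (sum_ker α y x (-β) hα li! (m+1) hr _ hK).mul_left ((1 + α * β)^(m+1))
    have hle : ∀ w, hh α w ≤ (1 + α * β)^(m+1) * ∫ s, hh α s * gam m β (-(w - s)) := by
      intro w
      have hpos : 0 < (1 + α*β)^(m+1) := by positivity
      by_cases hw : 0 ≤ w
      · have h2 : ∫ s, hh α s * gam m β (-(w - s)) = exp (-(α*w)) * ((1 + α*β)^(m+1))⁻¹ := by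
          have h4 := integral_sub_right_eq_self (μ := volume) (fun z => exp (-(α * z)) * gam m β z) w
          have h0 : -(1/β) < α := lt_trans (by simpa using hβ) hα
          rw [(lap_real m β hβ α h0).2] at h4
          rw [← h4, ← integral_const_mul]
          congr 1; funext s
          by_cases hs : w < s
          · unfold hh
            rw [Set.indicator_of_mem (by simp; linarith), ← mul_assoc, ← exp_add, neg_sub]; congr 2; ring
          · rw [gam_neg m β (-(w-s)) li!, gam_neg m β (s-w) li!]; simp
        have h5 : hh α w = exp (-(α * w)) := by unfold hh; rw [Set.indicator_of_mem (by simpa using hw)]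
        rw [h5, h2]
        exact le_of_eq (by field_simp)
      · have h5 : hh α w = 0 := by unfold hh; rw [Set.indicator_of_notMem (by simpa using hw)]
        rw [h5]
        refine mul_nonneg hpos.le (integral_nonneg fun s => mul_nonneg (hh_nonneg _ _) (gam_nonneg m β hβ _))
    have := hasSum_le (fun n : Nat.smoothNumbers (⌊y⌋₊+1) => by
      have h6 := mul_le_mul_of_nonneg_left (hle (log x - log (n:ℕ))) (by positivity : 0 ≤ ((n:ℕ):ℝ)^(-α))
      rw [mul_left_comm] at h6; exact h6) hS hsum
    have h7 := mul_le_mul_of_nonneg_left this hxa.le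
    rw [← mul_assoc (x^α) (x^(-α)), hxx, one_mul] at h7
    refine le_trans h7 (le_of_eq ?_)
    ring
end
end HTP

namespace HTP
section
open Real MeasureTheory
open Complex (I)
lemma abs_log_one_add_sub (v : ℝ) (hv : 0 ≤ v) : |log (1 + v) - v| ≤ v^2/2 := by
  have h1 : log (1+v) ≤ v := by have := log_le_sub_one_of_pos (by linarith : 0 < 1+v); linarith
  have h2 : v - v^2/2 ≤ log (1+v) := by
    have h3 := le_log_one_add_of_nonneg hv
    refine le_trans ?_ h3
    rw [le_div_iff₀ li!]
    nlinarith [pow_nonneg hv 3]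
  rw [abs_le]; constructor <;> nlinarith
lemma cos_upper (θ : ℝ) : cos θ ≤ 1 - θ^2/2 + θ^4 := by
  by_cases h : |θ| ≤ 1
  · have := (abs_le.1 (cos_bound h)).2
    have h2 : |θ|^4 = θ^4 := by rw [← abs_pow, abs_of_nonneg po!]
    rw [h2] at this
    have : 0 ≤ θ^4 := by positivity
    linarith
  · have h1 : 1 ≤ θ^2 := by rw [← sq_abs]; nlinarith [not_le.1 h]
    nlinarith [cos_le_one θ]
lemma ker_log (s : ℝ) : ∃ R T : ℝ, (1 + s * I : ℂ)⁻¹ = cex (R + T * I) ∧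
    |R| ≤ s^2/2 ∧ |T| ≤ |s| := by
  refine ⟨-(log (1+s^2))/2, -arctan s, ?_, ?_, ?_⟩
  · have hpos : 0 < 1 + s^2 := by positivity
    have h1 : (1 + s * I : ℂ) = cex (((log (1+s^2))/2 : ℝ) + arctan s * I) := by
      rw [Complex.exp_add, Complex.exp_mul_I, ← Complex.ofReal_exp, ← Complex.ofReal_cos, ← Complex.ofReal_sin,
        cos_arctan, sin_arctan]
      have h2 : exp (log (1+s^2)/2) = sqrt (1+s^2) := by
        rw [sqrt_eq_rpow, rpow_def_of_pos hpos]; congr 1; ring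
      have h3 : sqrt (1+s^2) ≠ 0 := by positivity
      rw [h2]
      have h3' : ((sqrt (1+s^2) : ℝ):ℂ) ≠ 0 := by exact_mod_cast h3
      push_cast
      field_simp
    rw [h1, ← Complex.exp_neg]; congr 1; push_cast; ring
  · have := abs_log_one_add_sub (s^2) po!
    have h1 : log (1+s^2) ≤ s^2 := by have := log_le_sub_one_of_pos (by positivity : 0 < 1+s^2); linarith
    have h2 : 0 ≤ log (1+s^2) := log_nonneg (by nlinarith [sq_nonneg s])
    rw [abs_le]; constructor <;> linarith
  · rw [abs_neg]
    have h := Convex.norm_image_sub_le_of_norm_hasDerivWithin_le (f := arctan) (f' := fun x => 1/(1+x^2)) (s := Set.univ) (C := 1) (x := 0) (y := s)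
      (fun x _ => (hasDerivAt_arctan x).hasDerivWithinAt) (fun x _ => by
        rw [norm_of_nonneg po!, div_le_one po!]; nlinarith [sq_nonneg x]) convex_univ trivial trivial
    simpa using h
/-- modulus -/
lemma fac_norm (q θ : ℝ) (hq : 0 < q) (hq1 : q < 1) :
    ‖fac q θ‖ ^ 2 = (1 + 2*q/(1-q)^2 * (1 - cos θ))⁻¹ := by
  unfold fac
  have h1 : (0:ℝ) < 1 - q := by linarith
  have e1 : ‖(1 - q * cex (-(θ * I)) : ℂ)‖^2 = (1-q)^2 + 2*q*(1-cos θ) := by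
    rw [← Complex.normSq_eq_norm_sq, Complex.normSq_apply]
    have : cex (-(θ * I)) = (cos θ : ℂ) - sin θ * I := by
      rw [← neg_mul, ← Complex.ofReal_neg, Complex.exp_mul_I]; simp; ring
    rw [this]
    simp [-Complex.ofReal_cos, -Complex.ofReal_sin]
    nlinarith [sin_sq_add_cos_sq θ]
  have e2 : ‖(1 - q : ℂ)‖ = 1 - q := by
    rw [← Complex.ofReal_one, ← Complex.ofReal_sub, Complex.norm_real, norm_of_nonneg h1.le]
  rw [norm_div, div_pow, e1, e2]
  have h3 : 0 ≤ 1 - cos θ := by linarith [cos_le_one θ]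
  have h2 : (1-q)^2 + 2*q*(1-cos θ) ≠ 0 := by positivity
  have h4 : (1 + 2*q/(1-q)^2 * (1 - cos θ)) = ((1-q)^2 + 2*q*(1-cos θ)) / (1-q)^2 := by field_simp
  rw [h4, inv_div]
lemma fac_arg (q θ : ℝ) (hq : 0 < q) (hq1 : q < 1) :
    ∃ T : ℝ, fac q θ * cex (θ * (q/(1-q)) * I) = ‖fac q θ‖ * cex (T * I) ∧
      |T| ≤ q * |θ|^3 / (1-q)^3 := by
  have h1 : (0:ℝ) < 1 - q := by linarith
  set z : ℝ → ℂ := fun θ => 1 - q * cex (-(θ * I)) with hz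
  have hexp : ∀ θ : ℝ, cex (-(θ * I)) = (cos θ : ℂ) - sin θ * I := by
    intro θ
    rw [← neg_mul, ← Complex.ofReal_neg, Complex.exp_mul_I]; simp; ring
  have hre : ∀ θ, 0 < (z θ).re := by
    intro θ
    simp only [hz, hexp]; simp [-Complex.ofReal_cos, -Complex.ofReal_sin]
    nlinarith [cos_le_one θ]
  have hz0 : ∀ θ, z θ ≠ 0 := fun θ h => by have := hre θ; rw [h] at this; simp at this
  have hder : ∀ θ : ℝ, HasDerivAt (fun θ : ℝ => (Complex.log (z θ)).im - θ * (q/(1-q)))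
      (-(q*(1+q)*(1-cos θ)/((1-q)*((1-q)^2 + 2*q*(1-cos θ))))) θ := by
    intro θ
    have d1 : HasDerivAt (fun z : ℝ => (z:ℂ)) 1 θ := Complex.ofRealCLM.hasDerivAt
    have d2 : HasDerivAt z (q * I * cex (-(θ * I))) θ := by
      have := (((d1.mul_const I).neg.cexp).const_mul (q:ℂ)).const_sub 1
      refine this.congr_deriv ?_
      simp only [Pi.neg_apply]; ring
    have d3 := d2.clog_real (Or.inl (hre θ))
    have d4 := (Complex.imCLM.hasFDerivAt.comp_hasDerivAt θ d3)
    have d5 := d4.sub ((hasDerivAt_id θ).mul_const (q/(1-q)))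
    refine d5.congr_deriv ?_
    have h3 : 0 ≤ 1 - cos θ := by linarith [cos_le_one θ]
    have hD : (1-q)^2 + 2*q*(1-cos θ) ≠ 0 := by positivity
    have hn : Complex.normSq (z θ) = (1-q)^2 + 2*q*(1-cos θ) := by
      rw [Complex.normSq_apply]; simp only [hz, hexp]; simp [-Complex.ofReal_cos, -Complex.ofReal_sin]; nlinarith [sin_sq_add_cos_sq θ]
    have e : (q * I * cex (-(θ * I)) / z θ).im = (q * cos θ - q^2) / ((1-q)^2 + 2*q*(1-cos θ)) := by
      rw [Complex.div_im, hn, ← sub_div]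
      congr 1
      simp only [hz, hexp]; simp [-Complex.ofReal_cos, -Complex.ofReal_sin]
      nlinarith [sin_sq_add_cos_sq θ]
    change (q * I * cex (-(θ * I)) / z θ).im - _ = _
    rw [e, one_mul, div_sub_div _ _ hD h1.ne', ← neg_div, div_eq_div_iff po! po!]
    ring
  refine ⟨-((Complex.log (z θ)).im - θ * (q/(1-q))), ?_, ?_⟩
  · have hl : z θ = ‖z θ‖ * cex ((Complex.log (z θ)).im * I) := by
      rw [Complex.log_im]; exact (Complex.norm_mul_exp_arg_mul_I (z θ)).symm
    have hfz : fac q θ = (1-q) / z θ := rfl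
    have hnz : ‖fac q θ‖ = (1-q)/‖z θ‖ := by
      rw [hfz, norm_div, ← Complex.ofReal_one, ← Complex.ofReal_sub, Complex.norm_real, norm_of_nonneg h1.le]
    have hnz0 : (‖z θ‖ : ℂ) ≠ 0 := by exact_mod_cast (norm_ne_zero_iff.2 (hz0 θ))
    rw [hnz, hfz]
    nth_rewrite 1 [hl]
    push_cast
    rw [neg_sub, sub_mul, Complex.exp_sub]
    have := Complex.exp_ne_zero ((Complex.log (z θ)).im * I)
    field_simp
  · rw [abs_neg]
    have h := Convex.norm_image_sub_le_of_norm_hasDerivWithin_le (f := fun θ : ℝ => (Complex.log (z θ)).im - θ * (q/(1-q)))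
      (f' := fun θ => (-(q*(1+q)*(1-cos θ)/((1-q)*((1-q)^2 + 2*q*(1-cos θ)))))) (s := Set.uIcc 0 θ) (C := q*θ^2/(1-q)^3) (x := 0) (y := θ)
      (fun x _ => (hder x).hasDerivWithinAt) (fun x hx => by
        have h3 : 0 ≤ 1 - cos x := by linarith [cos_le_one x]
        have hx2 : x^2 ≤ θ^2 := by
          have := Set.abs_sub_left_of_mem_uIcc hx
          rw [sub_zero, sub_zero] at this
          exact sq_le_sq.2 this
        have h4 : 1 - cos x ≤ θ^2/2 := by have := one_sub_sq_div_two_le_cos (x := x); linarith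
        rw [norm_neg, norm_of_nonneg po!]
        have h6 : (1-q)*(1-q)^2 ≤ (1-q)*((1-q)^2 + 2*q*(1-cos x)) := by gcongr; nlinarith [mul_nonneg hq.le h3]
        calc _ ≤ q*(1+1)*(θ^2/2)/((1-q)*(1-q)^2) := by gcongr
          _ = _ := by field_simp; ring) (convex_uIcc _ _) Set.left_mem_uIcc Set.right_mem_uIcc
    have h0 : (Complex.log (z 0)).im = 0 := by
      have : z 0 = ((1-q : ℝ):ℂ) := by simp [hz]
      rw [this, Complex.log_im, Complex.arg_ofReal_of_nonneg h1.le]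
    rw [h0] at h
    simp only [zero_mul, sub_zero, norm_eq_abs] at h
    refine h.trans (le_of_eq ?_)
    rw [← sq_abs θ]; ring
end
end HTP

namespace HTP
section
open Real MeasureTheory
open Complex (I)
lemma fac_exp (q θ : ℝ) (hq : 0 < q) (hq1 : q < 1) : ∃ R T : ℝ,
    cex (θ * (q/(1-q)) * I) * fac q θ = cex (((-(q/(1-q)^2*θ^2/2) + R : ℝ):ℂ) + T * I) ∧
    |R| ≤ (2*q/(1-q)^2 + (2*q/(1-q)^2)^2) * θ^4 ∧ |T| ≤ q * |θ|^3 / (1-q)^3 := by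
  obtain ⟨T, hT, hT2⟩ := fac_arg q θ hq hq1
  have hn := fac_norm q θ hq hq1
  have h1 : (0:ℝ) < 1 - q := by linarith
  have hM : 0 < 2*q/(1-q)^2 := by positivity
  have hκ : q/(1-q)^2 = 2*q/(1-q)^2/2 := by ring
  set M := 2*q/(1-q)^2
  have hv0 : 0 ≤ 1 - cos θ := by linarith [cos_le_one θ]
  have hv1 : 1 - cos θ ≤ θ^2/2 := by have := one_sub_sq_div_two_le_cos (x := θ); linarith
  have hv2 := cos_upper θ
  set v := 1 - cos θ
  have hpos : 0 < 1 + M * v := by positivity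
  have hnpos : 0 < ‖fac q θ‖ := by
    have : 0 < ‖fac q θ‖^2 := by rw [hn]; positivity
    by_contra h
    have h0 : ‖fac q θ‖ = 0 := le_antisymm (not_lt.1 h) (norm_nonneg _)
    rw [h0] at this; simp at this
  have hlog : log ‖fac q θ‖ = -(log (1 + M*v))/2 := by
    have := congrArg log hn
    rw [log_pow, log_inv] at this
    push_cast at this; linarith
  refine ⟨log ‖fac q θ‖ + M/2*θ^2/2, T, ?_, ?_, hT2⟩
  · rw [mul_comm, hT, Complex.exp_add, hκ, neg_add_cancel_comm_assoc, ← Complex.ofReal_exp, exp_log hnpos]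
  · rw [hlog]
    have a1 := abs_log_one_add_sub (M*v) po!
    have a2 : (M*v)^2 ≤ M^2*θ^4 := by
      have : v^2 ≤ θ^4 := by nlinarith [sq_nonneg θ]
      rw [mul_pow]; gcongr
    have a3 : |M*v - M*θ^2/2| ≤ M*θ^4 := by
      rw [abs_le]; constructor
      · have : -θ^4 ≤ v - θ^2/2 := by simp only [v]; linarith
        nlinarith
      · nlinarith [mul_nonneg hM.le (by positivity : 0 ≤ θ^4)]
    rw [abs_le] at a1 a3 ⊢
    have : 0 ≤ M*θ^4 := by positivity
    have : 0 ≤ M^2*θ^4 := by positivity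
    constructor <;> nlinarith [a1.1, a1.2, a3.1, a3.2]
lemma prod_exp (P : Finset ℕ) (q l : ℕ → ℝ) (B t : ℝ) (hq : ∀ i ∈ P, 0 < q i ∧ q i < 1) (hl : ∀ i ∈ P, 0 ≤ l i)
    (hB : ∀ i ∈ P, l i / (1 - q i) ≤ B) : ∃ R T : ℝ,
    cex (t * ((∑ i ∈ P, l i * (q i / (1 - q i)) : ℝ):ℂ) * I) * ∏ i ∈ P, fac (q i) (t * l i) =
      cex (((-((∑ i ∈ P, q i / (1 - q i)^2 * l i^2) * t^2/2) + R : ℝ):ℂ) + T * I) ∧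
    |R| ≤ 6 * B^2 * (∑ i ∈ P, q i / (1 - q i)^2 * l i^2) * t^4 ∧
    |T| ≤ B * (∑ i ∈ P, q i / (1 - q i)^2 * l i^2) * |t|^3 := by
  have h : ∀ i ∈ P, ∃ R T : ℝ, cex ((t * l i : ℝ) * (q i/(1-q i)) * I) * fac (q i) (t * l i) =
      cex (((-(q i/(1-q i)^2*(t * l i)^2/2) + R : ℝ):ℂ) + T * I) ∧
    |R| ≤ 6 * B^2 * (q i / (1 - q i)^2 * l i^2) * t^4 ∧ |T| ≤ B * (q i / (1 - q i)^2 * l i^2) * |t|^3 := by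
    intro i hi
    obtain ⟨h1, h2⟩ := hq i hi
    have h3 := hl i hi
    have h4 := hB i hi
    have h5 : 0 < 1 - q i := by linarith
    obtain ⟨R, T, e, e1, e2⟩ := fac_exp (q i) (t * l i) h1 h2
    have h6 : l i ≤ B := le_trans (by rw [le_div_iff₀ h5]; nlinarith) h4
    have h7 : l i ^2 ≤ B^2 := by gcongr
    have h8 : q i/(1-q i)^2 * l i^2 ≤ B^2 := by
      have : (l i / (1 - q i))^2 ≤ B^2 := by gcongr
      rw [div_pow] at this
      calc _ = q i * (l i^2 / (1-q i)^2) := by ring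
        _ ≤ 1 * (l i^2 / (1-q i)^2) := by gcongr
        _ ≤ _ := by linarith
    refine ⟨R, T, e, e1.trans ?_, e2.trans ?_⟩
    · set κ := q i / (1-q i)^2 with hκ
      have : 2 * q i/(1-q i)^2 = 2*κ := by rw [hκ]; ring
      have hk : 0 < κ := by positivity
      rw [this]
      have t4 : 0 ≤ t^4 := by positivity
      have a : (2*κ + (2*κ)^2) * l i^4 ≤ 6*B^2*(κ * l i^2) := by
        have a1 : κ * l i^2 * l i^2 ≤ κ * l i^2 * B^2 := by gcongr
        have a2 : κ * l i^2 * (κ * l i^2) ≤ κ * l i^2 * B^2 := by gcongr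
        nlinarith
      calc _ = ((2*κ + (2*κ)^2) * l i^4) * t^4 := by ring
        _ ≤ _ := by gcongr
    · rw [abs_mul, abs_of_nonneg h3]
      have := mul_le_mul_of_nonneg_right h4 (by positivity : 0 ≤ q i / (1 - q i)^2 * l i^2 * |t|^3)
      calc _ = l i / (1 - q i) * (q i / (1 - q i)^2 * l i^2 * |t|^3) := by field_simp
        _ ≤ _ := by linarith
  choose! R T h1 h2 h3 using h
  refine ⟨∑ i ∈ P, R i, ∑ i ∈ P, T i, ?_, ?_, ?_⟩
  · have e : cex (t * ((∑ i ∈ P, l i * (q i / (1 - q i)) : ℝ):ℂ) * I) =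
      ∏ i ∈ P, cex ((t * l i : ℝ) * (q i/(1-q i)) * I) := by
      rw [← Complex.exp_sum, ← Finset.sum_mul]; push_cast; rw [Finset.mul_sum]; congr 2
      refine Finset.sum_congr rfl fun i _ => by ring
    rw [e, ← Finset.prod_mul_distrib, Finset.prod_congr rfl h1, ← Complex.exp_sum]
    congr 1
    have e2 : -((∑ i ∈ P, q i / (1 - q i)^2 * l i^2) * t^2/2) + ∑ i ∈ P, R i =
        ∑ i ∈ P, (-(q i/(1-q i)^2*(t * l i)^2/2) + R i) := by
      rw [Finset.sum_add_distrib, Finset.sum_mul, Finset.sum_div, ← Finset.sum_neg_distrib]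
      congr 1
      refine Finset.sum_congr rfl fun i _ => by ring
    rw [Finset.sum_add_distrib, ← Finset.sum_mul, e2, Complex.ofReal_sum, Complex.ofReal_sum]
  · refine (Finset.abs_sum_le_sum_abs _ _).trans ((Finset.sum_le_sum h2).trans (le_of_eq ?_))
    rw [Finset.mul_sum, Finset.sum_mul]
  · refine (Finset.abs_sum_le_sum_abs _ _).trans ((Finset.sum_le_sum h3).trans (le_of_eq ?_))
    rw [Finset.mul_sum, Finset.sum_mul]
lemma ker_exp (α b B A : ℝ) (hα : 0 < α) (r : ℕ) (hB : 1/α ≤ B) (hA : 0 ≤ A) (hr : r * |b| ≤ A * B) (t : ℝ) : ∃ R T : ℝ,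
    α * ker α b r t = cex ((R:ℂ) + T * I) ∧ |R| ≤ (1 + A)^2 * B^2 * t^2 ∧ |T| ≤ (1+A) * B * |t| := by
  obtain ⟨R1, T1, e1, a1, b1⟩ := ker_log (t/α)
  obtain ⟨R2, T2, e2, a2, b2⟩ := ker_log (b*t)
  have hB0 : 0 < B := lt_of_lt_of_le po! hB
  refine ⟨R1 + r * R2, T1 + r * T2, ?_, ?_, ?_⟩
  · have : α * ker α b r t = (1 + ((t/α : ℝ):ℂ) * I)⁻¹ * ((1 + ((b*t : ℝ):ℂ) * I)⁻¹)^r := by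
      unfold ker
      have hα' : (α:ℂ) ≠ 0 := by exact_mod_cast hα.ne'
      have : (α + t * I : ℂ) = α * (1 + ((t/α : ℝ):ℂ) * I) := by push_cast; field_simp
      rw [this, mul_inv, mul_inv, inv_pow]; push_cast
      field_simp
    rw [this, e1, e2, ← Complex.exp_nat_mul, ← Complex.exp_add]
    congr 1; push_cast; ring
  · have h1 : (t/α)^2 ≤ B^2*t^2 := by
      rw [div_eq_mul_one_div, mul_pow, mul_comm]; gcongr
    have h2 : r * (b*t)^2 ≤ A^2*B^2*t^2 := by
      have h3 : (r * |b|)^2 ≤ (A*B)^2 := by gcongr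
      have h4 : (r:ℝ) * |b|^2 ≤ (r*|b|)^2 := by
        rw [mul_pow]; gcongr
        rcases Nat.eq_zero_or_pos r with h | h
        · simp [h]
        · have : (1:ℝ) ≤ r := by exact_mod_cast h
          nlinarith
      rw [sq_abs] at h4
      calc _ = (r * b^2) * t^2 := by ring
        _ ≤ (A*B)^2*t^2 := by gcongr; linarith
        _ = _ := by ring
    have h3 : |R1 + r*R2| ≤ |R1| + r * |R2| := by
      refine (abs_add_le _ _).trans ?_
      rw [abs_mul, Nat.abs_cast]
    have h4 : (r:ℝ) * |R2| ≤ r * ((b*t)^2/2) := by gcongr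
    have : 0 ≤ A * B^2*t^2 := by positivity
    have : 0 ≤ A^2 * B^2*t^2 := by positivity
    have : 0 ≤ B^2*t^2 := by positivity
    nlinarith
  · have h3 : |T1 + r*T2| ≤ |T1| + r * |T2| := by
      refine (abs_add_le _ _).trans ?_
      rw [abs_mul, Nat.abs_cast]
    have h4 : (r:ℝ) * |T2| ≤ r * (|b| * |t|) := by rw [← abs_mul]; gcongr
    have h5 : |t/α| ≤ B * |t| := by
      rw [abs_div, abs_of_pos hα, div_eq_mul_one_div, mul_comm]; gcongr
    have h6 : r * (|b| * |t|) ≤ A * B * |t| := by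
      rw [← mul_assoc]; gcongr
    linarith
end
end HTP

namespace HTP
section
open Real MeasureTheory
open Complex (I)
lemma q_pos (α : ℝ) (p : ℕ) (hp : p.Prime) : 0 < p^~α :=
  rpow_pos_of_pos (by exact_mod_cast hp.pos) _
lemma prime_mem {y : ℝ} (hy : 0 ≤ y) {p : ℕ} : p ∈ primesLE y ↔ (p:ℝ) ≤ y ∧ p.Prime := by
  rw [mem_primesLE, Nat.le_floor_iff hy]
lemma log_prime_pos {p : ℕ} (hp : p.Prime) : 0 < log p := log_pos (by exact_mod_cast hp.one_lt)
lemma log_le_of_mem {y : ℝ} (hy : 0 ≤ y) {p : ℕ} (h : p ∈ primesLE y) : log p ≤ log y := by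
  obtain ⟨h1, h2⟩ := (prime_mem hy).1 h
  exact log_le_log (by exact_mod_cast h2.pos) h1
lemma q_exp (α : ℝ) (p : ℕ) (hp : p.Prime) : p^~α = exp (-(α * log p)) := by
  rw [rpow_def_of_pos (by exact_mod_cast hp.pos)]; congr 1; ring
lemma log_div_le (α : ℝ) (hα : 0 < α) (p : ℕ) (hp : p.Prime) :
    log p / (1 - p^~α) ≤ log p + 1/α := by
  have h1 := prime_q_lt p hp α hα
  have hl := log_prime_pos hp
  rw [div_le_iff₀ li!]
  rw [q_exp α p hp, exp_neg]
  have hv : 0 < α * log p := by positivity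
  have h2 := add_one_le_exp (α * log p)
  have h3 : (exp (α * log p))⁻¹ ≤ (α * log p + 1)⁻¹ := by gcongr
  have h4 : (log p + 1/α) * (1 - (α * log p + 1)⁻¹) = log p := by
    have : α * log p + 1 ≠ 0 := by positivity
    field_simp; ring
  have h5 : 0 < log p + 1/α := by positivity
  nlinarith
lemma rpow_q (α : ℝ) (hα : 0 < α) (p : ℕ) (hp : p.Prime) : ((p:ℝ)^α - 1) = (1 - p^~α) * (p^~α)⁻¹ := by
  have h := q_pos α p hp
  rw [sub_mul, mul_inv_cancel₀ h.ne', rpow_neg po!, inv_inv, one_mul]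
lemma phi2_eq (α y : ℝ) (hα : 0 < α) :
    phi2 α y = ∑ p ∈ primesLE y, p^~α / (1 - p^~α)^2 * log p^2 := by
  unfold phi2
  refine Finset.sum_congr rfl fun p hp => ?_
  have hp := (mem_primesLE.1 hp).2
  have h := q_pos α p hp
  have h1 := prime_q_lt p hp α hα
  have h2 : 1 - p^~α ≠ 0 := by linarith
  rw [rpow_q α hα p hp]
  have : (p:ℝ)^α = (p^~α)⁻¹ := by rw [rpow_neg po!, inv_inv]
  rw [this]
  field_simp
lemma phi1_eq (α y : ℝ) (hα : 0 < α) :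
    -phi1 α y = ∑ p ∈ primesLE y, log p * (p^~α / (1 - p^~α)) := by
  unfold phi1
  rw [neg_neg]
  refine Finset.sum_congr rfl fun p hp => ?_
  have hp := (mem_primesLE.1 hp).2
  have h := q_pos α p hp
  have h1 := prime_q_lt p hp α hα
  have h2 : 1 - p^~α ≠ 0 := by linarith
  rw [rpow_q α hα p hp]
  field_simp
lemma Phi_norm_sq (α y x t : ℝ) (hα : 0 < α) : ‖Phi α y x t‖^2 =
    ∏ p ∈ primesLE y, (1 + 2*p^~α/(1-p^~α)^2 * (1 - cos (t * log p)))⁻¹ := by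
  unfold Phi
  rw [norm_mul, ← Complex.ofReal_mul, Complex.norm_exp_ofReal_mul_I, one_mul, norm_prod, ← Finset.prod_pow]
  refine Finset.prod_congr rfl fun p hp => ?_
  have hp := (mem_primesLE.1 hp).2
  rw [fac_norm _ _ (q_pos α p hp) (prime_q_lt p hp α hα)]
lemma Phi_fac_pos (α t : ℝ) (hα : 0 < α) (p : ℕ) (hp : p.Prime) :
    0 ≤ 2*p^~α/(1-p^~α)^2 * (1 - cos (t * log p)) := by
  have h := q_pos α p hp
  have h1 := prime_q_lt p hp α hα
  have := cos_le_one (t * log p)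
  have : 0 ≤ 1 - cos (t * log p) := by linarith
  positivity
lemma Phi_norm_le_one (α y x t : ℝ) (hα : 0 < α) : ‖Phi α y x t‖ ≤ 1 := by
  have : ‖Phi α y x t‖^2 ≤ 1 := by
    rw [Phi_norm_sq α y x t hα]
    refine Finset.prod_le_one (fun p hp => ?_) (fun p hp => ?_)
    · have := Phi_fac_pos α t hα p (mem_primesLE.1 hp).2
      positivity
    · have := Phi_fac_pos α t hα p (mem_primesLE.1 hp).2
      exact inv_le_one_of_one_le₀ li!
  nlinarith [norm_nonneg (Phi α y x t)]
lemma Phi_cont (α y x : ℝ) (hα : 0 < α) : Continuous (Phi α y x) := by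
  unfold Phi fac
  refine Continuous.mul (by fun_prop) (continuous_finsetProd _ fun p hp => ?_)
  refine Continuous.div (by fun_prop) (by fun_prop) fun t h => ?_
  have hp := (mem_primesLE.1 hp).2
  have h1 := prime_q_lt p hp α hα
  have h2 := q_pos α p hp
  have h3 : (1:ℂ) = (p^~α : ℝ) * cex (-(((t * log p : ℝ):ℂ) * I)) := by
    linear_combination h
  have h4 := congrArg norm h3
  rw [norm_mul, ← neg_mul, ← Complex.ofReal_neg, Complex.norm_exp_ofReal_mul_I, Complex.norm_real, norm_eq_abs,
    abs_of_pos h2] at h4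
  simp at h4
  linarith
lemma F_int (α b y x : ℝ) (hα : 0 < α) (hb : b ≠ 0) (r : ℕ) (hr : 2 ≤ r) :
    Integrable (fun t => Phi α y x t * ker α b r t) :=
  (ker_int α b hα hb r hr).bdd_mul (Phi_cont α y x hα).aestronglyMeasurable
    (Filter.Eventually.of_forall fun t => Phi_norm_le_one α y x t hα)
lemma F_norm_le (α b y x : ℝ) (hα : 0 < α) (r : ℕ) (t : ℝ) : ‖(α:ℂ) * (Phi α y x t * ker α b r t)‖ ≤ ‖Phi α y x t‖ := by
  rw [norm_mul, norm_mul, Complex.norm_real, norm_of_nonneg hα.le]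
  have : ‖ker α b r t‖ ≤ α⁻¹ := by
    unfold ker
    rw [norm_inv, norm_mul, norm_pow]
    have h1 := le_norm_al α t hα
    have h2 : 1 ≤ ‖(1 + b * t * I : ℂ)‖ ^ r := one_le_pow₀ (one_le_norm b t)
    gcongr
    nlinarith [norm_nonneg (α + t * I : ℂ)]
  calc _ ≤ α * (‖Phi α y x t‖ * α⁻¹) := by gcongr
    _ = _ := by field_simp
lemma Phi_near (α y x B t : ℝ) (hα : 0 < α) (hy : 2 ≤ y) (hB : B = log y + 1/α) (ht : |t| ≤ π / log y) :
    ‖Phi α y x t‖^2 ≤ (1 + 4/π^2*B^2*t^2)^(-(phi2 α y / B^2)) := by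
  have hL : 0 < log y := log_pos li!
  have hB0 : 0 < B := by rw [hB]; positivity
  have hpi := pi_pos
  set S := 1 + 4/π^2*B^2*t^2 with hS
  have hS1 : 1 ≤ S := by rw [hS]; have : 0 ≤ 4/π^2*B^2*t^2 := po!; linarith
  rw [Phi_norm_sq α y x t hα, Finset.prod_inv_distrib, rpow_neg li!, phi2_eq α y hα, Finset.sum_div,
    rpow_sum_of_pos li!]
  refine inv_anti₀ (Finset.prod_pos fun p hp => by positivity) (Finset.prod_le_prod (fun p hp => by positivity) fun p hp => ?_)
  have hpp := (mem_primesLE.1 hp).2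
  have h := q_pos α p hpp
  have h1 := prime_q_lt p hpp α hα
  have hl := log_prime_pos hpp
  have hl2 := log_le_of_mem li! hp
  set q := p^~α with hq
  set l := log p
  have h1' : 0 < 1 - q := by linarith
  have hz : q/(1-q)^2*l^2/B^2 ≤ 1 := by
    have a : l/(1-q) ≤ B := (log_div_le α hα p hpp).trans (by rw [hB]; linarith)
    have b : (l/(1-q))^2 ≤ B^2 := by gcongr
    rw [div_le_one po!]
    calc _ = q * (l/(1-q))^2 := by field_simp
      _ ≤ 1 * (l/(1-q))^2 := by gcongr
      _ ≤ _ := by linarith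
  refine (rpow_one_add_le_one_add_mul_self (by linarith [(by positivity : 0 ≤ 4/π^2*B^2*t^2)]) po! hz).trans ?_
  have hc : cos (t * l) ≤ 1 - 2/π^2*(t*l)^2 := by
    refine cos_le_one_sub_mul_cos_sq ?_
    rw [abs_mul, abs_of_pos hl]
    calc _ ≤ π / log y * log y := by gcongr
      _ = _ := by field_simp
  have : q/(1-q)^2*l^2/B^2 * (4/π^2*B^2*t^2) = 2*q/(1-q)^2 * (2/π^2*(t*l)^2) := by
    field_simp; ring
  rw [this]
  gcongr
  linarith
lemma F_exp (α b B A x y : ℝ) (hα : 0 < α) (hy : 2 ≤ y) (hB : B = log y + 1/α) (hA : 0 ≤ A) (r : ℕ)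
    (hr : r * |b| ≤ A * B) (hs : phi1 α y + log x = 0) (t : ℝ) : ∃ R T : ℝ,
    α * (Phi α y x t * ker α b r t) = cex (((-(phi2 α y * t^2/2) + R : ℝ):ℂ) + T * I) ∧
    |R| ≤ 6 * B^2 * phi2 α y * t^4 + (1+A)^2*B^2*t^2 ∧ |T| ≤ B * phi2 α y * |t|^3 + (1+A)*B * |t| := by
  have hL : 0 < log y := log_pos li!
  obtain ⟨R1, T1, e1, a1, b1⟩ := prod_exp (primesLE y) (fun p => p^~α) (fun p => log p) B t
    (fun p hp => ⟨q_pos α p (mem_primesLE.1 hp).2, prime_q_lt p (mem_primesLE.1 hp).2 α hα⟩)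
    (fun p hp => (log_prime_pos (mem_primesLE.1 hp).2).le)
    (fun p hp => (log_div_le α hα p (mem_primesLE.1 hp).2).trans (by
      rw [hB]; have := log_le_of_mem li! hp; linarith))
  obtain ⟨R2, T2, e2, a2, b2⟩ := ker_exp α b B A hα r (by rw [hB]; linarith) hA hr t
  have hx : log x = ∑ p ∈ primesLE y, log p * (p^~α / (1 - p^~α)) := by
    rw [← phi1_eq α y hα]; linarith
  rw [← phi2_eq α y hα] at a1 b1 e1
  rw [← hx] at e1
  refine ⟨R1 + R2, T1 + T2, ?_, ?_, ?_⟩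
  · calc _ = Phi α y x t * (α * ker α b r t) := by ring
      _ = _ := by
        rw [e2]; unfold Phi; rw [e1, ← Complex.exp_add]; congr 1; push_cast; ring
  · exact (abs_add_le _ _).trans li!
  · exact (abs_add_le _ _).trans li!
end
end HTP

namespace HTP
section
open Real MeasureTheory
lemma exp_ge2 (w : ℝ) (hw : 0 ≤ w) : w^2/2 ≤ exp w := by
  have := quadratic_le_exp_of_nonneg hw; linarith
lemma exp_ge3 (w : ℝ) (hw : 0 ≤ w) : w^3/6 ≤ exp w := by
  have := pow_div_factorial_le_exp w hw 3
  norm_num [Nat.factorial] at this; linarith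
lemma exp_cos_near (R T : ℝ) : |exp R * cos T - 1| ≤ exp |R| * (|R| + T^2/2) := by
  have h1 := one_sub_sq_div_two_le_cos (x := T)
  have h2 := cos_le_one T
  have h3 : exp R ≤ exp |R| := exp_le_exp.2 (le_abs_self R)
  have h4 : R + 1 ≤ exp R := add_one_le_exp R
  have h5 : exp R - 1 ≤ R * exp R := by
    have a := add_one_le_exp (-R)
    have b := exp_pos R
    have c : exp (-R) * exp R = 1 := by rw [← exp_add]; simp
    nlinarith
  have h6 : R * exp R ≤ |R| * exp |R| := by
    have := le_abs_self R
    have := abs_nonneg R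
    have := exp_pos R
    nlinarith
  have h7 : 1 ≤ exp |R| := one_le_exp (abs_nonneg R)
  have h8 : -|R| ≤ R := neg_abs_le R
  have h9 := exp_pos R
  have h10 := abs_nonneg R
  rw [abs_le]; constructor
  · have : exp R * (1 - cos T) ≤ exp |R| * (T^2/2) := by gcongr <;> linarith
    nlinarith
  · nlinarith [sq_nonneg T]
lemma near_pt (A B S R T t : ℝ) (hA : 0 ≤ A) (hB : 0 < B) (hS : 0 < S) (ht : B * |t| ≤ 1/(8*(1+A)))
    (hR : |R| ≤ 6 * B^2 * S * t^4 + (1+A)^2*B^2*t^2) (hT : |T| ≤ B * S * |t|^3 + (1+A)*B * |t|) :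
    |exp (-(S*t^2/2)+R) * cos T - exp (-(S*t^2/2))| ≤
      2*(576+8*(1+A)^2) * (B^2/S) * exp (-(S*t^2/8)) := by
  set v := S*t^2 with hv
  have hv0 : 0 ≤ v := by positivity
  have hBt : B^2*t^2 ≤ 1/64 ∧ (1+A)^2*(B^2*t^2) ≤ 1/64 := by
    have h : (B * |t|)^2 ≤ (1/(8*(1+A)))^2 := by gcongr
    rw [mul_pow, sq_abs, div_pow, mul_pow] at h
    have h2 : (1+A)^2*(B^2*t^2) ≤ 1/64 := by
      calc _ ≤ (1+A)^2 * (1^2/(8^2*(1+A)^2)) := by gcongr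
        _ = 1/64 := by field_simp; norm_num
    exact ⟨le_trans (le_mul_of_one_le_left po! (by nlinarith)) h2, h2⟩
  have hR1 : |R| ≤ v/8 + 1/64 := by
    have : 6 * B^2 * S * t^4 = 6*(B^2*t^2)*v := by rw [hv]; ring
    nlinarith [hBt.1, hBt.2]
  have hP : |R| + T^2/2 ≤ (B^2/S) * (6*v^2+2*(1+A)^2*v+v^3) := by
    have h1 : T^2 ≤ (B * S * |t|^3 + (1+A)*B * |t|)^2 := by rw [← sq_abs T]; gcongr
    have h2 : (B * S * |t|^3 + (1+A)*B * |t|)^2/2 ≤ B^2*S^2*t^6 + (1+A)^2*B^2*t^2 := by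
      have e1 : (B * S * |t|^3)^2 = B^2*S^2*t^6 := by rw [mul_pow, ← pow_mul, pow_mul' _ 3 2, sq_abs]; ring
      have e2 : ((1+A)*B * |t|)^2 = (1+A)^2*B^2*t^2 := by rw [mul_pow, sq_abs]; ring
      nlinarith [sq_nonneg (B * S * |t|^3 - (1+A)*B * |t|)]
    have e : (B^2/S) * (6*v^2+2*(1+A)^2*v+v^3) = 6 * B^2 * S * t^4 + 2*((1+A)^2*B^2*t^2) + B^2*S^2*t^6 := by
      rw [hv]; field_simp
    linarith
  have hpoly : 6*v^2+2*(1+A)^2*v+v^3 ≤ (576+8*(1+A)^2) * exp (v/4) := by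
    have a1 := exp_ge2 (v/4) po!
    have a2 := exp_ge3 (v/4) po!
    have a3 := add_one_le_exp (v/4)
    have a4 : (1+A)^2*v ≤ (1+A)^2*(4*exp (v/4)) := by gcongr; linarith
    nlinarith
  have hE : exp |R| ≤ 2 * exp (v/8) := by
    calc _ ≤ exp (v/8 + 1/64) := exp_le_exp.2 hR1
      _ = exp (1/64) * exp (v/8) := by rw [← exp_add]; ring_nf
      _ ≤ _ := by
        gcongr
        calc _ ≤ exp (log 2) := exp_le_exp.2 (by have := log_two_gt_d9; linarith)
          _ = 2 := exp_log nn!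
  rw [exp_add, mul_assoc, ← mul_sub_one, abs_mul, abs_exp]
  calc _ ≤ exp (-(v/2)) * (exp |R| * (|R| + T^2/2)) := by gcongr; exact exp_cos_near R T
    _ ≤ exp (-(v/2)) * (2 * exp (v/8) * ((B^2/S) * ((576+8*(1+A)^2) * exp (v/4)))) := by
      gcongr; exact hP.trans (by gcongr)
    _ = 2*(576+8*(1+A)^2) * (B^2/S) * (exp (-(v/2)) * exp (v/8) * exp (v/4)) := by ring
    _ = _ := by rw [← exp_add, ← exp_add]; ring_nf
lemma main_pt (A : ℝ) (hA : 0 ≤ A) : ∃ C, 0 < C ∧ ∀ (α b x y B : ℝ) (r : ℕ), 0 < α → 2 ≤ y → B = log y + 1/α →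
    r * |b| ≤ A * B → phi1 α y + log x = 0 → 4 * B^2 ≤ phi2 α y → ∀ t,
    |(Set.Icc (-(π / log y)) (π / log y)).indicator
      (fun t => ((α:ℂ) * (Phi α y x t * ker α b r t)).re) t - exp (-(phi2 α y/2) * t^2)| ≤
      C * (B^2/phi2 α y) * exp (-(phi2 α y/8) * t^2) + C * (B^2/phi2 α y)^2 * (1 + (2*B/π*t)^2)⁻¹ := by
  have hpi := pi_pos
  set δ := 1/(8*(1+A)) with hδ
  have hδ0 : 0 < δ := by positivity
  set d := 4/π^2*δ^2 with hd
  have hd0 : 0 < d := by positivity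
  set c := log (1+d) / 4 with hc
  have hc0 : 0 < c := by have := log_pos (by linarith : 1 < 1 + d); positivity
  set C := 2*(576+8*(1+A)^2) + 8/(3*δ^2) + 2/c^2 with hC
  refine ⟨C, by positivity, fun α b x y B r hα hy hB hr hs hN t => ?_⟩
  have hL : 0 < log y := log_pos li!
  have hB0 : 0 < B := by rw [hB]; positivity
  have hS0 : 0 < phi2 α y := by nlinarith [sq_pos_of_pos hB0]
  have hBL : δ / B < π / log y := by
    rw [div_lt_div_iff₀ hB0 hL]
    have h1 : δ ≤ 1 := by
      rw [hδ, div_le_one po!]; linarith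
    have h2 : log y ≤ B := by rw [hB]; have : 0 < 1/α := po!; linarith
    nlinarith [pi_gt_three]
  set S := phi2 α y with hSdef
  have hq : 0 < B^2/S := by positivity
  have hX : 0 ≤ (1 + (2*B/π*t)^2)⁻¹ := by positivity
  rcases le_or_gt (B * |t|) δ with h | h
  · have ht : t ∈ Set.Icc (-(π / log y)) (π / log y) := by
      rw [Set.mem_Icc, ← abs_le]
      have : |t| ≤ δ / B := by rw [le_div_iff₀ hB0]; linarith
      linarith
    rw [Set.indicator_of_mem ht]
    obtain ⟨R, T, e, hR, hT⟩ := F_exp α b B A x y hα hy hB hA r hr hs t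
    have := near_pt A B S R T t hA hB0 hS0 h hR hT
    rw [e, Complex.exp_re]
    simp only [Complex.add_re, Complex.ofReal_re, Complex.mul_re, Complex.I_re, Complex.ofReal_im, Complex.I_im,
      Complex.add_im, Complex.mul_im, mul_zero, mul_one, zero_mul, sub_zero, add_zero, zero_add]
    have e1 : -(S/2)*t^2 = -(S*t^2/2) := by ring
    have e2 : -(S/8)*t^2 = -(S*t^2/8) := by ring
    rw [e1, e2]
    refine this.trans ?_
    have h3 : 0 ≤ C * (B^2/S)^2 * (1 + (2*B/π*t)^2)⁻¹ := by positivity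
    have h4 : 2*(576+8*(1+A)^2) ≤ C := by rw [hC]; have : 0 < 8/(3*δ^2) + 2/c^2 := po!; linarith
    have h5 : 2*(576+8*(1+A)^2) * (B^2/S) * exp (-(S*t^2/8)) ≤ C * (B^2/S) * exp (-(S*t^2/8)) := by gcongr
    linarith
  · have hBt : δ^2 ≤ B^2*t^2 := by
      rw [← sq_abs t, ← mul_pow]; gcongr
    have h1 : exp (-(S/2)*t^2) ≤ 8/(3*δ^2) * (B^2/S) * exp (-(S/8)*t^2) := by
      have e : -(S/2)*t^2 = -(3*S*t^2/8) + -(S/8)*t^2 := by ring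
      rw [e, exp_add]
      gcongr
      have h2 : 0 < t^2 := by
        have : 0 < δ^2 := by positivity
        by_contra h; have : t^2 = 0 := le_antisymm (not_lt.1 h) (sq_nonneg t)
        rw [this] at hBt; linarith
      have h3 := add_one_le_exp (3*S*t^2/8)
      rw [exp_neg]
      calc _ ≤ (3*S*t^2/8)⁻¹ := by gcongr; linarith
        _ ≤ (3*S*(δ^2/B^2)/8)⁻¹ := by
          gcongr; rw [div_le_iff₀ po!]; linarith
        _ = _ := by field_simp
    have h2 : |(Set.Icc (-(π / log y)) (π / log y)).indicator
      (fun t => ((α:ℂ) * (Phi α y x t * ker α b r t)).re) t| ≤ 2/c^2 * (B^2/S)^2 * (1 + (2*B/π*t)^2)⁻¹ := by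
      by_cases ht : t ∈ Set.Icc (-(π / log y)) (π / log y)
      swap
      · rw [Set.indicator_of_notMem ht, abs_zero]; positivity
      rw [Set.indicator_of_mem ht]
      refine ((Complex.abs_re_le_norm _).trans (F_norm_le α b y x hα r t)).trans ?_
      have h3 := Phi_near α y x B t hα hy hB (abs_le.2 (Set.mem_Icc.1 ht))
      have e0 : (1 + 4/π^2*B^2*t^2) = 1 + (2*B/π*t)^2 := by ring
      rw [e0] at h3
      set s := (2*B/π*t)^2 with hs'
      have hsd : d ≤ s := by
        rw [hd, hs']
        calc _ ≤ 4/π^2*(B^2*t^2) := by gcongr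
          _ = _ := by ring
      have hN4 : 4 ≤ S/B^2 := by rw [le_div_iff₀ po!]; linarith
      set N := S/B^2 with hNdef
      have h4 : ‖Phi α y x t‖ ≤ (1+s)^(-(N/2)) := by
        have e : ((1+s)^(-(N/2)))^2 = (1+s)^(-N) := by
          rw [← rpow_natCast, ← rpow_mul po!]; congr 1; push_cast; ring
        rw [← e] at h3
        exact (sq_le_sq₀ (norm_nonneg _) po!).1 h3
      refine h4.trans ?_
      have e : -(N/2) = -(N/2-1) + (-1) := by ring
      rw [e, rpow_add li!, rpow_neg_one]
      gcongr
      calc (1+s)^(-(N/2-1)) ≤ (1+s)^(-(N/4)) := rpow_le_rpow_of_exponent_le li! li!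
        _ ≤ (1+d)^(-(N/4)) := rpow_le_rpow_of_nonpos li! li! li!
        _ = (exp (c*N))⁻¹ := by rw [rpow_def_of_pos li!, ← exp_neg, hc]; congr 1; ring
        _ ≤ ((c*N)^2/2)⁻¹ := by
          have := exp_ge2 (c*N) po!
          gcongr
        _ = 2/c^2*(B^2/S)^2 := by rw [hNdef]; field_simp
    refine (abs_sub _ _).trans ?_
    rw [abs_exp]
    have h3 : 8/(3*δ^2) * (B^2/S) * exp (-(S/8)*t^2) ≤ C * (B^2/S) * exp (-(S/8)*t^2) := by
      gcongr; rw [hC]; have : 0 < 2*(576+8*(1+A)^2) + 2/c^2 := by positivity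
      linarith
    have h4 : 2/c^2 * (B^2/S)^2 * (1 + (2*B/π*t)^2)⁻¹ ≤ C * (B^2/S)^2 * (1 + (2*B/π*t)^2)⁻¹ := by
      gcongr; rw [hC]; have : 0 < 2*(576+8*(1+A)^2) + 8/(3*δ^2) := by positivity
      linarith
    linarith
theorem main_term (A : ℝ) (hA : 0 ≤ A) : ∃ C, 0 < C ∧ ∀ (α b x y B : ℝ) (r : ℕ), 0 < α → 2 ≤ y → B = log y + 1/α →
    r * |b| ≤ A * B → phi1 α y + log x = 0 → 4 * B^2 ≤ phi2 α y →
    |α * (∫ t in Set.Icc (-(π / log y)) (π / log y), Phi α y x t * ker α b r t).re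
      - sqrt (2*π) / sqrt (phi2 α y)| ≤ C * (B^2 / phi2 α y) / sqrt (phi2 α y) := by
  obtain ⟨C, hC, h⟩ := main_pt A hA
  have hpi := pi_pos
  refine ⟨C * (sqrt (8*π) + π^2/2), by positivity, fun α b x y B r hα hy hB hr hs hN => ?_⟩
  have hL : 0 < log y := log_pos li!
  have hB0 : 0 < B := by rw [hB]; positivity
  have hS0 : 0 < phi2 α y := by nlinarith [sq_pos_of_pos hB0]
  have h := h α b x y B r hα hy hB hr hs hN
  set S := phi2 α y with hSdef
  set I := Set.Icc (-(π / log y)) (π / log y)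
  have hcont : Continuous (fun t => Phi α y x t * ker α b r t) := (Phi_cont α y x hα).mul (ker_cont α b hα r)
  have hF : IntegrableOn (fun t => Phi α y x t * ker α b r t) I := hcont.continuousOn.integrableOn_Icc
  have hF2 : IntegrableOn (fun t => ((α:ℂ) * (Phi α y x t * ker α b r t)).re) I :=
    (Complex.continuous_re.comp (continuous_const.mul hcont)).continuousOn.integrableOn_Icc
  have e1 : α * (∫ t in I, Phi α y x t * ker α b r t).re = ∫ t, I.indicator (fun t => ((α:ℂ) * (Phi α y x t * ker α b r t)).re) t := by
    rw [integral_indicator measurableSet_Icc]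
    have e := integral_re (𝕜 := ℂ) hF
    simp only [Complex.re_ofReal_mul]
    rw [integral_const_mul]
    congr 1
    exact e.symm
  have g1 : Integrable (fun t:ℝ => exp (-(S/2) * t^2)) := integrable_exp_neg_mul_sq po!
  have g2 : Integrable (fun t:ℝ => exp (-(S/8) * t^2)) := integrable_exp_neg_mul_sq po!
  have hk : 2*B/π ≠ 0 := by positivity
  have g3 : Integrable (fun t:ℝ => (1 + (2*B/π*t)^2)⁻¹) := integrable_inv_one_add_sq.comp_mul_left' hk
  have e2 : sqrt (2*π) / sqrt S = ∫ t, exp (-(S/2) * t^2) := by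
    rw [integral_gaussian, ← sqrt_div po!]; congr 1; field_simp
  rw [e1, e2, ← integral_sub ((integrable_indicator_iff measurableSet_Icc).2 hF2) g1]
  have g4 := (g2.const_mul (C * (B^2/S))).add (g3.const_mul (C * (B^2/S)^2))
  rw [← norm_eq_abs]
  refine (norm_integral_le_of_norm_le g4 (Filter.Eventually.of_forall h)).trans ?_
  simp only [Pi.add_apply]
  rw [integral_add (g2.const_mul (C * (B^2/S))) (g3.const_mul (C * (B^2/S)^2)), integral_const_mul,
    integral_const_mul, integral_gaussian,
    Measure.integral_comp_mul_left (fun t => (1+t^2)⁻¹) (2*B/π), integral_univ_inv_one_add_sq]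
  have e3 : sqrt (π/(S/8)) = sqrt (8*π) / sqrt S := by
    rw [← sqrt_div po!]; congr 1; field_simp
  rw [e3, smul_eq_mul, abs_of_pos po!]
  have hBS : B ≤ sqrt S := le_sqrt_of_sq_le (by nlinarith [sq_nonneg B])
  have hs0 : 0 < sqrt S := sqrt_pos.2 hS0
  have h5 : (B^2/S)^2 * ((2*B/π)⁻¹*π) ≤ (B^2/S) * (π^2/2) / sqrt S := by
    have e : (B^2/S)^2 * ((2*B/π)⁻¹*π) = (B^2/S) * (π^2/2) * (B / S) := by field_simp
    rw [e, div_eq_mul_inv _ (sqrt S)]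
    gcongr
    rw [div_le_iff₀ hS0]
    calc B ≤ sqrt S := hBS
      _ = (sqrt S)⁻¹ * (sqrt S * sqrt S) := by field_simp
      _ = _ := by rw [mul_self_sqrt hS0.le]
  calc _ = C * (B^2/S) * sqrt (8*π) / sqrt S + C * ((B^2/S)^2 * ((2*B/π)⁻¹*π)) := by ring
    _ ≤ C * (B^2/S) * sqrt (8*π) / sqrt S + C * ((B^2/S) * (π^2/2) / sqrt S) := by gcongr
    _ = _ := by ring
end
end HTP

namespace HTP
section
open Real MeasureTheory
open Complex (I)
lemma theta_eq (y : ℝ) : Chebyshev.theta y = ∑ p ∈ primesLE y, log p := by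
  rw [Chebyshev.theta_eq_sum_primesLE]; rfl
lemma theta_le (y : ℝ) (hy : 0 ≤ y) : ∑ p ∈ primesLE y, log p ≤ log 4 * y := by
  rw [← theta_eq]; exact Chebyshev.theta_le_log4_mul_x hy
lemma log_le_two_sqrt (z : ℝ) (hz : 0 < z) : log z ≤ 2 * sqrt z := by
  have h := log_le_sub_one_of_pos (sqrt_pos.2 hz)
  have h2 := log_sqrt hz.le
  linarith
lemma card_le : ∃ C : ℝ, 0 < C ∧ ∀ y : ℝ, 2 ≤ y → ((primesLE y).card : ℝ) ≤ C * (y / log y) := by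
  refine ⟨2 * log 4 + 2, by have := log_pos (by norm_num : (1:ℝ) < 4); positivity, fun y hy => ?_⟩
  have h := Chebyshev.pi_le_log4_mul_div (x := y) li!
  have hL : 0 < log y := log_pos li!
  have e : ((primesLE y).card : ℝ) = (Nat.primeCounting ⌊y⌋₊ : ℕ) := by
    rw [Nat.primeCounting, Nat.primeCounting', Nat.count_eq_card_filter_range]; rfl
  rw [e]
  refine h.trans ?_
  have h1 := log_le_two_sqrt y li!
  have h2 : sqrt y ≤ 2 * (y / log y) := by
    rw [← mul_div_assoc, le_div_iff₀ hL]
    nlinarith [mul_self_sqrt (by linarith : 0 ≤ y), sqrt_nonneg y]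
  rw [log_sqrt li!]
  have e : log 4 * y / (log y / 2) = 2 * log 4 * (y / log y) := by field_simp
  rw [e]; linarith
lemma theta_ge : ∃ y0 : ℝ, 2 ≤ y0 ∧ ∀ y, y0 ≤ y → y / 2 ≤ ∑ p ∈ primesLE y, log p := by
  have h : ∀ᶠ x : ℝ in Filter.atTop, x/2 ≤ (x - 1) * log 2 - log (x + 2) - 2 * sqrt x * log x := by
    have a1 : ∀ᶠ x : ℝ in Filter.atTop, ‖log x‖ ≤ 0.01 * ‖x^(1/2:ℝ)‖ :=
      (isLittleO_log_rpow_atTop (by norm_num : (0:ℝ) < 1/2)).def nn!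
    filter_upwards [a1, Filter.eventually_ge_atTop 10000] with x hx h4
    rw [← sqrt_eq_rpow, norm_of_nonneg (sqrt_nonneg x), norm_of_nonneg (log_nonneg li!)] at hx
    have h1 : log (x+2) ≤ log x + 1 := by
      have : x + 2 = x * (1 + 2/x) := by field_simp
      rw [this, log_mul po! po!]
      have := log_le_sub_one_of_pos (by positivity : 0 < 1 + 2/x)
      have : 2/x ≤ 1 := by rw [div_le_one po!]; linarith
      linarith
    have h2 := log_two_gt_d9
    have h3 := mul_self_sqrt (by linarith : 0 ≤ x)
    have h5 : (100:ℝ) ≤ sqrt x := le_sqrt_of_sq_le (by norm_num; linarith)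
    nlinarith
  obtain ⟨y0, h0⟩ := Filter.eventually_atTop.1 h
  refine ⟨max y0 2, le_max_right _ _, fun y hy => ?_⟩
  rw [← theta_eq]
  exact (h0 y ((le_max_left _ _).trans hy)).trans (Chebyshev.theta_ge' (by linarith [(le_max_right y0 2).trans hy]))
lemma log_fact (N : ℕ) : log (N.factorial : ℕ) = ∑ p ∈ primesLE N, (N.factorial.factorization p : ℝ) * log p := by
  rw [log_nat_eq_sum_factorization]
  refine Finsupp.sum_of_support_subset _ (fun p hp => ?_) _ (by simp)
  rw [Nat.support_factorization, Nat.mem_primeFactors] at hp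
  exact mem_primesLE.2 ⟨by rw [Nat.floor_natCast]; exact (hp.1.dvd_factorial).1 hp.2.1, hp.1⟩
lemma val_fact (N p : ℕ) (hp : p.Prime) : (N:ℝ)/p - 1 ≤ N.factorial.factorization p ∧
    (N.factorial.factorization p : ℝ) ≤ N/((p:ℝ)-1) := by
  have h2 : (2:ℝ) ≤ p := by exact_mod_cast hp.two_le
  haveI := Fact.mk hp
  constructor
  · have h : N/p ≤ N.factorial.factorization p := by
      rw [Nat.factorization_factorial hp (Nat.lt_succ_self (Nat.log p N + 1) |>.trans' (Nat.lt_succ_self _))]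
      calc N/p = N/p^1 := by rw [pow_one]
        _ ≤ _ := Finset.single_le_sum (f := fun i => N/p^i) (fun _ _ => Nat.zero_le _) (by simp)
    have h1 : (N:ℝ)/p < (N/p : ℕ) + 1 := by
      have := Nat.lt_floor_add_one ((N:ℝ)/p)
      rwa [Nat.floor_div_eq_div] at this
    have h3 : ((N/p:ℕ):ℝ) ≤ N.factorial.factorization p := by exact_mod_cast h
    linarith
  · rw [le_div_iff₀ li!]
    have h := sub_one_mul_padicValNat_factorial (p := p) N
    rw [← Nat.factorization_def _ hp] at h
    have h3 : (p-1) * N.factorial.factorization p ≤ N := by omega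
    have h4 : (((p-1 : ℕ)):ℝ) * N.factorial.factorization p ≤ N := by exact_mod_cast h3
    rw [Nat.cast_sub hp.one_lt.le] at h4
    push_cast at h4; linarith
lemma sum_log_sq (s : Finset ℕ) (hs : ∀ p ∈ s, p.Prime) :
    ∑ p ∈ s, log p / (p * ((p:ℝ)-1)) ≤ 4 * ∑' n : ℕ, 1/(n:ℝ)^(3/2:ℝ) := by
  have hsum : Summable (fun n : ℕ => 1/(n:ℝ)^(3/2:ℝ)) := summable_one_div_nat_rpow.2 nn!
  calc _ ≤ ∑ p ∈ s, 4 * (1/(p:ℝ)^(3/2:ℝ)) := Finset.sum_le_sum fun p hp => ?_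
    _ = 4 * ∑ p ∈ s, (1/(p:ℝ)^(3/2:ℝ)) := by rw [Finset.mul_sum]
    _ ≤ _ := by gcongr; exact hsum.sum_le_tsum _ (fun _ _ => by positivity)
  have h2 : (2:ℝ) ≤ p := by exact_mod_cast (hs p hp).two_le
  have e : (p:ℝ)^(3/2:ℝ) = p * sqrt p := by
    rw [sqrt_eq_rpow, show (3/2:ℝ) = 1 + 1/2 by norm_num, rpow_add li!, rpow_one]
  rw [e, ← mul_div_assoc, mul_one, div_le_div_iff₀ (by nlinarith) po!]
  have h3 := log_le_two_sqrt p li!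
  have h4 := mul_self_sqrt (by linarith : (0:ℝ) ≤ p)
  have h5 : log p * sqrt p ≤ 2 * p := by nlinarith [sqrt_nonneg (p:ℝ)]
  nlinarith
lemma mertens : ∃ C : ℝ, 0 < C ∧ ∀ z : ℝ, 1 ≤ z → |∑ p ∈ primesLE z, log p / p - log z| ≤ C := by
  set K := ∑' n : ℕ, 1/(n:ℝ)^(3/2:ℝ)
  have hK : 0 ≤ K := tsum_nonneg fun n => by positivity
  have h4 : 0 < log 4 := log_pos nn!
  refine ⟨4 * K + 2 + log 4, by positivity, fun z hz => ?_⟩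
  set N := ⌊z⌋₊ with hN
  have hN1 : 1 ≤ N := Nat.le_floor (by simpa using hz)
  have hN0 : (1:ℝ) ≤ N := by exact_mod_cast hN1
  have e : primesLE z = primesLE (N:ℝ) := by unfold primesLE; rw [Nat.floor_natCast]
  have hlo : (N:ℝ) ≤ z := Nat.floor_le li!
  have hhi : z < N + 1 := Nat.lt_floor_add_one z
  have hlog1 : log N ≤ log z := log_le_log li! hlo
  have hlog2 : log z ≤ log N + 1 := by
    have : z / N ≤ 2 := by rw [div_le_iff₀ li!]; linarith
    have h := log_le_sub_one_of_pos (by positivity : 0 < z / N)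
    rw [log_div li! li!] at h; linarith
  rw [e]
  have hf := log_fact N
  have hlow : N * log N - N ≤ log (N.factorial : ℕ) := by
    have := Stirling.le_log_factorial_stirling (n := N) (by omega)
    have := log_nonneg hN0
    have : 0 ≤ log (2 * π) := log_nonneg (by linarith [pi_gt_three])
    linarith
  have hup : log (N.factorial : ℕ) ≤ N * log N := by
    rw [← log_pow]
    exact log_le_log (by exact_mod_cast N.factorial_pos) (by exact_mod_cast N.factorial_le_pow)
  have a1 : N * (∑ p ∈ primesLE (N:ℝ), log p / p) - log 4 * N ≤ log (N.factorial : ℕ) := by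
    have := theta_le (N:ℝ) po!
    rw [hf, Finset.mul_sum]
    have h : ∑ p ∈ primesLE (N:ℝ), ((N:ℝ) * (log p / p) - log p) ≤ ∑ p ∈ primesLE (N:ℝ), (N.factorial.factorization p : ℝ) * log p := by
      refine Finset.sum_le_sum fun p hp => ?_
      have hp := (mem_primesLE.1 hp).2
      have := mul_le_mul_of_nonneg_right (val_fact N p hp).1 (log_prime_pos hp).le
      calc _ = ((N:ℝ)/p - 1) * log p := by ring
        _ ≤ _ := this
    rw [Finset.sum_sub_distrib] at h
    linarith
  have a2 : log (N.factorial : ℕ) ≤ N * (∑ p ∈ primesLE (N:ℝ), log p / p + 4 * K) := by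
    have hs := sum_log_sq (primesLE (N:ℝ)) (fun p hp => (mem_primesLE.1 hp).2)
    rw [hf]
    calc _ ≤ ∑ p ∈ primesLE (N:ℝ), N * (log p / p + log p / (p * ((p:ℝ)-1))) := by
          refine Finset.sum_le_sum fun p hp => ?_
          have hp := (mem_primesLE.1 hp).2
          have h2 : (2:ℝ) ≤ p := by exact_mod_cast hp.two_le
          have := mul_le_mul_of_nonneg_right (val_fact N p hp).2 (log_prime_pos hp).le
          refine this.trans (le_of_eq ?_)
          have : (p:ℝ) - 1 ≠ 0 := by linarith
          field_simp; ring
      _ = N * (∑ p ∈ primesLE (N:ℝ), log p / p + ∑ p ∈ primesLE (N:ℝ), log p / (p * ((p:ℝ)-1))) := by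
          rw [← Finset.mul_sum, Finset.sum_add_distrib]
      _ ≤ _ := by gcongr
  have b1 : ∑ p ∈ primesLE (N:ℝ), log p / p ≤ log N + log 4 := by
    have : N * (∑ p ∈ primesLE (N:ℝ), log p / p) ≤ N * (log N + log 4) := by linarith
    exact le_of_mul_le_mul_left this li!
  have b2 : log N - 1 ≤ ∑ p ∈ primesLE (N:ℝ), log p / p + 4 * K := by
    have : N * (log N - 1) ≤ N * (∑ p ∈ primesLE (N:ℝ), log p / p + 4 * K) := by linarith
    exact le_of_mul_le_mul_left this li!
  rw [abs_le]; constructor <;> linarith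
end
end HTP

namespace HTP
section
open Real MeasureTheory
open Complex (I)
lemma cexp_log_deriv (w : ℂ) (t : ℝ) (ht : 0 < t) :
    HasDerivAt (fun t : ℝ => cex (w * (log t : ℝ))) (cex (w * (log t : ℝ)) * (w * (t⁻¹ : ℝ))) t :=
  ((hasDerivAt_log ht.ne').ofReal_comp.const_mul w).cexp
lemma abel : ∃ C : ℝ, 0 < C ∧ ∀ (y : ℝ) (w : ℂ), 1 ≤ y → 0 ≤ w.re → w ≠ 0 →
    ‖∑ p ∈ primesLE y, cex (w * (log p : ℝ)) * ((log p / p : ℝ) : ℂ)‖ ≤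
      exp (w.re * log y) * (2 / ‖w‖ + C * (1 + ‖w‖ * log y)) := by
  obtain ⟨C, hC, hM⟩ := mertens
  refine ⟨C, hC, fun y w hy hw hw0 => ?_⟩
  have hL : 0 ≤ log y := log_nonneg hy
  have hwn : 0 < ‖w‖ := norm_pos_iff.2 hw0
  set f : ℝ → ℂ := fun t => cex (w * (log t : ℝ)) with hf
  set c : ℕ → ℂ := fun n => if n.Prime then ((log n / n : ℝ):ℂ) else 0 with hc
  have hS : ∀ z : ℝ, ∑ k ∈ Finset.Icc 0 ⌊z⌋₊, c k = ((∑ p ∈ primesLE z, log p / p : ℝ):ℂ) := by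
    intro z
    rw [hc, ← Finset.sum_filter, Complex.ofReal_sum]
    refine Finset.sum_congr ?_ fun _ _ => rfl
    ext p; simp [mem_primesLE]
  have hd : ∀ t ∈ Set.Icc 1 y, HasDerivAt f (f t * (w * (t⁻¹ : ℝ))) t := fun t ht => cexp_log_deriv w t (by linarith [ht.1])
  have hde : ∀ t ∈ Set.Icc 1 y, deriv f t = f t * (w * (t⁻¹ : ℝ)) := fun t ht => (hd t ht).deriv
  have hfc : ContinuousOn f (Set.Icc 1 y) := fun t ht => (hd t ht).continuousAt.continuousWithinAt
  have hcont : ContinuousOn (fun t : ℝ => f t * (w * (t⁻¹ : ℝ))) (Set.Icc 1 y) := by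
    refine hfc.mul (continuousOn_const.mul ?_)
    refine Complex.continuous_ofReal.comp_continuousOn (continuousOn_inv₀.mono fun t ht => ?_)
    have := ht.1; simp only [Set.mem_compl_iff, Set.mem_singleton_iff]; intro h; linarith
  have hint : IntegrableOn (deriv f) (Set.Icc 1 y) :=
    hcont.integrableOn_Icc.congr_fun (fun t ht => (hde t ht).symm) measurableSet_Icc
  have habel := sum_mul_eq_sub_integral_mul₀ c (by simp [hc]) y (fun t ht => (hd t ht).differentiableAt) hint
  have e1 : ∑ k ∈ Finset.Icc 0 ⌊y⌋₊, f k * c k = ∑ p ∈ primesLE y, cex (w * (log p : ℝ)) * ((log p / p : ℝ) : ℂ) := by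
    simp only [hc, mul_ite, mul_zero]
    rw [← Finset.sum_filter]
    refine Finset.sum_congr ?_ fun _ _ => rfl
    ext p; simp [mem_primesLE]
  set G : ℝ → ℂ := fun t => f t * (log t : ℝ) - f t / w with hG
  have hGd : ∀ t ∈ Set.uIcc 1 y, HasDerivAt G (f t * (w * (t⁻¹ : ℝ)) * (log t : ℝ)) t := by
    intro t ht
    rw [Set.uIcc_of_le hy] at ht
    have h1 := ((hd t ht).mul (hasDerivAt_log (by linarith [ht.1] : t ≠ 0)).ofReal_comp).sub ((hd t ht).div_const w)
    refine h1.congr_deriv ?_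
    field_simp; ring
  have hlogc : ContinuousOn (fun t : ℝ => ((log t : ℝ):ℂ)) (Set.Icc 1 y) :=
    Complex.continuous_ofReal.comp_continuousOn (continuousOn_log.mono fun t ht => by
      have := ht.1; simp only [Set.mem_compl_iff, Set.mem_singleton_iff]; intro h; linarith)
  have hint2 : IntegrableOn (fun t : ℝ => f t * (w * (t⁻¹ : ℝ)) * (log t : ℝ)) (Set.Icc 1 y) :=
    (hcont.mul hlogc).integrableOn_Icc
  have hFTC := intervalIntegral.integral_eq_sub_of_hasDerivAt hGd
    ((intervalIntegrable_iff_integrableOn_Icc_of_le hy).2 hint2)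
  have hint3 := integrableOn_mul_sum_Icc c (m := 0) (by norm_num : (0:ℝ) ≤ 1) hint
  rw [intervalIntegral.integral_of_le hy] at hFTC
  have hdiff : ‖(∫ t in Set.Ioc 1 y, deriv f t * ∑ k ∈ Finset.Icc 0 ⌊t⌋₊, c k) - (G y - G 1)‖ ≤
      C * ‖w‖ * exp (w.re * log y) * log y := by
    rw [← hFTC, ← integral_sub (hint3.mono_set Set.Ioc_subset_Icc_self) (hint2.mono_set Set.Ioc_subset_Icc_self)]
    have e2 : C * ‖w‖ * exp (w.re * log y) * log y = ∫ t in Set.Ioc 1 y, C * ‖w‖ * exp (w.re * log y) * t⁻¹ := by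
      rw [integral_const_mul, ← intervalIntegral.integral_of_le hy, integral_inv_of_pos nn! li!, div_one]
    rw [e2]
    refine norm_integral_le_of_norm_le ?_ ?_
    · refine Integrable.const_mul (IntegrableOn.mono_set (t := Set.Icc 1 y) ?_ Set.Ioc_subset_Icc_self) _
      refine ContinuousOn.integrableOn_Icc (continuousOn_inv₀.mono fun t ht => ?_)
      have := ht.1; simp only [Set.mem_compl_iff, Set.mem_singleton_iff]; intro h; linarith
    · refine (ae_restrict_iff' measurableSet_Ioc).2 (Filter.Eventually.of_forall fun t ht => ?_)
      have ht' : t ∈ Set.Icc 1 y := Set.Ioc_subset_Icc_self ht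
      rw [hde t ht', hS, ← mul_sub, ← Complex.ofReal_sub, norm_mul, norm_mul, norm_mul, Complex.norm_real, Complex.norm_real,
        norm_eq_abs, norm_eq_abs, abs_of_pos (inv_pos.2 (by linarith [ht.1]))]
      have h1 : ‖f t‖ ≤ exp (w.re * log y) := by
        simp only [hf, Complex.norm_exp, Complex.re_mul_ofReal]
        have := log_le_log (by linarith [ht.1]) ht.2
        exact exp_le_exp.2 (by gcongr)
      have h2 := hM t ht'.1
      have h3 : 0 < t⁻¹ := inv_pos.2 (by linarith [ht.1])
      calc _ ≤ exp (w.re * log y) * (‖w‖ * t⁻¹) * C := by gcongr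
        _ = _ := by ring
  rw [e1, hS] at habel
  rw [habel]
  set J := ∫ t in Set.Ioc 1 y, deriv f t * ∑ k ∈ Finset.Icc 0 ⌊t⌋₊, c k
  set S := ∑ p ∈ primesLE y, log p / p
  have hfy : ‖f y‖ = exp (w.re * log y) := by simp only [hf, Complex.norm_exp, Complex.re_mul_ofReal]
  have hG1 : G 1 = -(1/w) := by simp [hG, hf]
  have e3 : f y * (S:ℂ) - J = f y * ((S - log y : ℝ):ℂ) + f y / w - 1/w - (J - (G y - G 1)) := by
    rw [hG1]; simp only [hG]; push_cast; ring
  rw [e3]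
  refine (norm_sub_le _ _).trans ?_
  have n1 := norm_sub_le (f y * ((S - log y : ℝ):ℂ) + f y / w) (1/w)
  have n2 := norm_add_le (f y * ((S - log y : ℝ):ℂ)) (f y / w)
  rw [norm_mul, norm_div, hfy, Complex.norm_real, norm_eq_abs] at n2
  rw [norm_div, norm_one] at n1
  have h1 : 1 ≤ exp (w.re * log y) := one_le_exp po!
  have h2 := hM y hy
  set E := exp (w.re * log y)
  have h3 : E * |S - log y| ≤ E * C := by gcongr
  have h4 : 1/‖w‖ ≤ E/‖w‖ := by gcongr
  calc _ ≤ E * C + E/‖w‖ + E/‖w‖ + C * ‖w‖ * E * log y := by linarith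
    _ = _ := by ring
end
end HTP

namespace HTP
section
open Real MeasureTheory
open Complex (I)
lemma em_step (G f g : ℝ → ℂ) (K : ℝ) (hG : ∀ x : ℝ, 1 ≤ x → HasDerivAt G (f x) x)
    (hf : ∀ x : ℝ, 1 ≤ x → HasDerivAt f (g x) x) (hg : ∀ x : ℝ, 1 ≤ x → ‖g x‖ ≤ K * (1 / (x * √x)))
    (hK : 0 ≤ K) (n : ℕ) (hn : 1 ≤ n) :
    ‖f n - (G (n + 1 : ℕ) - G n)‖ ≤ 4 * K * (1 / √(n:ℝ) - 1 / √((n + 1 : ℕ):ℝ)) := by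
  have hn1 : (1:ℝ) ≤ n := by exact_mod_cast hn
  have hgb : ∀ x ∈ Set.Icc (n:ℝ) (n+1), ‖g x‖ ≤ K * (1 / (n * √(n:ℝ))) := by
    intro x hx
    refine (hg x (hn1.trans hx.1)).trans (mul_le_mul_of_nonneg_left ?_ hK)
    refine one_div_le_one_div_of_le po! ?_
    exact mul_le_mul hx.1 (sqrt_le_sqrt hx.1) po! (by linarith [hx.1])
  have hfb : ∀ x ∈ Set.Icc (n:ℝ) (n+1), ‖f x - f n‖ ≤ K * (1 / (n * √(n:ℝ))) := by
    intro x hx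
    have := Convex.norm_image_sub_le_of_norm_hasDerivWithin_le (f := f) (f' := g)
      (fun x hx => (hf x (hn1.trans hx.1)).hasDerivWithinAt) hgb (convex_Icc _ _) (Set.left_mem_Icc.2 li!) hx
    refine this.trans (mul_le_of_le_one_right po! ?_)
    rw [norm_eq_abs, abs_le]; constructor <;> linarith [hx.1, hx.2]
  have h3 := Convex.norm_image_sub_le_of_norm_hasDerivWithin_le (f := fun x : ℝ => G x - f n * (x:ℂ)) (f' := fun x => f x - f n * 1)
      (s := Set.Icc (n:ℝ) (n+1)) (x := (n:ℝ)) (y := (n:ℝ)+1) (C := K * (1 / (n * √(n:ℝ))))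
      (fun x hx => ((hG x (hn1.trans hx.1)).sub ((hasDerivAt_id x).ofReal_comp.const_mul (f n))).hasDerivWithinAt)
      (by intro x hx; simpa using hfb x hx) (convex_Icc _ _) (Set.left_mem_Icc.2 li!) (Set.right_mem_Icc.2 li!)
  have e : f n - (G (n + 1 : ℕ) - G n) = -((G ((n:ℝ)+1) - f n * (((n:ℝ)+1:ℝ):ℂ)) - (G n - f n * ((n:ℝ):ℂ))) := by
    push_cast; ring
  rw [e, norm_neg]
  refine h3.trans ?_
  simp only [add_sub_cancel_left, norm_one, mul_one]
  rw [show 4 * K * (1 / √(n:ℝ) - 1 / √((n + 1 : ℕ):ℝ)) = K * (4 * (1 / √(n:ℝ) - 1 / √((n + 1 : ℕ):ℝ))) by ring]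
  refine mul_le_mul_of_nonneg_left ?_ hK
  push_cast
  set a := √(n:ℝ) with ha
  set b := √((n:ℝ)+1) with hb
  have ha1 : 1 ≤ a := one_le_sqrt.2 hn1
  have ha2 : a ^ 2 = n := sq_sqrt li!
  have hb2 : b ^ 2 = n + 1 := sq_sqrt li!
  have hb1 : 1 ≤ b := one_le_sqrt.2 li!
  have hba : b ≤ 3 / 2 * a := by
    by_contra h
    push Not at h
    nlinarith
  have e2 : 1 / a - 1 / b = 1 / (a * b * (a + b)) := by
    have : (b - a) * (a + b) = 1 := by nlinarith
    have h5 : a + b ≠ 0 := by positivity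
    have h6 : a ≠ 0 := by positivity
    have h7 : b ≠ 0 := by positivity
    field_simp
    linarith
  rw [e2, ← ha2, div_le_iff₀ po!]
  have h4 : b * (a + b) ≤ 4 * a ^ 2 := by
    nlinarith
  rw [mul_assoc, div_mul_eq_mul_div, mul_div_assoc', le_div_iff₀ po!]
  nlinarith [mul_le_mul_of_nonneg_left h4 (by positivity : 0 ≤ a)]
lemma em_sum (G f g : ℝ → ℂ) (K : ℝ) (hG : ∀ x : ℝ, 1 ≤ x → HasDerivAt G (f x) x)
    (hf : ∀ x : ℝ, 1 ≤ x → HasDerivAt f (g x) x) (hg : ∀ x : ℝ, 1 ≤ x → ‖g x‖ ≤ K * (1 / (x * √x)))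
    (hK : 0 ≤ K) (a : ℕ → ℂ) (ha : ∀ n : ℕ, 1 ≤ n → a n = f n) (S : ℂ) (hS : HasSum a S)
    (hG0 : Filter.Tendsto (fun n : ℕ => G n) Filter.atTop (nhds 0)) (N : ℕ) (hN : 1 ≤ N) :
    ‖S - ∑ n ∈ Finset.range N, a n + G N‖ ≤ 4 * K / √(N:ℝ) := by
  have h1 : ∀ M : ℕ, N ≤ M → ‖∑ n ∈ Finset.range M, a n - ∑ n ∈ Finset.range N, a n - (G M - G N)‖ ≤
      4 * K * (1 / √(N:ℝ) - 1 / √(M:ℝ)) := by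
    intro M hM
    induction M, hM using Nat.le_induction with
    | base => simp
    | succ M hM ih =>
      have h2 := em_step G f g K hG hf hg hK M (hN.trans hM)
      rw [Finset.sum_range_succ, ha M (hN.trans hM)]
      calc _ = ‖(∑ n ∈ Finset.range M, a n - ∑ n ∈ Finset.range N, a n - (G M - G N)) + (f M - (G (M + 1 : ℕ) - G M))‖ := by
            congr 1; ring
        _ ≤ _ := norm_add_le _ _
        _ ≤ _ := add_le_add ih h2
        _ = _ := by ring
  have h2 : Filter.Tendsto (fun M : ℕ => ‖∑ n ∈ Finset.range M, a n - ∑ n ∈ Finset.range N, a n - (G M - G N)‖) Filter.atTop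
      (nhds ‖S - ∑ n ∈ Finset.range N, a n - (0 - G N)‖) :=
    ((hS.tendsto_sum_nat.sub_const _).sub (hG0.sub_const _)).norm
  rw [show S - ∑ n ∈ Finset.range N, a n + G N = S - ∑ n ∈ Finset.range N, a n - (0 - G N) by ring]
  refine le_of_tendsto h2 ?_
  filter_upwards [Filter.eventually_ge_atTop N] with M hM
  refine (h1 M hM).trans ?_
  rw [show 4 * K / √(N:ℝ) = 4 * K * (1 / √(N:ℝ)) by ring]
  refine mul_le_mul_of_nonneg_left ?_ po!
  have : 0 ≤ 1 / √(M:ℝ) := by positivity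
  linarith
lemma harm (N : ℕ) : ∑ n ∈ Finset.range N, (1 : ℝ) / n ≤ 1 + log N := by
  have h := harmonic_le_one_add_log N
  rw [harmonic_eq_sum_Icc] at h
  push_cast at h
  refine le_trans ?_ h
  have : ∑ n ∈ Finset.range N, (1 : ℝ) / n ≤ ∑ n ∈ insert 0 (Finset.Icc 1 N), (1 : ℝ) / n := by
    refine Finset.sum_le_sum_of_subset_of_nonneg ?_ (fun _ _ _ => by positivity)
    intro n hn; simp at hn ⊢; omega
  rw [Finset.sum_insert (by simp)] at this
  simpa using this
lemma norm_cexp_log (s : ℂ) (x : ℝ) : ‖cex (s * (log x : ℝ))‖ = exp (s.re * log x) := by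
  rw [Complex.norm_exp, Complex.re_mul_ofReal]
lemma cpow_nat (s : ℂ) (n : ℕ) (hn : 1 ≤ n) : (n:ℂ) ^ s = cex (s * (log n : ℝ)) := by
  have : (n:ℂ) ≠ 0 := by exact_mod_cast (by omega : n ≠ 0)
  rw [Complex.cpow_def_of_ne_zero this, ← Complex.natCast_log, mul_comm]
lemma G_tendsto (ε : ℝ) (hε : 0 < ε) (s : ℂ) (hs : s.re = -ε) :
    Filter.Tendsto (fun n : ℕ => cex (s * (log n : ℝ))) Filter.atTop (nhds 0) ∧
    Filter.Tendsto (fun n : ℕ => cex (s * (log n : ℝ)) * (log n : ℝ)) Filter.atTop (nhds 0) := by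
  have hlog : Filter.Tendsto (fun n : ℕ => log n) Filter.atTop Filter.atTop :=
    tendsto_log_atTop.comp tendsto_natCast_atTop_atTop
  constructor
  · rw [tendsto_zero_iff_norm_tendsto_zero]
    simp only [norm_cexp_log, hs]
    have h := (tendsto_exp_atBot.comp ((Filter.tendsto_id).const_mul_atTop_of_neg (by linarith : -ε < 0))).comp hlog
    exact h
  · rw [tendsto_zero_iff_norm_tendsto_zero]
    have h := (tendsto_pow_mul_exp_neg_atTop_nhds_zero 1).comp (hlog.const_mul_atTop hε)
    have h2 := h.const_mul ε⁻¹
    rw [mul_zero] at h2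
    refine h2.congr' ?_
    filter_upwards [Filter.eventually_ge_atTop 1] with n hn
    have : 0 ≤ log n := log_nonneg (by exact_mod_cast hn)
    rw [norm_mul, norm_cexp_log, hs, Complex.norm_real, norm_of_nonneg this]
    simp only [Function.comp]
    rw [pow_one, show -(ε * log n) = -ε * log n by ring]
    field_simp
lemma zeta_em (ε t : ℝ) (hε : 0 < ε) (s : ℂ) (hs : s = 1 + ε + t * I) (N : ℕ) (hN : 1 ≤ N) :
    ‖riemannZeta s - ∑ n ∈ Finset.range N, LSeries.term 1 s n + cex ((1 - s) * (log N : ℝ)) / (1 - s)‖ ≤ 4 * ‖s‖ / √(N:ℝ) ∧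
    ‖-deriv riemannZeta s - ∑ n ∈ Finset.range N, LSeries.term (LSeries.logMul 1) s n + (cex ((1 - s) * (log N : ℝ)) * (log N : ℝ) / (1 - s)
      - cex ((1 - s) * (log N : ℝ)) / (1 - s) ^ 2)‖ ≤ 4 * (3 * ‖s‖) / √(N:ℝ) := by
  have hre : s.re = 1 + ε := by simp [hs]
  have hre1 : 1 < s.re := by linarith
  have hs1 : 1 - s ≠ 0 := by
    intro h
    have := congrArg Complex.re h
    simp [hre] at this; linarith
  have hsn : 1 ≤ ‖s‖ := hre1.le.trans (Complex.re_le_norm s)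
  have hf1 : ∀ x : ℝ, 1 ≤ x → HasDerivAt (fun x : ℝ => cex ((1 - s) * (log x : ℝ)) / (1 - s)) (cex (-s * (log x : ℝ))) x := by
    intro x hx
    refine ((cexp_log_deriv (1 - s) x li!).div_const _).congr_deriv ?_
    have : cex ((1 - s) * (log x : ℝ)) = cex (-s * (log x : ℝ)) * (x:ℂ) := by
      rw [show (1 - s) * (log x : ℝ) = -s * (log x : ℝ) + (log x : ℝ) by ring, Complex.exp_add,
        ← Complex.ofReal_exp, exp_log li!]
    rw [this]
    have hx0 : (x:ℂ) ≠ 0 := by exact_mod_cast (by linarith : x ≠ 0)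
    push_cast
    field_simp
  have hg1 : ∀ x : ℝ, 1 ≤ x → HasDerivAt (fun x : ℝ => cex (-s * (log x : ℝ))) (cex (-s * (log x : ℝ)) * (-s * (x⁻¹ : ℝ))) x :=
    fun x hx => cexp_log_deriv (-s) x li!
  have hn1 : ∀ x : ℝ, 1 ≤ x → ‖cex (-s * (log x : ℝ))‖ ≤ x⁻¹ := by
    intro x hx
    rw [norm_cexp_log, Complex.neg_re, hre]
    have hl := log_nonneg hx
    calc _ ≤ exp (-log x) := exp_le_exp.2 (by nlinarith)
      _ = _ := by rw [exp_neg, exp_log li!]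
  have habs : LSeries.abscissaOfAbsConv 1 < (s.re : EReal) := by
    rw [LSeries.abscissaOfAbsConv_one]; exact_mod_cast hre1
  constructor
  · refine em_sum (fun x : ℝ => cex ((1 - s) * (log x : ℝ)) / (1 - s)) _ _ ‖s‖ hf1 hg1 ?_ (norm_nonneg _) (LSeries.term 1 s) ?_ _ ?_ ?_ N hN
    · intro x hx
      have hx0 : 0 < x := by linarith
      rw [norm_mul, norm_mul, norm_neg, Complex.norm_real, norm_of_nonneg po!]
      calc _ ≤ x⁻¹ * (‖s‖ * x⁻¹) := by gcongr; exact hn1 x hx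
        _ = ‖s‖ * (1 / (x * x)) := by field_simp
        _ ≤ _ := by
          gcongr
          rw [sqrt_le_iff]; constructor <;> nlinarith
    · intro n hn
      rw [LSeries.term_of_ne_zero (by omega), cpow_nat _ _ hn, neg_mul, Complex.exp_neg]
      simp
    · rw [← LSeries_one_eq_riemannZeta hre1]
      exact (LSeriesSummable_of_abscissaOfAbsConv_lt_re habs).hasSum
    · have := (G_tendsto ε hε (1 - s) (by simp [hre])).1.div_const (1 - s)
      simpa using this
  · have hg2 : ∀ x : ℝ, 1 ≤ x → HasDerivAt (fun x : ℝ => cex (-s * (log x : ℝ)) * (log x : ℝ))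
        (cex (-s * (log x : ℝ)) * (-s * (x⁻¹ : ℝ)) * (log x : ℝ) + cex (-s * (log x : ℝ)) * (x⁻¹ : ℝ)) x :=
      fun x hx => (hg1 x hx).mul (hasDerivAt_log li!).ofReal_comp
    have hf2 : ∀ x : ℝ, 1 ≤ x → HasDerivAt (fun x : ℝ => cex ((1 - s) * (log x : ℝ)) * (log x : ℝ) / (1 - s)
      - cex ((1 - s) * (log x : ℝ)) / (1 - s) ^ 2) (cex (-s * (log x : ℝ)) * (log x : ℝ)) x := by
      intro x hx
      have h1 := ((hf1 x hx).mul (hasDerivAt_log (by linarith : x ≠ 0)).ofReal_comp).sub ((hf1 x hx).div_const (1 - s))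
      have : cex ((1 - s) * (log x : ℝ)) = cex (-s * (log x : ℝ)) * (x:ℂ) := by
        rw [show (1 - s) * (log x : ℝ) = -s * (log x : ℝ) + (log x : ℝ) by ring, Complex.exp_add,
          ← Complex.ofReal_exp, exp_log li!]
      have hx0 : (x:ℂ) ≠ 0 := by exact_mod_cast (by linarith : x ≠ 0)
      refine (h1.congr_deriv ?_).congr_of_eventuallyEq (Filter.Eventually.of_forall fun z => ?_)
      · rw [this]
        push_cast
        field_simp
        ring
      · simp only [Pi.mul_apply, Pi.sub_apply]
        field_simp
    refine em_sum (fun x : ℝ => cex ((1 - s) * (log x : ℝ)) * (log x : ℝ) / (1 - s)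
      - cex ((1 - s) * (log x : ℝ)) / (1 - s) ^ 2) _ _ (3 * ‖s‖) hf2 hg2 ?_ po! (LSeries.term (LSeries.logMul 1) s) ?_ _ ?_ ?_ N hN
    · intro x hx
      have hx0 : 0 < x := by linarith
      have hl := log_nonneg hx
      have hl2 := log_le_two_sqrt x hx0
      have hsx : 1 ≤ √x := one_le_sqrt.2 hx
      calc _ ≤ ‖cex (-s * (log x : ℝ))‖ * (‖s‖ * x⁻¹) * log x + ‖cex (-s * (log x : ℝ))‖ * x⁻¹ := by
            refine (norm_add_le _ _).trans ?_
            simp only [norm_mul, norm_neg, Complex.norm_real]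
            rw [norm_of_nonneg hl, norm_of_nonneg (by positivity : 0 ≤ x⁻¹)]
        _ ≤ x⁻¹ * (‖s‖ * x⁻¹) * (2 * √x) + x⁻¹ * (‖s‖ * x⁻¹ * √x) := by
            have := hn1 x hx
            gcongr
            calc x⁻¹ = 1 * x⁻¹ * 1 := by ring
              _ ≤ _ := by gcongr
        _ = 3 * ‖s‖ * (√x / (x * x)) := by field_simp; ring
        _ = _ := by
          congr 1
          have : x = √x * √x := (mul_self_sqrt hx0.le).symm
          rw [div_eq_div_iff po! po!]
          nlinarith
    · intro n hn
      rw [LSeries.term_of_ne_zero (by omega), cpow_nat _ _ hn, neg_mul, Complex.exp_neg]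
      simp only [LSeries.logMul, Pi.one_apply, mul_one, Complex.natCast_log]
      rw [div_eq_mul_inv, mul_comm]
    · have : deriv riemannZeta s = -LSeries (LSeries.logMul 1) s := by
        rw [← LSeries_deriv habs]
        refine Filter.EventuallyEq.deriv_eq ?_
        filter_upwards [(isOpen_lt continuous_const Complex.continuous_re).mem_nhds hre1] with z hz
        exact (LSeries_one_eq_riemannZeta hz).symm
      rw [this, neg_neg]
      refine (LSeriesSummable_of_abscissaOfAbsConv_lt_re ?_).hasSum
      rwa [LSeries.abscissaOfAbsConv_logMul]
    · have h1 := (G_tendsto ε hε (1 - s) (by simp [hre])).1.div_const ((1 - s) ^ 2)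
      have h2 := (G_tendsto ε hε (1 - s) (by simp [hre])).2.div_const (1 - s)
      have := h2.sub h1
      simpa using this
lemma zeta_bound : ∃ C : ℝ, 1 ≤ C ∧ ∀ ε t : ℝ, 0 < ε → ε ≤ 1 →
    ‖riemannZeta (1 + ε + t * I)‖ ≤ 1 / ‖(ε:ℂ) + t * I‖ + C * log (2 + |t|) ∧
    (1 ≤ |t| → ‖deriv riemannZeta (1 + ε + t * I)‖ ≤ C * log (2 + |t|) ^ 2) := by
  refine ⟨200, by norm_num, fun ε t hε hε1 => ?_⟩
  set s : ℂ := 1 + ε + t * I with hs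
  have hT := abs_nonneg t
  set N : ℕ := ⌈(2 + |t|) ^ 2⌉₊ with hN
  have hN2 : (2 + |t|) ^ 2 ≤ (N:ℝ) := Nat.le_ceil _
  have hN4 : (4:ℝ) ≤ N := by nlinarith
  have hN1 : 1 ≤ N := by exact_mod_cast (by linarith : (1:ℝ) ≤ N)
  have hNu : (N:ℝ) ≤ (2 + |t|) ^ 3 := by
    have := (Nat.ceil_lt_add_one (by positivity : 0 ≤ (2 + |t|) ^ 2)).le
    nlinarith [sq_nonneg (|t|), mul_nonneg hT (sq_nonneg (|t|))]
  set l := log (2 + |t|) with hl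
  have hl0 : 1 / 2 ≤ l := by
    have h2 : log 2 ≤ l := log_le_log nn! li!
    linarith [log_two_gt_d9]
  have hlN : log N ≤ 3 * l := by
    have := log_le_log li! hNu
    rwa [log_pow] at this
  have hlN0 : 0 ≤ log N := log_nonneg li!
  have hsq : 2 + |t| ≤ √(N:ℝ) := le_sqrt_of_sq_le hN2
  have hsn : ‖s‖ ≤ 2 + |t| := by
    rw [hs]
    refine (norm_add_le _ _).trans (add_le_add ?_ (by simp))
    rw [show (1:ℂ) + ε = ((1 + ε : ℝ):ℂ) by push_cast; ring, Complex.norm_real, norm_of_nonneg li!]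
    linarith
  have hfrac : ‖s‖ / √(N:ℝ) ≤ 1 := by
    rw [div_le_one li!]; linarith
  have hG : ‖cex ((1 - s) * (log N : ℝ))‖ ≤ 1 := by
    rw [norm_cexp_log, exp_le_one_iff]
    have : (1 - s).re = -ε := by simp [hs]
    rw [this]; nlinarith
  have h1s : 1 - s = -((ε:ℂ) + t * I) := by rw [hs]; ring
  have hterm : ∀ n : ℕ, ‖LSeries.term 1 s n‖ ≤ 1 / (n:ℝ) ∧ ‖LSeries.term (LSeries.logMul 1) s n‖ ≤ 1 / (n:ℝ) * log n := by
    intro n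
    rcases Nat.eq_zero_or_pos n with rfl | hn
    · simp
    · have hn' : (1:ℝ) ≤ n := by exact_mod_cast hn
      have hl := log_nonneg hn'
      have : ‖((n:ℂ) ^ s)⁻¹‖ ≤ 1 / (n:ℝ) := by
        rw [cpow_nat _ _ hn, ← Complex.exp_neg, ← neg_mul, norm_cexp_log]
        have : (-s).re = -(1 + ε) := by simp [hs]
        rw [this]
        calc _ ≤ exp (-log n) := exp_le_exp.2 (by nlinarith)
          _ = _ := by rw [exp_neg, exp_log li!, one_div]
      rw [LSeries.term_of_ne_zero (by omega), LSeries.term_of_ne_zero (by omega)]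
      simp only [LSeries.logMul, Pi.one_apply, mul_one, div_eq_mul_inv (_ : ℂ) _, one_mul, norm_mul]
      refine ⟨this, ?_⟩
      rw [← Complex.natCast_log, Complex.norm_real, norm_of_nonneg hl, mul_comm]
      gcongr
  have hharm := harm N
  obtain ⟨hz, hd⟩ := zeta_em ε t hε s hs N hN1
  rw [mul_div_assoc] at hz
  rw [show 4 * (3 * ‖s‖) / √(N:ℝ) = 4 * (3 * (‖s‖ / √(N:ℝ))) by ring] at hd
  constructor
  · have h2 : ‖∑ n ∈ Finset.range N, LSeries.term 1 s n‖ ≤ 1 + 3 * l := by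
      refine (norm_sum_le _ _).trans ((Finset.sum_le_sum fun n _ => (hterm n).1).trans ?_)
      linarith
    have h3 : ‖cex ((1 - s) * (log N : ℝ)) / (1 - s)‖ ≤ 1 / ‖(ε:ℂ) + t * I‖ := by
      rw [norm_div, h1s, norm_neg, ← h1s]; gcongr
    calc ‖riemannZeta s‖ = ‖(riemannZeta s - ∑ n ∈ Finset.range N, LSeries.term 1 s n + cex ((1 - s) * (log N : ℝ)) / (1 - s))
          + ∑ n ∈ Finset.range N, LSeries.term 1 s n - cex ((1 - s) * (log N : ℝ)) / (1 - s)‖ := by congr 1; ring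
      _ ≤ 4 * (‖s‖ / √(N:ℝ)) + (1 + 3 * l) + 1 / ‖(ε:ℂ) + t * I‖ :=
        (norm_sub_le _ _).trans (add_le_add ((norm_add_le _ _).trans (add_le_add hz h2)) h3)
      _ ≤ _ := by nlinarith
  · intro ht
    have h2 : ‖∑ n ∈ Finset.range N, LSeries.term (LSeries.logMul 1) s n‖ ≤ (1 + 3 * l) * (3 * l) := by
      refine (norm_sum_le _ _).trans ?_
      calc _ ≤ ∑ n ∈ Finset.range N, 1 / (n:ℝ) * log N := by
            refine Finset.sum_le_sum fun n hn => (hterm n).2.trans ?_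
            rcases Nat.eq_zero_or_pos n with rfl | hn0
            · simp
            · gcongr
              exact (Finset.mem_range.1 hn).le
        _ = (∑ n ∈ Finset.range N, 1 / (n:ℝ)) * log N := by rw [Finset.sum_mul]
        _ ≤ _ := by gcongr; linarith
    have h1s' : 1 ≤ ‖1 - s‖ := by
      rw [h1s, norm_neg]; exact ht.trans (le_norm_al' ε t)
    have h3 : ‖cex ((1 - s) * (log N : ℝ)) * (log N : ℝ) / (1 - s)
      - cex ((1 - s) * (log N : ℝ)) / (1 - s) ^ 2‖ ≤ 3 * l + 1 := by
      refine (norm_sub_le _ _).trans ?_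
      simp only [norm_div, norm_mul, norm_pow, Complex.norm_real]
      rw [norm_of_nonneg hlN0]
      refine add_le_add ?_ ?_
      · refine (div_le_self po! h1s').trans ?_
        nlinarith
      · exact (div_le_self po! (one_le_pow₀ h1s')).trans hG
    rw [← norm_neg]
    calc ‖-deriv riemannZeta s‖ = ‖(-deriv riemannZeta s - ∑ n ∈ Finset.range N, LSeries.term (LSeries.logMul 1) s n + (cex ((1 - s) * (log N : ℝ)) * (log N : ℝ) / (1 - s)
      - cex ((1 - s) * (log N : ℝ)) / (1 - s) ^ 2))
          + ∑ n ∈ Finset.range N, LSeries.term (LSeries.logMul 1) s n - (cex ((1 - s) * (log N : ℝ)) * (log N : ℝ) / (1 - s)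
      - cex ((1 - s) * (log N : ℝ)) / (1 - s) ^ 2)‖ := by congr 1; ring
      _ ≤ 4 * (3 * (‖s‖ / √(N:ℝ))) + (1 + 3 * l) * (3 * l) + (3 * l + 1) :=
        (norm_sub_le _ _).trans (add_le_add ((norm_add_le _ _).trans (add_le_add hd h2)) h3)
      _ ≤ _ := by nlinarith
end
end HTP

namespace HTP
lemma ld_far : ∃ C : ℝ, 0 < C ∧ ∀ ε t : ℝ, 0 < ε → ε ≤ 1 → 1 ≤ |t| →
    ‖-deriv riemannZeta (1 + ε + t * Complex.I) / riemannZeta (1 + ε + t * Complex.I)‖ ^ 4 ≤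
      C * (1 / ε) ^ 3 * Real.log (2 + |t|) ^ 9 := by
  obtain ⟨C, hC, hz⟩ := zeta_bound
  refine ⟨C ^ 4 * (1 + C) ^ 3 * (2 + 2 * C), by positivity, fun ε t hε hε1 ht => ?_⟩
  set l := Real.log (2 + |t|) with hl
  have hl1 : 1 ≤ l := by
    have h3 : Real.log 3 ≤ l := Real.log_le_log nn! li!
    have : 1 ≤ Real.log 3 := by
      rw [Real.le_log_iff_exp_le nn!]; linarith [Real.exp_one_lt_d9]
    linarith
  have h341 := DirichletCharacter.norm_LSeries_product_ge_one (1 : DirichletCharacter ℂ 1) hε t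
  have hL : ∀ s : ℂ, 1 < s.re → LSeries (fun n : ℕ => (1 : DirichletCharacter ℂ 1) n) s = riemannZeta s := by
    intro s hs
    rw [← LSeries_one_eq_riemannZeta hs]
    refine LSeries_congr (fun {n} _ => ?_) s
    have : IsUnit ((n : ZMod 1)) := by
      rw [Subsingleton.elim (n : ZMod 1) 1]; exact isUnit_one
    simp [MulChar.one_apply this]
  have e2 : ((1 : DirichletCharacter ℂ 1) ^ 2) = 1 := one_pow 2
  rw [e2, hL _ (by simp [hε]), hL _ (by simp [hε]), hL _ (by simp [hε])] at h341
  rw [show (1:ℂ) + ε + Complex.I * t = 1 + ε + t * Complex.I by ring,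
    show (1:ℂ) + ε + 2 * Complex.I * t = 1 + ε + ((2 * t : ℝ):ℂ) * Complex.I by push_cast; ring, norm_mul, norm_mul, norm_pow, norm_pow] at h341
  have h0 := (hz ε 0 hε hε1).1
  have hd := (hz ε t hε hε1).2 ht
  have h2 := (hz ε (2 * t) hε hε1).1
  simp only [Complex.ofReal_zero, zero_mul, add_zero, abs_zero, Complex.norm_real] at h0
  rw [Real.norm_of_nonneg hε.le] at h0
  set z := ‖riemannZeta (1 + ε + t * Complex.I)‖ with hzd
  set d := ‖deriv riemannZeta (1 + ε + t * Complex.I)‖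
  have h0' : ‖riemannZeta (1 + ε)‖ ≤ (1 + C) * (1 / ε) := by
    have : Real.log 2 ≤ 1 := by linarith [Real.log_two_lt_d9]
    have h1 : 1 ≤ 1 / ε := by rw [le_div_iff₀ hε]; linarith
    nlinarith
  have h2' : ‖riemannZeta (1 + ε + ((2 * t : ℝ):ℂ) * Complex.I)‖ ≤ (2 + 2 * C) * l := by
    have h3 : 1 / ‖(ε:ℂ) + ((2 * t : ℝ):ℂ) * Complex.I‖ ≤ 1 := by
      have : 1 ≤ ‖(ε:ℂ) + ((2 * t : ℝ):ℂ) * Complex.I‖ := by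
        refine le_trans ?_ (le_norm_al' ε (2 * t))
        rw [abs_mul, abs_two]; linarith
      rw [div_le_one li!]; exact this
    have h4 : Real.log (2 + |2 * t|) ≤ 2 * l := by
      rw [hl, ← Real.log_rpow po!]
      refine Real.log_le_log po! ?_
      rw [abs_mul, abs_two, Real.rpow_two]
      nlinarith [abs_nonneg t]
    nlinarith
  have hz0 : 0 < z := by
    rcases (norm_nonneg (riemannZeta (1 + ε + t * Complex.I))).eq_or_lt with h | h
    · rw [← hzd] at h
      rw [← h] at h341; norm_num at h341
    · exact h
  have hone : 1 ≤ ((1 + C) * (1 / ε)) ^ 3 * z ^ 4 * ((2 + 2 * C) * l) := by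
    refine le_trans h341 ?_
    gcongr
  rw [norm_div, norm_neg, div_pow, div_le_iff₀ po!]
  calc d ^ 4 ≤ (C * l ^ 2) ^ 4 * 1 := by rw [mul_one]; gcongr
    _ ≤ (C * l ^ 2) ^ 4 * (((1 + C) * (1 / ε)) ^ 3 * z ^ 4 * ((2 + 2 * C) * l)) := by gcongr
    _ = _ := by ring
open ArithmeticFunction in
lemma rc_one : vonMangoldt.residueClass (1 : ZMod 1) = fun n => vonMangoldt n := by
  ext n
  simp only [vonMangoldt.residueClass, Set.indicator]
  exact if_pos (Subsingleton.elim (α := ZMod 1) _ _)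
lemma ld_near : ∃ C : ℝ, 0 < C ∧ ∀ ε t : ℝ, 0 < ε → ε ≤ 1 → |t| ≤ 1 →
    ‖-deriv riemannZeta (1 + ε + t * Complex.I) / riemannZeta (1 + ε + t * Complex.I) - 1 / (ε + t * Complex.I)‖ ≤ C := by
  have hK : IsCompact ((fun p : ℝ × ℝ => (1 + p.1 + p.2 * Complex.I : ℂ)) '' (Set.Icc 0 1 ×ˢ Set.Icc (-1) 1)) :=
    (isCompact_Icc.prod isCompact_Icc).image (by fun_prop)
  have hcont := (ArithmeticFunction.vonMangoldt.continuousOn_LFunctionResidueClassAux (1 : ZMod 1)).mono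
    (s := {s : ℂ | 1 ≤ s.re}) (t := (fun p : ℝ × ℝ => (1 + p.1 + p.2 * Complex.I : ℂ)) '' (Set.Icc 0 1 ×ˢ Set.Icc (-1) 1)) (by
      rintro _ ⟨p, hp, rfl⟩
      simp [hp.1.1])
  obtain ⟨C, hC⟩ := hK.exists_bound_of_continuousOn hcont
  refine ⟨max C 1, by positivity, fun ε t hε hε1 ht => ?_⟩
  have h1 := hC (1 + ε + t * Complex.I) ⟨(ε, t), ⟨⟨hε.le, hε1⟩, abs_le.1 ht⟩, rfl⟩
  rw [ArithmeticFunction.vonMangoldt.eqOn_LFunctionResidueClassAux isUnit_one (show 1 < (1 + ε + t * Complex.I : ℂ).re by simp [hε])] at h1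
  simp only [rc_one] at h1
  rw [ArithmeticFunction.LSeries_vonMangoldt_eq_deriv_riemannZeta_div (by simp [hε])] at h1
  refine le_trans (le_of_eq ?_) (h1.trans (le_max_left _ _))
  congr 2
  simp only [Nat.totient_one, Nat.cast_one, inv_one]
  congr 1
  ring
end HTP

namespace HTP
noncomputable def DD (ε t : ℝ) : ℂ := -deriv riemannZeta (1 + ε + t * Complex.I) / riemannZeta (1 + ε + t * Complex.I)
open ArithmeticFunction in
lemma DD_hasSum (ε t : ℝ) (hε : 0 < ε) :
    HasSum (fun n : ℕ => vonMangoldt n * Real.exp (-(1 + ε) * Real.log n) * Real.cos (t * Real.log n)) (DD ε t).re := by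
  have hre : 1 < (1 + ε + t * Complex.I : ℂ).re := by simp [hε]
  have h := (LSeriesSummable_vonMangoldt hre).hasSum
  have e : ∑' n, LSeries.term (fun n => (vonMangoldt n : ℂ)) (1 + ε + t * Complex.I) n = DD ε t :=
    LSeries_vonMangoldt_eq_deriv_riemannZeta_div hre
  rw [e] at h
  have h2 := Complex.hasSum_re h
  convert h2 using 2 with n
  rcases Nat.eq_zero_or_pos n with rfl | hn
  · simp
  · rw [LSeries.term_of_ne_zero (by omega), cpow_nat _ _ hn, div_eq_mul_inv, ← Complex.exp_neg, Complex.re_ofReal_mul, Complex.exp_re, mul_assoc]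
    simp only [Complex.neg_re, Complex.neg_im, Complex.re_mul_ofReal, Complex.im_mul_ofReal]
    simp [Real.cos_neg]
    left; left; ring
lemma DD_real : ∃ C : ℝ, 0 < C ∧ ∀ ε : ℝ, 0 < ε → ε ≤ 1 → |(DD ε 0).re - 1 / ε| ≤ C := by
  obtain ⟨C, hC, h⟩ := ld_near
  refine ⟨C, hC, fun ε h0 h1 => ?_⟩
  have := (Complex.abs_re_le_norm _).trans (h ε 0 h0 h1 (by simp))
  rw [Complex.sub_re] at this
  have e : (1 / ((ε:ℂ) + (0:ℝ) * Complex.I)).re = 1 / ε := by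
    rw [Complex.ofReal_zero, zero_mul, add_zero, ← Complex.ofReal_one, ← Complex.ofReal_div, Complex.ofReal_re]
  rw [e] at this
  exact this
open ArithmeticFunction in
lemma zb_split (y z ε t : ℝ) (hy : 2 ≤ y) (hz : 1 ≤ z) (hε : 0 < ε) :
    (DD ε 0).re - (DD ε t).re ≤ 2 * Real.exp (-(ε / 2) * Real.log y) * (DD (ε / 2) 0).re
      + 2 * (∑' n : ℕ, (if n.Prime then 0 else vonMangoldt.residueClass (1 : ZMod 1) n) / (n:ℝ))
      + 2 * (∑ p ∈ primesLE z, Real.log p / p)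
      + Real.log y * (∑ p ∈ (primesLE y).filter (fun p : ℕ => z < p), (1 - Real.cos (t * Real.log p)) / p) := by
  have hL : 0 ≤ Real.log y := Real.log_nonneg li!
  have h1 := (DD_hasSum ε 0 hε).sub (DD_hasSum ε t hε)
  have h2 := (DD_hasSum (ε / 2) 0 po!).mul_left (2 * Real.exp (-(ε / 2) * Real.log y))
  have h3 := ((vonMangoldt.summable_residueClass_non_primes_div (1 : ZMod 1)).hasSum).mul_left 2
  have h4 : HasSum (fun n : ℕ => if n ∈ primesLE z then Real.log n / n else 0) (∑ p ∈ primesLE z, Real.log p / p) := by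
    have := hasSum_sum_of_ne_finset_zero (f := fun n : ℕ => if n ∈ primesLE z then Real.log n / n else 0) (s := primesLE z)
      (fun b hb => by simp [hb]) (L := SummationFilter.unconditional ℕ)
    rwa [Finset.sum_congr rfl (fun p hp => if_pos hp)] at this
  have h5 : HasSum (fun n : ℕ => if n ∈ (primesLE y).filter (fun p : ℕ => z < p) then (1 - Real.cos (t * Real.log n)) / n else 0)
      (∑ p ∈ (primesLE y).filter (fun p : ℕ => z < p), (1 - Real.cos (t * Real.log p)) / p) := by
    have := hasSum_sum_of_ne_finset_zero (f := fun n : ℕ => if n ∈ (primesLE y).filter (fun p : ℕ => z < p) then (1 - Real.cos (t * Real.log n)) / n else 0) (s := (primesLE y).filter (fun p : ℕ => z < p))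
      (fun b hb => if_neg hb) (L := SummationFilter.unconditional ℕ)
    rwa [Finset.sum_congr rfl (fun p hp => if_pos hp)] at this
  refine hasSum_le ?_ h1 (((h2.add h3).add (h4.mul_left 2)).add (h5.mul_left (Real.log y)))
  intro n
  simp only [zero_mul, Real.cos_zero, mul_one, rc_one]
  rcases Nat.eq_zero_or_pos n with rfl | hn
  · simp
  have hn1 : (1:ℝ) ≤ n := by exact_mod_cast hn
  have hln := Real.log_nonneg hn1
  have hΛ : 0 ≤ vonMangoldt n := vonMangoldt_nonneg
  have hc1 : 0 ≤ 1 - Real.cos (t * Real.log n) := by linarith [Real.cos_le_one (t * Real.log n)]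
  have hc2 : 1 - Real.cos (t * Real.log n) ≤ 2 := by linarith [Real.neg_one_le_cos (t * Real.log n)]
  have t2 : 0 ≤ 2 * ((if n.Prime then 0 else vonMangoldt n) / (n:ℝ)) := by
    split_ifs <;> positivity
  have t3 : 0 ≤ 2 * (if n ∈ primesLE z then Real.log n / n else 0) := by
    split_ifs <;> positivity
  have t4 : 0 ≤ Real.log y * (if n ∈ (primesLE y).filter (fun p : ℕ => z < p) then (1 - Real.cos (t * Real.log n)) / n else 0) := by
    split_ifs <;> positivity
  have t1 : 0 ≤ 2 * Real.exp (-(ε / 2) * Real.log y) * (vonMangoldt n * Real.exp (-(1 + ε / 2) * Real.log n)) := by positivity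
  have e1 : vonMangoldt n * Real.exp (-(1 + ε) * Real.log n) - vonMangoldt n * Real.exp (-(1 + ε) * Real.log n) * Real.cos (t * Real.log n)
      = vonMangoldt n * Real.exp (-(1 + ε) * Real.log n) * (1 - Real.cos (t * Real.log n)) := by ring
  rw [e1]
  rcases lt_or_ge y n with hyn | hyn
  · have : vonMangoldt n * Real.exp (-(1 + ε) * Real.log n) * (1 - Real.cos (t * Real.log n)) ≤
        2 * Real.exp (-(ε / 2) * Real.log y) * (vonMangoldt n * Real.exp (-(1 + ε / 2) * Real.log n)) := by
      have hlog := Real.log_le_log li! hyn.le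
      have : Real.exp (-(1 + ε) * Real.log n) ≤ Real.exp (-(ε / 2) * Real.log y) * Real.exp (-(1 + ε / 2) * Real.log n) := by
        rw [← Real.exp_add]
        refine Real.exp_le_exp.2 ?_
        nlinarith
      calc _ ≤ vonMangoldt n * (Real.exp (-(ε / 2) * Real.log y) * Real.exp (-(1 + ε / 2) * Real.log n)) * 2 := by gcongr
        _ = _ := by ring
    linarith
  · have hexp : Real.exp (-(1 + ε) * Real.log n) ≤ 1 / n := by
      calc _ ≤ Real.exp (-Real.log n) := Real.exp_le_exp.2 (by nlinarith)
        _ = _ := by rw [Real.exp_neg, Real.exp_log li!, one_div]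
    by_cases hp : n.Prime
    · have hΛp : vonMangoldt n = Real.log n := vonMangoldt_apply_prime hp
      rcases le_or_gt (n:ℝ) z with hnz | hnz
      · have hm : n ∈ primesLE z := (prime_mem li!).2 ⟨hnz, hp⟩
        rw [if_pos hm]
        have : vonMangoldt n * Real.exp (-(1 + ε) * Real.log n) * (1 - Real.cos (t * Real.log n)) ≤ 2 * (Real.log n / n) := by
          rw [hΛp]
          calc _ ≤ Real.log n * (1 / n) * 2 := by gcongr
            _ = _ := by ring
        linarith
      · have hm : n ∈ (primesLE y).filter (fun p : ℕ => z < p) :=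
          Finset.mem_filter.2 ⟨(prime_mem li!).2 ⟨hyn, hp⟩, hnz⟩
        rw [if_pos hm] at t4 ⊢
        have hlog := Real.log_le_log li! hyn
        have : vonMangoldt n * Real.exp (-(1 + ε) * Real.log n) * (1 - Real.cos (t * Real.log n)) ≤ Real.log y * ((1 - Real.cos (t * Real.log n)) / n) := by
          rw [hΛp]
          calc _ ≤ Real.log y * (1 / n) * (1 - Real.cos (t * Real.log n)) := by gcongr
            _ = _ := by ring
        linarith
    · rw [if_neg hp] at t2 ⊢
      have : vonMangoldt n * Real.exp (-(1 + ε) * Real.log n) * (1 - Real.cos (t * Real.log n)) ≤ 2 * (vonMangoldt n / n) := by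
        calc _ ≤ vonMangoldt n * (1 / n) * 2 := by gcongr
          _ = _ := by ring
      linarith
lemma zb_mid : ∃ c κ y0 : ℝ, 0 < c ∧ 0 < κ ∧ κ < 1 ∧ 2 ≤ y0 ∧ ∀ y t : ℝ, y0 ≤ y → Real.pi / Real.log y ≤ |t| → |t| ≤ Real.log y ^ 21 →
    c ≤ ∑ p ∈ (primesLE y).filter (fun p : ℕ => y ^ κ < p), (1 - Real.cos (t * Real.log p)) / p := by
  obtain ⟨C1, hC1, hnear⟩ := ld_near
  obtain ⟨C2, hC2, hfar⟩ := ld_far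
  obtain ⟨C3, hC3, hreal⟩ := DD_real
  obtain ⟨C4, hC4, hM⟩ := mertens
  set C5 := ∑' n : ℕ, (if n.Prime then 0 else ArithmeticFunction.vonMangoldt.residueClass (1 : ZMod 1) n) / (n:ℝ)
  have hlit := (Real.isLittleO_pow_log_id_atTop (n := 9)).bound (show (0:ℝ) < 1 / (C2 * 22 ^ 9 * 10 ^ 8) by positivity)
  have hev := Real.tendsto_log_atTop.eventually (hlit.and ((Filter.eventually_ge_atTop 16).and (Filter.eventually_ge_atTop (10000 * (C1 + 2 * C3 + 2 * C4 + 2 * |C5|)))))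
  obtain ⟨y1, hy1⟩ := Filter.eventually_atTop.1 hev
  refine ⟨1/1000, 1/65536, max y1 2, by norm_num, by norm_num, by norm_num, le_max_right _ _, fun y t hy ht1 ht2 => ?_⟩
  have hy2 : 2 ≤ y := (le_max_right _ _).trans hy
  obtain ⟨h9, hL16, hLC⟩ := hy1 y ((le_max_left _ _).trans hy)
  set L := Real.log y with hLdef
  have hL0 : 0 < L := by linarith
  have hz1 : 1 ≤ y ^ (1/65536:ℝ) := Real.one_le_rpow li! nn!
  have hsp := zb_split y (y ^ (1/65536:ℝ)) (16 / L) t hy2 hz1 po!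
  rw [← hLdef] at hsp
  have hlogz : Real.log (y ^ (1/65536:ℝ)) = 1/65536 * L := Real.log_rpow li! _
  have hMz := (abs_le.1 (hM _ hz1)).2
  rw [hlogz] at hMz
  have hε1 : 16 / L ≤ 1 := by rw [div_le_one hL0]; exact hL16
  have hr1 := (abs_le.1 (hreal (16 / L) po! hε1)).1
  have hr2 := (abs_le.1 (hreal (16 / L / 2) po! li!)).2
  rw [one_div_div] at hr1
  rw [show 1 / (16 / L / 2) = L / 8 by field_simp; norm_num] at hr2
  have hexp : Real.exp (-(16 / L / 2) * L) ≤ 1 / 1000 := by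
    rw [show -(16 / L / 2) * L = -(8 * 1) by field_simp; norm_num, Real.exp_neg, one_div]
    refine inv_anti₀ nn! ?_
    rw [show (8:ℝ) * 1 = ((8:ℕ):ℝ) * 1 by norm_num, Real.exp_nat_mul]
    calc (1000:ℝ) ≤ 2.7 ^ 8 := by norm_num
      _ ≤ _ := pow_le_pow_left₀ nn! (by linarith [Real.exp_one_gt_d9]) 8
  have hC5 : C5 ≤ |C5| := le_abs_self _
  have hC50 : 0 ≤ |C5| := abs_nonneg _
  have hD2 : 2 * Real.exp (-(16 / L / 2) * L) * (DD (16 / L / 2) 0).re ≤ 2 * (1 / 1000) * (L / 8 + C3) := by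
    have h0 : (DD (16 / L / 2) 0).re ≤ L / 8 + C3 := by linarith
    calc _ ≤ 2 * Real.exp (-(16 / L / 2) * L) * (L / 8 + C3) := by gcongr
      _ ≤ _ := by gcongr
  have hDt : (DD (16 / L) t).re ≤ L / 16 - 9 / 4240 * L + C1 := by
    rcases le_or_gt |t| 1 with h | h
    · have h6 := (Complex.re_le_norm _).trans (hnear (16 / L) t po! hε1 h)
      rw [Complex.sub_re] at h6
      have e : (1 / (((16 / L : ℝ):ℂ) + t * Complex.I)).re = (16 / L) / ((16 / L) ^ 2 + t ^ 2) := by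
        rw [one_div, Complex.inv_re, Complex.normSq_apply]
        simp
        ring
      rw [e] at h6
      have h7 : (16 / L) / ((16 / L) ^ 2 + t ^ 2) ≤ L / 16 - 9 / 4240 * L := by
        have h8 : (3 / L) ^ 2 ≤ t ^ 2 := by
          rw [← sq_abs t]
          refine pow_le_pow_left₀ po! (le_trans ?_ ht1) 2
          gcongr
          exact Real.pi_gt_three.le
        calc _ ≤ (16 / L) / ((16 / L) ^ 2 + (3 / L) ^ 2) := by gcongr
          _ = _ := by field_simp; norm_num
      have : (DD (16 / L) t).re = (-deriv riemannZeta (1 + (16 / L : ℝ) + t * Complex.I) / riemannZeta (1 + (16 / L : ℝ) + t * Complex.I)).re := rfl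
      linarith
    · have h6 := hfar (16 / L) t po! hε1 h.le
      have h7 : Real.log (2 + |t|) ≤ 22 * Real.log L := by
        rw [show (22:ℝ) * Real.log L = Real.log (L ^ 22) by rw [Real.log_pow]; norm_num]
        refine Real.log_le_log po! ?_
        have : 1 ≤ L ^ 21 := one_le_pow₀ li!
        rw [pow_succ]
        nlinarith
      have hlt0 : 0 ≤ Real.log (2 + |t|) := Real.log_nonneg (by linarith [abs_nonneg t])
      have hlL : 0 ≤ Real.log L := Real.log_nonneg li!
      simp only [id, Real.norm_eq_abs] at h9
      rw [abs_of_nonneg po!, abs_of_pos hL0, div_mul_eq_mul_div, one_mul, le_div_iff₀ po!] at h9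
      have h8 : ‖DD (16 / L) t‖ ^ 4 ≤ (L / 100) ^ 4 := by
        refine h6.trans ?_
        rw [one_div_div]
        calc C2 * (L / 16) ^ 3 * Real.log (2 + |t|) ^ 9 ≤ C2 * L ^ 3 * (22 * Real.log L) ^ 9 := by
              gcongr
              linarith
          _ = L ^ 3 * (Real.log L ^ 9 * (C2 * 22 ^ 9 * 10 ^ 8)) / 10 ^ 8 := by ring
          _ ≤ L ^ 3 * L / 10 ^ 8 := by gcongr
          _ = _ := by ring
      have h10 := (pow_le_pow_iff_left₀ (norm_nonneg _) po! nn!).1 h8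
      have := (Complex.re_le_norm (DD (16 / L) t)).trans h10
      linarith
  set S := ∑ p ∈ (primesLE y).filter (fun p : ℕ => y ^ (1/65536:ℝ) < p), (1 - Real.cos (t * Real.log p)) / p
  have hfin : 1 / 1000 * L ≤ L * S := by linarith
  have : L * (1 / 1000) ≤ L * S := by linarith
  exact le_of_mul_le_mul_left this hL0
end HTP

namespace HTP
section
open Real MeasureTheory
open Complex (I)
lemma ell (s : ℂ) (hs : 1 < s.re) (p : ℕ) (hp : p.Prime) :
    ‖-Complex.log (1 - (p:ℂ) ^ (-s)) - cex (-s * (log p : ℝ))‖ ≤ 1 / (p:ℝ) ^ 2 := by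
  have hp2 : (2:ℝ) ≤ p := by exact_mod_cast hp.two_le
  rw [cpow_nat _ _ hp.one_lt.le]
  set z := cex (-s * (log p : ℝ)) with hz
  have hzn : ‖z‖ ≤ 1 / p := by
    rw [hz, norm_cexp_log, Complex.neg_re]
    have := log_prime_pos hp
    calc _ ≤ exp (-log p) := exp_le_exp.2 (by nlinarith)
      _ = _ := by rw [exp_neg, exp_log li!, one_div]
  have hz2 : ‖z‖ ≤ 1 / 2 := hzn.trans (one_div_le_one_div_of_le nn! hp2)
  have h := Complex.norm_log_one_add_sub_self_le (z := -z) (by rw [norm_neg]; linarith)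
  rw [norm_neg] at h
  have e : -Complex.log (1 - z) - z = -(Complex.log (1 + -z) - -z) := by rw [← sub_eq_add_neg]; ring
  rw [e, norm_neg]
  refine h.trans ?_
  have h2 : (1 - ‖z‖)⁻¹ ≤ 2 := by
    rw [inv_le_comm₀ li! nn!]; linarith
  calc ‖z‖ ^ 2 * (1 - ‖z‖)⁻¹ / 2 ≤ (1 / p) ^ 2 * 2 / 2 := by
        have : 0 ≤ (1 - ‖z‖)⁻¹ := inv_nonneg.2 li!
        gcongr
    _ = _ := by ring
lemma za_cons : ∃ C y0 : ℝ, 0 < C ∧ 2 ≤ y0 ∧ ∀ y t : ℝ, y0 ≤ y → t ≠ 0 →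
    exp (-∑ p ∈ primesLE y, (1 - cos (t * log p)) / p) ≤ C / log y * (1 / |t| + log (2 + |t|)) := by
  obtain ⟨C1, hC1, hz⟩ := zeta_bound
  obtain ⟨C2, hC2, hreal⟩ := DD_real
  set Q := ∑' n : ℕ, 1 / (n:ℝ) ^ 2
  refine ⟨exp (2 * (1 + C2) + 2 * Q) * (2 * C1), exp 16, by positivity, by linarith [add_one_le_exp (16:ℝ)], fun y t hy ht => ?_⟩
  have hy0 : 0 < y := (exp_pos _).trans_le hy
  have hL16 : 16 ≤ log y := (le_log_iff_exp_le hy0).2 hy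
  set L := log y with hLdef
  have hL0 : 0 < L := by linarith
  have hδ : 0 < 1 / L := by positivity
  have hδ1 : 1 / L ≤ 1 := by rw [div_le_one hL0]; linarith
  set s : ℝ → ℂ := fun t => 1 + (1 / L : ℝ) + t * I with hs
  have hsre : ∀ t, (s t).re = 1 + 1 / L := by intro t; simp [hs]
  have hsre1 : ∀ t, 1 < (s t).re := by intro t; rw [hsre]; linarith
  have hsum : ∀ t, Summable (fun p : Nat.Primes => -Complex.log (1 - (p:ℂ) ^ (-(s t)))) := by
    intro t
    have := DirichletCharacter.summable_neg_log_one_sub_mul_prime_cpow (1 : DirichletCharacter ℂ 1) (hsre1 t)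
    refine this.congr fun p => ?_
    have : IsUnit (((p:ℕ) : ZMod 1)) := by
      rw [Subsingleton.elim ((p:ℕ) : ZMod 1) 1]; exact isUnit_one
    rw [MulChar.one_apply this, one_mul]
  set Z : ℝ → ℂ := fun t => ∑' p : Nat.Primes, -Complex.log (1 - (p:ℂ) ^ (-(s t))) with hZ
  have hZn : ∀ t, ‖riemannZeta (s t)‖ = exp (Z t).re := by
    intro t
    rw [← riemannZeta_eulerProduct_exp_log (hsre1 t), Complex.norm_exp]
  set g : ℕ → ℝ := fun n => (if n ∈ primesLE y then (1 - cos (t * log n)) / n else 0)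
    + 2 / L * (ArithmeticFunction.vonMangoldt n * exp (-(1 + 1 / L) * log n)) + 2 * (1 / (n:ℝ) ^ 2) with hg
  have hgsum : HasSum g (∑ p ∈ primesLE y, (1 - cos (t * log p)) / p + 2 / L * (DD (1 / L) 0).re + 2 * Q) := by
    refine HasSum.add (HasSum.add ?_ ?_) ?_
    · have := hasSum_sum_of_ne_finset_zero (f := fun n : ℕ => if n ∈ primesLE y then (1 - cos (t * log n)) / n else 0) (s := primesLE y)
        (fun b hb => if_neg hb) (L := SummationFilter.unconditional ℕ)
      rwa [Finset.sum_congr rfl (fun p hp => if_pos hp)] at this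
    · have := (DD_hasSum (1 / L) 0 hδ).mul_left (2 / L)
      simpa using this
    · exact ((summable_one_div_nat_pow.2 nn!).hasSum).mul_left 2
  have hg0 : ∀ n, 0 ≤ g n := by
    intro n
    have h1 : 0 ≤ 1 - cos (t * log n) := by linarith [cos_le_one (t * log n)]
    have h2 : 0 ≤ ArithmeticFunction.vonMangoldt n := ArithmeticFunction.vonMangoldt_nonneg
    simp only [hg]
    split_ifs <;> positivity
  have hdiff : (Z 0).re - (Z t).re ≤ ∑ p ∈ primesLE y, (1 - cos (t * log p)) / p + 2 / L * (DD (1 / L) 0).re + 2 * Q := by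
    have h1 := (Complex.hasSum_re (hsum 0).hasSum).sub (Complex.hasSum_re (hsum t).hasSum)
    have h2 : HasSum (fun p : Nat.Primes => g p) (∑' p : Nat.Primes, g p) :=
      (hgsum.summable.comp_injective Nat.Primes.coe_nat_injective).hasSum
    have h3 : ∑' p : Nat.Primes, g p ≤ ∑' n, g n := Summable.tsum_subtype_le g {p | p.Prime} hg0 hgsum.summable
    rw [hgsum.tsum_eq] at h3
    refine le_trans (hasSum_le ?_ h1 h2) h3
    intro ⟨p, hp⟩
    have hp2 : (2:ℝ) ≤ p := by exact_mod_cast hp.two_le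
    have hlp := log_prime_pos hp
    have l0 := ell (s 0) (hsre1 0) p hp
    have lt := ell (s t) (hsre1 t) p hp
    have l0' := (abs_le.1 ((Complex.abs_re_le_norm _).trans l0)).2
    have lt' := (abs_le.1 ((Complex.abs_re_le_norm _).trans lt)).1
    have hE : ∀ t, (cex (-(s t) * (log p : ℝ))).re = exp (-(1 + 1 / L) * log p) * cos (t * log p) := by
      intro t
      rw [Complex.exp_re, Complex.re_mul_ofReal, Complex.im_mul_ofReal, Complex.neg_re, hsre, Complex.neg_im, neg_mul (s t).im, cos_neg]
      simp [hs]
    rw [Complex.sub_re, hE] at l0' lt'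
    simp only [zero_mul, cos_zero, mul_one] at l0'
    set e := exp (-(1 + 1 / L) * log p) with he
    have hc1 : 0 ≤ 1 - cos (t * log p) := by linarith [cos_le_one (t * log p)]
    have hc2 : 1 - cos (t * log p) ≤ 2 := by linarith [neg_one_le_cos (t * log p)]
    have hmain : e * (1 - cos (t * log p)) ≤ (if p ∈ primesLE y then (1 - cos (t * log p)) / p else 0)
        + 2 / L * (ArithmeticFunction.vonMangoldt p * e) := by
      rw [ArithmeticFunction.vonMangoldt_apply_prime hp]
      have he0 : 0 ≤ e := (exp_pos _).le
      split_ifs with hm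
      · have : e ≤ 1 / p := by
          calc e ≤ exp (-log p) := exp_le_exp.2 (by nlinarith)
            _ = _ := by rw [exp_neg, exp_log li!, one_div]
        have h5 : e * (1 - cos (t * log p)) ≤ 1 / p * (1 - cos (t * log p)) := by gcongr
        have h6 : 0 ≤ 2 / L * (log p * e) := by positivity
        rw [one_div_mul_eq_div] at h5
        linarith
      · have hyp : y < p := by
          by_contra h
          exact hm ((prime_mem hy0.le).2 ⟨not_lt.1 h, hp⟩)
        have hlog : L ≤ log p := log_le_log hy0 hyp.le
        calc e * (1 - cos (t * log p)) ≤ e * 2 * 1 := by rw [mul_one]; gcongr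
          _ ≤ e * 2 * (log p / L) := by
            gcongr
            rw [le_div_iff₀ hL0]; linarith
          _ = _ := by ring
    simp only [hg]
    linarith
  have hD := (abs_le.1 (hreal (1 / L) hδ hδ1)).2
  rw [one_div_one_div] at hD
  have hD2 : 2 / L * (DD (1 / L) 0).re ≤ 2 * (1 + C2) := by
    calc 2 / L * (DD (1 / L) 0).re ≤ 2 / L * (L + C2) := by gcongr; linarith
      _ = 2 * (1 + C2 / L) := by field_simp
      _ ≤ _ := by
        gcongr
        exact div_le_self hC2.le li!
  have hz0 : L / 2 ≤ ‖riemannZeta (s 0)‖ := by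
    have h := (zeta_em (1 / L) 0 hδ (s 0) rfl 1 le_rfl).1
    simp only [Finset.range_one, Finset.sum_singleton, LSeries.term_zero, Nat.cast_one, log_one, Complex.ofReal_zero, mul_zero, Complex.exp_zero, sqrt_one, div_one, sub_zero] at h
    have e0 : s 0 = ((1 + 1 / L : ℝ):ℂ) := by simp [hs]
    have e1 : 1 / (1 - s 0) = -(L:ℂ) := by
      rw [e0]; push_cast
      have : (L:ℂ) ≠ 0 := by exact_mod_cast hL0.ne'
      field_simp
      ring
    rw [e1, ← sub_eq_add_neg] at h
    have h2 : ‖s 0‖ ≤ 2 := by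
      rw [e0, Complex.norm_real, norm_of_nonneg po!]; linarith
    have h3 := norm_sub_norm_le (L:ℂ) (riemannZeta (s 0))
    rw [Complex.norm_real, norm_of_nonneg hL0.le, norm_sub_rev] at h3
    linarith
  have hzt := (hz (1 / L) t hδ hδ1).1
  have hl0 : 0 ≤ log (2 + |t|) := log_nonneg (by linarith [abs_nonneg t])
  have htp : 0 < |t| := abs_pos.2 ht
  have hzt2 : ‖riemannZeta (s t)‖ ≤ C1 * (1 / |t| + log (2 + |t|)) := by
    have : 1 / ‖((1 / L : ℝ):ℂ) + t * I‖ ≤ 1 / |t| := one_div_le_one_div_of_le htp (le_norm_al' _ _)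
    have h4 : 0 ≤ 1 / |t| := by positivity
    have : 1 / |t| ≤ C1 * (1 / |t|) := le_mul_of_one_le_left h4 hC1
    simp only [hs]
    linarith
  rw [hZn] at hz0 hzt2
  set S := ∑ p ∈ primesLE y, (1 - cos (t * log p)) / p
  have hexp : exp (-S) * exp (Z 0).re ≤ exp (2 * (1 + C2) + 2 * Q) * exp (Z t).re := by
    rw [← exp_add, ← exp_add]
    exact exp_le_exp.2 li!
  have h5 : exp (-S) * (L / 2) ≤ exp (2 * (1 + C2) + 2 * Q) * (C1 * (1 / |t| + log (2 + |t|))) :=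
    (mul_le_mul_of_nonneg_left hz0 (exp_pos _).le).trans (hexp.trans (mul_le_mul_of_nonneg_left hzt2 (exp_pos _).le))
  rw [div_mul_eq_mul_div, le_div_iff₀ hL0]
  linarith
end
end HTP

namespace HTP
section
open Real MeasureTheory
open Complex (I)
lemma q_mono (α : ℝ) (hα : 0 < α) (p : ℕ) (hp : p.Prime) : α * log p * (p^~α / (1 - p^~α)) ≤ 1 := by
  have h1 := prime_q_lt p hp α hα
  rw [mul_div_assoc', div_le_one li!, q_exp α p hp]
  have h2 := add_one_le_exp (α * log p)
  have h3 := exp_pos (-(α * log p))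
  have h4 : exp (α * log p) * exp (-(α * log p)) = 1 := by rw [← exp_add]; simp
  nlinarith
lemma log_x_eq (α x y : ℝ) (hα : 0 < α) (h : phi1 α y + log x = 0) :
    log x = ∑ p ∈ primesLE y, log p * (p^~α / (1 - p^~α)) := by
  rw [← phi1_eq α y hα]; linarith
lemma pr_of_mem {y : ℝ} {p : ℕ} (h : p ∈ primesLE y) : p.Prime := (mem_primesLE.1 h).2
lemma al_log (α x y : ℝ) (hα : 0 < α) (h : phi1 α y + log x = 0) : α * log x ≤ (primesLE y).card := by
  rw [log_x_eq α x y hα h, Finset.mul_sum, Finset.card_eq_sum_ones, Nat.cast_sum]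
  refine Finset.sum_le_sum fun p hp => ?_
  rw [← mul_assoc, Nat.cast_one]
  exact q_mono α hα p (pr_of_mem hp)
lemma al_phi2 (α y : ℝ) (hα : 0 < α) : α ^ 2 * phi2 α y ≤ (primesLE y).card := by
  rw [phi2_eq α y hα, Finset.mul_sum, Finset.card_eq_sum_ones, Nat.cast_sum]
  refine Finset.sum_le_sum fun p hp => ?_
  have hp' := pr_of_mem hp
  have h1 := prime_q_lt p hp' α hα
  have hl := log_prime_pos hp'
  rw [show α ^ 2 * (p^~α / (1 - p^~α) ^ 2 * log p ^ 2) =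
    (α * log p) ^ 2 * p^~α / (1 - p^~α) ^ 2 by ring, Nat.cast_one, div_le_one (pow_pos li! 2), q_exp α p hp']
  set v := α * log p with hv
  have hv0 : 0 ≤ v := by positivity
  have hs := self_le_sinh_iff.2 (by positivity : 0 ≤ v / 2)
  rw [sinh_eq] at hs
  have e1 : exp (-v) = exp (-(v / 2)) ^ 2 := by rw [← exp_nat_mul]; congr 1; push_cast; ring
  have e2 : exp (v / 2) * exp (-(v / 2)) = 1 := by rw [← exp_add]; simp
  have h5 : v * exp (-(v / 2)) ≤ 1 - exp (-v) := by
    rw [e1]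
    nlinarith [exp_pos (-(v / 2))]
  calc v ^ 2 * exp (-v) = (v * exp (-(v / 2))) ^ 2 := by rw [e1]; ring
    _ ≤ _ := pow_le_pow_left₀ po! h5 2
lemma q_le_w (α : ℝ) (hα : 0 < α) (p : ℕ) (hp : p.Prime) : p^~α ≤ p^~α / (1 - p^~α) := by
  have h1 := prime_q_lt p hp α hα
  have h2 := q_pos α p hp
  rw [le_div_iff₀ li!]
  nlinarith
lemma al_lt_one : ∃ y0 : ℝ, 2 ≤ y0 ∧ ∀ α x y : ℝ, y0 ≤ y → 0 < α → phi1 α y + log x = 0 → 3 * log y ≤ log x → α < 1 := by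
  obtain ⟨C, hC, hM⟩ := mertens
  set D := 4 * ∑' n : ℕ, 1 / (n:ℝ) ^ (3 / 2 : ℝ) with hD
  refine ⟨max 2 (exp (C + D + 1)), le_max_left _ _, fun α x y hy hα h hu => ?_⟩
  have hy2 := (le_max_left _ _).trans hy
  have hL : C + D + 1 ≤ log y := (le_log_iff_exp_le li!).2 ((le_max_right _ _).trans hy)
  by_contra hlt
  push Not at hlt
  have h1 := (abs_le.1 (hM y li!)).2
  have h2 := sum_log_sq (primesLE y) (fun p hp => pr_of_mem hp)
  rw [log_x_eq α x y hα h] at hu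
  have h3 : ∑ p ∈ primesLE y, log p * (p^~α / (1 - p^~α)) ≤
      ∑ p ∈ primesLE y, (log p / p + log p / (p * ((p:ℝ) - 1))) := by
    refine Finset.sum_le_sum fun p hp => ?_
    have hp' := pr_of_mem hp
    have hp2 : (2:ℝ) ≤ p := by exact_mod_cast hp'.two_le
    have hl := log_prime_pos hp'
    have hq : p^~α ≤ 1 / p := by
      rw [one_div, ← rpow_neg_one]
      exact rpow_le_rpow_of_exponent_le li! li!
    have hp1 : 1 / (p:ℝ) < 1 := by rw [div_lt_one li!]; linarith
    calc _ ≤ log p * (1 / p / (1 - 1 / p)) := by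
          gcongr
      _ = _ := by
        have : (p:ℝ) - 1 ≠ 0 := by linarith
        have : (p:ℝ) ≠ 0 := by linarith
        field_simp
        ring
  rw [Finset.sum_add_distrib] at h3
  have hD0 : 0 ≤ D := mul_nonneg nn! (tsum_nonneg fun n => by positivity)
  linarith
lemma half_lower : ∃ y0 : ℝ, 2 ≤ y0 ∧ ∀ α y : ℝ, y0 ≤ y → 0 < α → α ≤ 1 →
    y ^ ((1 - α) / 2) * (log y / 4) ≤ ∑ p ∈ (primesLE y).filter (fun p : ℕ => √y < p), log p * p^~α := by
  obtain ⟨C, hC, hM⟩ := mertens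
  refine ⟨max 2 (exp (8 * C)), le_max_left _ _, fun α y hy hα hα1 => ?_⟩
  have hy2 := (le_max_left _ _).trans hy
  have hL : 8 * C ≤ log y := (le_log_iff_exp_le li!).2 ((le_max_right _ _).trans hy)
  have hs1 : 1 ≤ √y := one_le_sqrt.2 li!
  have hlogs : log (√y) = log y / 2 := log_sqrt li!
  have h1 := (abs_le.1 (hM y li!)).1
  have h2 := (abs_le.1 (hM (√y) hs1)).2
  rw [hlogs] at h2
  have hsub : ∑ p ∈ primesLE y, log p / p ≤ ∑ p ∈ (primesLE y).filter (fun p : ℕ => √y < p), log p / p + ∑ p ∈ primesLE (√y), log p / p := by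
    rw [← Finset.sum_filter_add_sum_filter_not (primesLE y) (fun p : ℕ => √y < p)]
    refine add_le_add le_rfl (Finset.sum_le_sum_of_subset_of_nonneg ?_ fun p hp _ => ?_)
    · intro p hp
      rw [Finset.mem_filter, not_lt] at hp
      exact (prime_mem li!).2 ⟨hp.2, pr_of_mem hp.1⟩
    · have := log_prime_pos (pr_of_mem hp)
      positivity
  have h3 : y ^ ((1 - α) / 2) * ∑ p ∈ (primesLE y).filter (fun p : ℕ => √y < p), log p / p ≤ ∑ p ∈ (primesLE y).filter (fun p : ℕ => √y < p), log p * p^~α := by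
    rw [Finset.mul_sum]
    refine Finset.sum_le_sum fun p hp => ?_
    rw [Finset.mem_filter] at hp
    have hp' := pr_of_mem hp.1
    have hp0 : (0:ℝ) < p := by exact_mod_cast hp'.pos
    have hl := log_prime_pos hp'
    have e : p^~α = (p:ℝ) ^ (1 - α) / p := by
      rw [show -α = (1 - α) - 1 by ring, rpow_sub_one hp0.ne']
    have : y ^ ((1 - α) / 2) ≤ (p:ℝ) ^ (1 - α) := by
      calc _ = (√y) ^ (1 - α) := by rw [sqrt_eq_rpow, ← rpow_mul li!]; congr 1; ring
        _ ≤ _ := rpow_le_rpow po! hp.2.le li!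
    rw [e]
    calc _ ≤ (p:ℝ) ^ (1 - α) * (log p / p) := by gcongr
      _ = _ := by ring
  refine le_trans ?_ h3
  gcongr
  linarith
lemma w_upper : ∃ C : ℝ, 0 < C ∧ ∀ α z : ℝ, 1 ≤ z → 1 / 4 ≤ α → α ≤ 1 →
    ∑ p ∈ primesLE z, log p * (p^~α / (1 - p^~α)) ≤ 8 * z ^ (1 - α) * (log z + C) := by
  obtain ⟨C, hC, hM⟩ := mertens
  refine ⟨C, hC, fun α z hz hα hα1 => ?_⟩
  have h1 := (abs_le.1 (hM z hz)).2
  calc _ ≤ ∑ p ∈ primesLE z, 8 * z ^ (1 - α) * (log p / p) := by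
        refine Finset.sum_le_sum fun p hp => ?_
        have hp' := pr_of_mem hp
        have hp0 : (0:ℝ) < p := by exact_mod_cast hp'.pos
        have hp2 : (2:ℝ) ≤ p := by exact_mod_cast hp'.two_le
        have hl := log_prime_pos hp'
        have hq0 := q_pos α p hp'
        have hpz := ((prime_mem li!).1 hp).1
        have hq : p^~α ≤ 7 / 8 := by
          calc p^~α ≤ (p:ℝ) ^ (-(1/4):ℝ) := rpow_le_rpow_of_exponent_le li! li!
            _ ≤ (2:ℝ) ^ (-(1/4):ℝ) := rpow_le_rpow_of_nonpos nn! hp2 nn!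
            _ ≤ 7 / 8 := by
              rw [rpow_neg nn!, inv_le_comm₀ po! nn!]
              have h4 : ((2:ℝ) ^ (1/4:ℝ)) ^ 4 = 2 := by
                rw [← rpow_natCast, ← rpow_mul nn!]; norm_num
              refine (pow_le_pow_iff_left₀ nn! po! (by norm_num : 4 ≠ 0)).1 ?_
              rw [h4]; norm_num
        have e : p^~α = (p:ℝ) ^ (1 - α) / p := by
          rw [show -α = (1 - α) - 1 by ring, rpow_sub_one hp0.ne']
        calc _ ≤ log p * (p^~α / (1 / 8)) := by gcongr; linarith
          _ = 8 * (p:ℝ) ^ (1 - α) * (log p / p) := by rw [e]; ring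
          _ ≤ _ := by gcongr
    _ = 8 * z ^ (1 - α) * ∑ p ∈ primesLE z, log p / p := by rw [Finset.mul_sum]
    _ ≤ _ := by
      gcongr; linarith
lemma theta_lower : ∃ y0 : ℝ, 2 ≤ y0 ∧ ∀ α y : ℝ, y0 ≤ y → 0 < α →
    y ^ (1 - α) / 8 ≤ ∑ p ∈ (primesLE y).filter (fun p : ℕ => √y < p), log p * p^~α := by
  obtain ⟨y1, hy1, hth⟩ := theta_ge
  refine ⟨max y1 100, (hy1.trans (le_max_left _ _)), fun α y hy hα => ?_⟩
  have h100 : 100 ≤ y := (le_max_right _ _).trans hy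
  have h1 := hth y ((le_max_left _ _).trans hy)
  have h2 := theta_le (√y) po!
  have hl4 : log 4 ≤ 3 / 2 := by
    rw [show (4:ℝ) = 2 ^ 2 by norm_num, log_pow]; push_cast; linarith [log_two_lt_d9]
  have hsy : √y ≤ y / 10 := by
    rw [sqrt_le_iff]; constructor <;> nlinarith
  have hsub : ∑ p ∈ primesLE y, log p ≤ ∑ p ∈ (primesLE y).filter (fun p : ℕ => √y < p), log p + ∑ p ∈ primesLE (√y), log p := by
    rw [← Finset.sum_filter_add_sum_filter_not (primesLE y) (fun p : ℕ => √y < p)]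
    refine add_le_add le_rfl (Finset.sum_le_sum_of_subset_of_nonneg ?_ fun p hp _ => ?_)
    · intro p hp
      rw [Finset.mem_filter, not_lt] at hp
      exact (prime_mem po!).2 ⟨hp.2, pr_of_mem hp.1⟩
    · exact (log_prime_pos (pr_of_mem hp)).le
  have h3 : y / 8 ≤ ∑ p ∈ (primesLE y).filter (fun p : ℕ => √y < p), log p := by nlinarith [sqrt_nonneg y]
  calc y ^ (1 - α) / 8 = y / 8 * y ^ (-α) := by
        rw [show 1 - α = -α + 1 by ring, rpow_add_one li!]; ring
    _ ≤ (∑ p ∈ (primesLE y).filter (fun p : ℕ => √y < p), log p) * y ^ (-α) := by gcongr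
    _ = ∑ p ∈ (primesLE y).filter (fun p : ℕ => √y < p), log p * y ^ (-α) := Finset.sum_mul _ _ _
    _ ≤ _ := by
      refine Finset.sum_le_sum fun p hp => ?_
      have hm := (Finset.mem_filter.1 hp).1
      have hp' := pr_of_mem hm
      have hp0 : (0:ℝ) < p := by exact_mod_cast hp'.pos
      have hl := log_prime_pos hp'
      gcongr ?_ * ?_
      exact rpow_le_rpow_of_nonpos hp0 ((prime_mem li!).1 hm).1 li!
lemma filter_le_logx (α x y : ℝ) (hα : 0 < α) (h : phi1 α y + log x = 0) (P : ℕ → Prop) [DecidablePred P] :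
    ∑ p ∈ (primesLE y).filter P, log p * p^~α ≤ log x := by
  rw [log_x_eq α x y hα h]
  calc _ ≤ ∑ p ∈ primesLE y, log p * p^~α := by
        refine Finset.sum_le_sum_of_subset_of_nonneg (Finset.filter_subset _ _) fun p hp _ => ?_
        have := log_prime_pos (pr_of_mem hp)
        have := q_pos α p (pr_of_mem hp)
        positivity
    _ ≤ _ := by
      refine Finset.sum_le_sum fun p hp => ?_
      have := log_prime_pos (pr_of_mem hp)
      have := q_le_w α hα p (pr_of_mem hp)
      gcongr
end
end HTP

namespace HTP
section
open Real MeasureTheory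
open Complex (I)
lemma card_ge : ∃ y0 : ℝ, 2 ≤ y0 ∧ ∀ y : ℝ, y0 ≤ y → y / (2 * log y) ≤ (primesLE y).card := by
  obtain ⟨y0, hy0, h⟩ := theta_ge
  refine ⟨y0, hy0, fun y hy => ?_⟩
  have hL : 0 < log y := log_pos li!
  have h1 := h y hy
  have h2 : ∑ p ∈ primesLE y, log p ≤ (primesLE y).card * log y := by
    rw [← nsmul_eq_mul]
    exact Finset.sum_le_card_nsmul _ _ _ fun p hp => log_le_of_mem li! hp
  rw [div_le_iff₀ po!]
  linarith
lemma phi2_lower (α x y : ℝ) (hα : 0 < α) (hy : 2 ≤ y) :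
    log y / 2 * ∑ p ∈ (primesLE y).filter (fun p : ℕ => √y < p), log p * (p^~α / (1 - p^~α)) ≤ phi2 α y := by
  rw [phi2_eq α y hα, Finset.mul_sum]
  refine le_trans (Finset.sum_le_sum fun p hp => ?_) (Finset.sum_le_sum_of_subset_of_nonneg (Finset.filter_subset (fun p : ℕ => √y < p) _) fun p hp _ => ?_)
  · rw [Finset.mem_filter] at hp
    have hp' := pr_of_mem hp.1
    have hl := log_prime_pos hp'
    have h1 := prime_q_lt p hp' α hα
    have h0 := q_pos α p hp'
    have hlog : log y / 2 ≤ log p := by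
      rw [← log_sqrt li!]
      exact log_le_log po! hp.2.le
    have h2 : p^~α / (1 - p^~α) ≤ p^~α / (1 - p^~α) ^ 2 := by
      refine div_le_div_of_nonneg_left h0.le (pow_pos li! 2) ?_
      nlinarith
    have h3 : 0 ≤ p^~α / (1 - p^~α) := div_nonneg h0.le li!
    calc _ ≤ log p * (log p * (p^~α / (1 - p^~α))) := by gcongr
      _ ≤ log p * (log p * (p^~α / (1 - p^~α) ^ 2)) := by gcongr
      _ = _ := by ring
  · have h0 := q_pos α p (pr_of_mem hp)
    positivity
lemma split_w (α x y : ℝ) (hα : 0 < α) (h : phi1 α y + log x = 0) :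
    log x ≤ ∑ p ∈ (primesLE y).filter (fun p : ℕ => √y < p), log p * (p^~α / (1 - p^~α))
      + ∑ p ∈ primesLE (√y), log p * (p^~α / (1 - p^~α)) := by
  rw [log_x_eq α x y hα h, ← Finset.sum_filter_add_sum_filter_not (primesLE y) (fun p : ℕ => √y < p)]
  refine add_le_add le_rfl (Finset.sum_le_sum_of_subset_of_nonneg ?_ fun p hp _ => ?_)
  · intro p hp
    rw [Finset.mem_filter, not_lt] at hp
    exact (prime_mem po!).2 ⟨hp.2, pr_of_mem hp.1⟩
  · have hp' := pr_of_mem hp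
    have h1 := prime_q_lt p hp' α hα
    have h0 := q_pos α p hp'
    exact mul_nonneg (log_prime_pos hp').le (div_nonneg h0.le li!)
lemma filter_q_le_w (α y : ℝ) (hα : 0 < α) : ∑ p ∈ (primesLE y).filter (fun p : ℕ => √y < p), log p * p^~α ≤
    ∑ p ∈ (primesLE y).filter (fun p : ℕ => √y < p), log p * (p^~α / (1 - p^~α)) := by
  refine Finset.sum_le_sum fun p hp => ?_
  have hp' := pr_of_mem (Finset.mem_filter.1 hp).1
  have := log_prime_pos hp'
  have := q_le_w α hα p hp'
  gcongr
lemma w_half : ∃ C y0 : ℝ, 0 < C ∧ 2 ≤ y0 ∧ ∀ α x y : ℝ, y0 ≤ y → 0 < α → α ≤ 1 → phi1 α y + log x = 0 → 1 ≤ α * log y →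
    log x ≤ C * ∑ p ∈ (primesLE y).filter (fun p : ℕ => √y < p), log p * (p^~α / (1 - p^~α)) := by
  obtain ⟨C, hC, hw⟩ := w_upper
  obtain ⟨y1, hy1, hh⟩ := half_lower
  obtain ⟨y2, hy2, ht⟩ := theta_lower
  have hlit := (isLittleO_log_rpow_atTop (show (0:ℝ) < 1/4 by norm_num)).bound (show (0:ℝ) < 1 by norm_num)
  obtain ⟨y3, hy3⟩ := Filter.eventually_atTop.1 hlit
  refine ⟨33, max (max y1 y2) (max y3 (exp (2 * C))), by norm_num, hy1.trans ((le_max_left _ _).trans (le_max_left _ _)), fun α x y hy hα hα1 h hαL => ?_⟩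
  have hyy1 : y1 ≤ y := ((le_max_left _ _).trans (le_max_left _ _)).trans hy
  have hyy2 : y2 ≤ y := ((le_max_right _ _).trans (le_max_left _ _)).trans hy
  have hyy3 : y3 ≤ y := ((le_max_left _ _).trans (le_max_right _ _)).trans hy
  have hyC : exp (2 * C) ≤ y := ((le_max_right _ _).trans (le_max_right _ _)).trans hy
  have hL : 2 * C ≤ log y := (le_log_iff_exp_le li!).2 hyC
  have hy0 : 0 < y := by linarith
  have hs1 : 1 ≤ √y := one_le_sqrt.2 li!
  have hlogs : log (√y) = log y / 2 := log_sqrt li!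
  have hsplit := split_w α x y hα h
  have hqw := filter_q_le_w α y hα
  set S := ∑ p ∈ (primesLE y).filter (fun p : ℕ => √y < p), log p * (p^~α / (1 - p^~α))
  rcases le_or_gt (1/4) α with h4 | h4
  · have h1 := hw α (√y) hs1 h4 hα1
    have h2 := hh α y hyy1 hα hα1
    rw [hlogs, sqrt_eq_rpow, ← rpow_mul li!, show 1 / 2 * (1 - α) = (1 - α) / 2 by ring] at h1
    have h3 : 8 * y ^ ((1 - α) / 2) * (log y / 2 + C) ≤ 32 * (y ^ ((1 - α) / 2) * (log y / 4)) := by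
      have : 0 ≤ y ^ ((1 - α) / 2) := by positivity
      nlinarith
    rw [sqrt_eq_rpow] at hsplit
    rw [sqrt_eq_rpow] at h2
    simp only [sqrt_eq_rpow] at hqw
    linarith
  · have h1 := ht α y hyy2 hα
    have h2 : ∑ p ∈ primesLE (√y), log p * (p^~α / (1 - p^~α)) ≤ √y * log y := by
      calc _ ≤ ∑ p ∈ primesLE (√y), log y := by
            refine Finset.sum_le_sum fun p hp => ?_
            have h5 := q_mono α hα p (pr_of_mem hp)
            refine le_of_mul_le_mul_left ?_ hα
            rw [← mul_assoc]
            linarith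
        _ = (primesLE (√y)).card * log y := by rw [Finset.sum_const, nsmul_eq_mul]
        _ ≤ _ := by
          have : ((primesLE (√y)).card:ℝ) ≤ √y := by
            have h6 : (primesLE (√y)).card ≤ ⌊√y⌋₊ := by
              have : primesLE (√y) ⊆ Finset.Icc 1 ⌊√y⌋₊ := by
                intro p hp
                have := mem_primesLE.1 hp
                exact Finset.mem_Icc.2 ⟨this.2.one_lt.le, this.1⟩
              simpa using Finset.card_le_card this
            exact (Nat.cast_le.2 h6).trans (Nat.floor_le po!)
          have : 0 ≤ log y := by linarith
          gcongr
    have h3 := hy3 y hyy3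
    rw [one_mul, norm_of_nonneg li!, norm_of_nonneg po!] at h3
    have h5 : √y * log y ≤ y ^ (3/4:ℝ) := by
      calc _ ≤ √y * y ^ (1/4:ℝ) := by gcongr
        _ = _ := by rw [sqrt_eq_rpow, ← rpow_add li!]; norm_num
    have h6 : y ^ (3/4:ℝ) ≤ y ^ (1 - α) := rpow_le_rpow_of_exponent_le li! li!
    have h7 : 0 ≤ y ^ (1 - α) := by positivity
    linarith
lemma rel_B : ∃ C y0 : ℝ, 0 < C ∧ 2 ≤ y0 ∧ ∀ α x y : ℝ, y0 ≤ y → 0 < α → phi1 α y + log x = 0 → 3 * log y ≤ log x →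
    (log y + 1 / α) ^ 2 ≤ C * (1 / (log x / log y) + log y / y) * phi2 α y := by
  obtain ⟨C, y1, hC, hy1, hw⟩ := w_half
  obtain ⟨y2, hy2, hk⟩ := card_ge
  obtain ⟨y3, hy3, hlt⟩ := al_lt_one
  refine ⟨max 24 (8 * C), max y1 (max y2 y3), by positivity, hy1.trans (le_max_left _ _), fun α x y hy hα h hu => ?_⟩
  have hyy1 : y1 ≤ y := (le_max_left _ _).trans hy
  have hyy2 : y2 ≤ y := ((le_max_left _ _).trans (le_max_right _ _)).trans hy
  have hyy3 : y3 ≤ y := ((le_max_right _ _).trans (le_max_right _ _)).trans hy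
  have hL : 0 < log y := log_pos li!
  have hx : 0 < log x := by linarith
  have hα1 := hlt α x y hyy3 hα h hu
  have hy0 : 0 < y := by linarith
  have hphi0 : 0 ≤ phi2 α y := by
    rw [phi2_eq α y hα]
    refine Finset.sum_nonneg fun p hp => ?_
    have h0 := q_pos α p (pr_of_mem hp)
    positivity
  rcases lt_or_ge (α * log y) 1 with hc | hc
  · have h1 : ((primesLE y).card:ℝ) / 3 ≤ α ^ 2 * phi2 α y := by
      rw [phi2_eq α y hα, Finset.mul_sum, Finset.card_eq_sum_ones, Nat.cast_sum, Finset.sum_div]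
      refine Finset.sum_le_sum fun p hp => ?_
      have hp' := pr_of_mem hp
      have h1 := prime_q_lt p hp' α hα
      have hl := log_prime_pos hp'
      have hv1 : α * log p ≤ 1 := by
        have := log_le_of_mem li! hp
        nlinarith
      rw [show α ^ 2 * (p^~α / (1 - p^~α) ^ 2 * log p ^ 2) =
        (α * log p) ^ 2 * p^~α / (1 - p^~α) ^ 2 by ring, Nat.cast_one, le_div_iff₀ (pow_pos li! 2)]
      rw [q_exp α p hp'] at h1 ⊢
      have h2 := add_one_le_exp (-(α * log p))
      have h3 : 1 / 3 ≤ exp (-(α * log p)) := by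
        have h4 : exp (-1) ≤ exp (-(α * log p)) := exp_le_exp.2 li!
        have := exp_neg_one_gt_d9
        linarith
      have h5 : (1 - exp (-(α * log p))) ^ 2 ≤ (α * log p) ^ 2 := pow_le_pow_left₀ li! li! 2
      nlinarith [sq_nonneg (α * log p)]
    have h2 := hk y hyy2
    have h3 : (log y + 1 / α) ^ 2 ≤ (2 / α) ^ 2 := by
      refine pow_le_pow_left₀ po! ?_ 2
      have : log y ≤ 1 / α := by rw [le_div_iff₀ hα]; linarith
      calc _ ≤ 1 / α + 1 / α := by linarith
        _ = _ := by ring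
    refine h3.trans ?_
    have h4 : 4 ≤ 24 * (log y / y) * (α ^ 2 * phi2 α y) := by
      have h5 : y / (6 * log y) ≤ α ^ 2 * phi2 α y := by
        refine le_trans ?_ h1
        calc _ = y / (2 * log y) / 3 := by field_simp; norm_num
          _ ≤ _ := by gcongr
      calc (4:ℝ) = 24 * (log y / y) * (y / (6 * log y)) := by field_simp; norm_num
        _ ≤ _ := by gcongr
    have h5 : (2 / α) ^ 2 ≤ 24 * (log y / y) * phi2 α y := by
      rw [div_pow, div_le_iff₀ po!]
      linarith
    refine h5.trans ?_
    have : 0 ≤ 1 / (log x / log y) := by positivity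
    gcongr
    · exact le_max_left _ _
    · linarith
  · have h1 := hw α x y hyy1 hα hα1.le h hc
    have h2 := phi2_lower α x y hα li!
    have h3 : (log y + 1 / α) ^ 2 ≤ (2 * log y) ^ 2 := by
      refine pow_le_pow_left₀ po! ?_ 2
      have : 1 / α ≤ log y := by rw [div_le_iff₀ hα]; linarith
      linarith
    refine h3.trans ?_
    have h4 : log y * log x ≤ 2 * C * phi2 α y := by
      calc _ ≤ log y * (C * ∑ p ∈ (primesLE y).filter (fun p : ℕ => √y < p), log p * (p^~α / (1 - p^~α))) := by gcongr
        _ = 2 * C * (log y / 2 * ∑ p ∈ (primesLE y).filter (fun p : ℕ => √y < p), log p * (p^~α / (1 - p^~α))) := by ring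
        _ ≤ _ := by gcongr
    have h5 : (2 * log y) ^ 2 ≤ 8 * C * (1 / (log x / log y)) * phi2 α y := by
      rw [one_div_div]
      have e : (2 * log y) ^ 2 = 4 * (log y / log x) * (log y * log x) := by field_simp; norm_num
      rw [e]
      calc _ ≤ 4 * (log y / log x) * (2 * C * phi2 α y) := by gcongr
        _ = _ := by ring
    refine h5.trans ?_
    have : 0 ≤ log y / y := by positivity
    gcongr
    · exact le_max_right _ _
    · linarith
lemma rel_small : ∃ y0 : ℝ, 2 ≤ y0 ∧ ∀ α x y : ℝ, y0 ≤ y → 0 < α → α ≤ 1 → phi1 α y + log x = 0 → 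
    log x ≤ log y * log y ^ 7 → 3 / 4 ≤ α ∧ phi2 α y ≤ 8 * log y * log x ∧ y ^ (1 - α) ≤ 16 * (log x / log y) ^ 2 := by
  obtain ⟨y1, hy1, hh⟩ := half_lower
  obtain ⟨y2, hy2, ht⟩ := theta_lower
  have hlit := (isLittleO_log_rpow_atTop (show (0:ℝ) < 1/32 by norm_num)).bound (show (0:ℝ) < 1/2 by norm_num)
  obtain ⟨y3, hy3⟩ := Filter.eventually_atTop.1 hlit
  refine ⟨max y1 (max y2 y3), hy1.trans (le_max_left _ _), fun α x y hy hα hα1 h hx => ?_⟩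
  have hyy1 : y1 ≤ y := (le_max_left _ _).trans hy
  have hyy2 : y2 ≤ y := ((le_max_left _ _).trans (le_max_right _ _)).trans hy
  have hyy3 : y3 ≤ y := ((le_max_right _ _).trans (le_max_right _ _)).trans hy
  have hL : 0 < log y := log_pos li!
  have hy0 : 0 < y := by linarith
  have h34 : 3 / 4 ≤ α := by
    by_contra hlt
    push Not at hlt
    have h1 := (ht α y hyy2 hα).trans (filter_le_logx α x y hα h _)
    have h2 := hy3 y hyy3
    rw [norm_of_nonneg hL.le, norm_of_nonneg po!] at h2
    have h3 : y ^ (1/4:ℝ) < y ^ (1 - α) := rpow_lt_rpow_of_exponent_lt li! li!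
    have h4 : log y ^ 8 ≤ (1 / 2 * y ^ (1/32:ℝ)) ^ 8 := pow_le_pow_left₀ hL.le h2 8
    rw [mul_pow, ← rpow_natCast (y ^ (1/32:ℝ)), ← rpow_mul hy0.le] at h4
    norm_num at h4
    have h5 : log y * log y ^ 7 = log y ^ 8 := by ring
    norm_num at h3
    linarith [rpow_pos_of_pos hy0 (1/4)]
  refine ⟨h34, ?_, ?_⟩
  · rw [phi2_eq α y hα, log_x_eq α x y hα h, Finset.mul_sum]
    refine Finset.sum_le_sum fun p hp => ?_
    have hp' := pr_of_mem hp
    have hp2 : (2:ℝ) ≤ p := by exact_mod_cast hp'.two_le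
    have hl := log_prime_pos hp'
    have hlog := log_le_of_mem hy0.le hp
    have h1 := prime_q_lt p hp' α hα
    have hq0 := q_pos α p hp'
    have hq : p^~α ≤ 7 / 8 := by
      calc p^~α ≤ (p:ℝ) ^ (-(1/2):ℝ) := rpow_le_rpow_of_exponent_le li! li!
        _ ≤ (2:ℝ) ^ (-(1/2):ℝ) := rpow_le_rpow_of_nonpos nn! hp2 nn!
        _ ≤ 7 / 8 := by
          rw [rpow_neg nn!, ← sqrt_eq_rpow, inv_le_comm₀ po! nn!]
          exact le_sqrt_of_sq_le nn!
    set q := p^~α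
    have h18 : 1 / 8 ≤ 1 - q := by linarith
    have e : q / (1 - q) ^ 2 = q / (1 - q) / (1 - q) := by rw [div_div, sq]
    rw [e]
    have hw : 0 ≤ q / (1 - q) := div_nonneg hq0.le li!
    calc q / (1 - q) / (1 - q) * log p ^ 2 ≤ q / (1 - q) / (1 / 8) * (log y * log p) := by
          rw [sq]; gcongr
      _ = _ := by ring
  · have h1 := (hh α y hyy1 hα hα1).trans (filter_le_logx α x y hα h _)
    have h2 : y ^ ((1 - α) / 2) ≤ 4 * (log x / log y) := by
      rw [mul_div_assoc', le_div_iff₀ hL]; linarith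
    calc y ^ (1 - α) = (y ^ ((1 - α) / 2)) ^ 2 := by
          rw [← rpow_natCast (y ^ ((1 - α) / 2)), ← rpow_mul hy0.le]; congr 1; push_cast; ring
      _ ≤ (4 * (log x / log y)) ^ 2 := pow_le_pow_left₀ po! h2 2
      _ = _ := by ring
lemma rel_u : ∃ C y0 : ℝ, 0 < C ∧ 2 ≤ y0 ∧ ∀ α x y : ℝ, y0 ≤ y → 1 / 4 ≤ α → α ≤ 1 → phi1 α y + log x = 0 → 
    log x / log y ≤ C * y ^ (1 - α) := by
  obtain ⟨C, hC, hw⟩ := w_upper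
  refine ⟨16, max 2 (exp C), by norm_num, le_max_left _ _, fun α x y hy hα hα1 h => ?_⟩
  have hy2 := (le_max_left _ _).trans hy
  have hL : C ≤ log y := (le_log_iff_exp_le li!).2 ((le_max_right _ _).trans hy)
  have h1 := hw α y li! hα hα1
  rw [← log_x_eq α x y li! h] at h1
  rw [div_le_iff₀ li!]
  have : 0 ≤ y ^ (1 - α) := by positivity
  nlinarith
end
end HTP

namespace HTP
section
open Real MeasureTheory
open Complex (I)
lemma card_le_diam (S : Finset ℕ) (R : ℝ) (hR : 0 ≤ R) (h : ∀ a ∈ S, ∀ b ∈ S, (b:ℝ) ≤ a + R) : (S.card:ℝ) ≤ R + 1 := by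
  rcases S.eq_empty_or_nonempty with rfl | hne
  · simp; linarith
  have hs : S ⊆ Finset.Icc (S.min' hne) (S.max' hne) := fun n hn => Finset.mem_Icc.2 ⟨S.min'_le n hn, S.le_max' n hn⟩
  have h1 := Finset.card_le_card hs
  rw [Nat.card_Icc] at h1
  have h2 := h _ (S.min'_mem hne) _ (S.max'_mem hne)
  have h4 := S.min'_le _ (S.max'_mem hne)
  have h3 : S.card + S.min' hne ≤ S.max' hne + 1 := by omega
  have h3' : (S.card:ℝ) + S.min' hne ≤ S.max' hne + 1 := by exact_mod_cast h3
  linarith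
lemma bad_count (t ε y κ : ℝ) (ht : 0 < t) (hε : 0 < ε) (hκ : 0 < κ) (hκ1 : κ < 1) (hy : 0 < y) (S : Finset ℕ)
    (h : ∀ n ∈ S, κ * y < n ∧ (n:ℝ) ≤ y ∧ |t * log n - 2 * π * round (t * log n / (2 * π))| ≤ ε) :
    (S.card:ℝ) ≤ (t * (log (1 / κ) / (2 * π)) + 2) * (2 * ε * y / t + 1) := by
  have hpi := pi_pos
  set f : ℕ → ℤ := fun n => round (t * log n / (2 * π)) with hf
  set a := t * log (κ * y) / (2 * π) with ha
  set b := t * log y / (2 * π) with hb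
  have hab : b - a = t * (log (1 / κ) / (2 * π)) := by
    rw [ha, hb, log_mul hκ.ne' hy.ne', one_div, log_inv]; ring
  have hlk : 0 < log (1 / κ) := log_pos (by rw [lt_div_iff₀ hκ]; linarith)
  have hab0 : 0 ≤ b - a := by rw [hab]; positivity
  have himg : S.image f ⊆ Finset.Icc ⌈a - 1/2⌉ ⌊b + 1/2⌋ := by
    intro j hj
    obtain ⟨n, hn, rfl⟩ := Finset.mem_image.1 hj
    obtain ⟨h1, h2, h3⟩ := h n hn
    have hn0 : (0:ℝ) < n := lt_trans po! h1
    have h4 := abs_le.1 (abs_sub_round (t * log n / (2 * π)))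
    have h5 : a ≤ t * log n / (2 * π) := by
      rw [ha]; gcongr
    have h6 : t * log n / (2 * π) ≤ b := by
      rw [hb]; gcongr
    rw [Finset.mem_Icc, Int.ceil_le, Int.le_floor]
    simp only [hf]
    constructor <;> linarith [h4.1, h4.2]
  have hcard : ((S.image f).card:ℝ) ≤ t * (log (1 / κ) / (2 * π)) + 2 := by
    have h1 := Finset.card_le_card himg
    rw [Int.card_Icc] at h1
    have h2 : (((⌊b + 1/2⌋ + 1 - ⌈a - 1/2⌉).toNat : ℕ) : ℝ) ≤ b - a + 2 := by
      rcases le_total 0 (⌊b + 1/2⌋ + 1 - ⌈a - 1/2⌉) with h | h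
      · have : (((⌊b + 1/2⌋ + 1 - ⌈a - 1/2⌉).toNat : ℤ) : ℝ) = ((⌊b + 1/2⌋ + 1 - ⌈a - 1/2⌉ : ℤ) : ℝ) := by rw [Int.toNat_of_nonneg h]
        rw [Int.cast_natCast] at this
        rw [this]; push_cast
        linarith [Int.floor_le (b + 1/2), Int.le_ceil (a - 1/2)]
      · rw [Int.toNat_of_nonpos h]; push_cast; linarith
    rw [← hab]
    exact (Nat.cast_le.2 h1).trans h2
  have hfib : ∀ j ∈ S.image f, (((S.filter (fun n => f n = j)).card : ℕ) : ℝ) ≤ 2 * ε * y / t + 1 := by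
    intro j _
    refine card_le_diam _ _ po! fun m hm n hn => ?_
    rw [Finset.mem_filter] at hm hn
    obtain ⟨hm1, -, hm3⟩ := h m hm.1
    obtain ⟨hn1, hn2, hn3⟩ := h n hn.1
    have hm0 : (0:ℝ) < m := lt_trans po! hm1
    have hn0 : (0:ℝ) < n := lt_trans po! hn1
    have e1 := hm.2
    have e2 := hn.2
    simp only [hf] at e1 e2
    rw [e1] at hm3
    rw [e2] at hn3
    have h1 := log_le_sub_one_of_pos (div_pos hm0 hn0)
    rw [log_div hm0.ne' hn0.ne'] at h1
    have h2 : t * (log n - log m) ≤ 2 * ε := by linarith [(abs_le.1 hm3).1, (abs_le.1 hn3).2]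
    have h3 : (n:ℝ) * (1 - m / n) = n - m := by field_simp
    have h4 : 1 - (m:ℝ) / n ≤ 2 * ε / t := by rw [le_div_iff₀ ht]; nlinarith
    have h5 : (n:ℝ) - m ≤ y * (2 * ε / t) := by
      rw [← h3]
      have : 0 ≤ 2 * ε / t := by positivity
      calc _ ≤ (n:ℝ) * (2 * ε / t) := by gcongr
        _ ≤ _ := by gcongr
    have h6 : y * (2 * ε / t) = 2 * ε * y / t := by ring
    linarith
  rw [Finset.card_eq_sum_card_image f S, Nat.cast_sum]
  refine (Finset.sum_le_card_nsmul _ _ _ hfib).trans ?_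
  rw [nsmul_eq_mul]
  gcongr
end
end HTP

namespace HTP
section
open Real MeasureTheory
open Complex (I)
set_option maxHeartbeats 1000000 in
lemma good_count : ∃ c0 c y0 : ℝ, 0 < c0 ∧ 0 < c ∧ c ≤ 1 ∧ 2 ≤ y0 ∧ ∀ y t : ℝ, y0 ≤ y → π / log y ≤ |t| → |t| ≤ c0 * (y / log y) →
    y / (8 * log y) ≤ ((primesLE y).filter (fun p : ℕ => c / log y ^ 4 ≤ 1 - cos (t * log p))).card := by
  obtain ⟨C, hC, hk⟩ := card_le
  obtain ⟨y1, hy1, hk1⟩ := card_ge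
  set κ := 1 / (16 * (C + 1)) with hκd
  have hκ : 0 < κ := by positivity
  have hκ1 : κ < 1 := by rw [hκd, div_lt_one po!]; linarith
  have hCk : 2 * C * κ ≤ 1 / 8 := by rw [hκd, mul_one_div, div_le_iff₀ po!]; linarith
  have hpi := pi_pos
  have hpi3 := pi_gt_three
  set l := log (1 / κ) / (2 * π) with hl
  have hl0 : 0 < l := div_pos (log_pos (by rw [lt_div_iff₀ hκ]; linarith)) po!
  set a := 1 / (16 * (2 * l + 4)) with had
  have ha : 0 < a := by positivity
  have ha1 : a ≤ 1 := by rw [had, div_le_one po!]; linarith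
  have hal : (2 * l + 4) * a = 1 / 16 := by rw [had]; field_simp
  refine ⟨1 / (16 * (l + 1)), (2 / π ^ 2) * (a / 2) ^ 2, max (max y1 (1 / κ ^ 2)) (max 4096 (2 / κ)), by positivity, by positivity, ?_, hy1.trans ((le_max_left _ _).trans (le_max_left _ _)), fun y t hy ht1 ht2 => ?_⟩
  · have h1 : 2 / π ^ 2 ≤ 1 := by rw [div_le_one po!]; nlinarith only [hpi3]
    have h2 : (a / 2) ^ 2 ≤ 1 := by nlinarith only [ha, ha1]
    exact mul_le_one₀ h1 po! h2
  have hyy1 : y1 ≤ y := ((le_max_left _ _).trans (le_max_left _ _)).trans hy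
  have hyk : 1 / κ ^ 2 ≤ y := ((le_max_right _ _).trans (le_max_left _ _)).trans hy
  have hy4 : 4096 ≤ y := ((le_max_left _ _).trans (le_max_right _ _)).trans hy
  have hyk2 : 2 / κ ≤ y := ((le_max_right _ _).trans (le_max_right _ _)).trans hy
  rw [div_le_iff₀ po!] at hyk hyk2
  have hy0 : 0 < y := by linarith
  have hL1 : 1 ≤ log y := by
    rw [le_log_iff_exp_le hy0]; linarith [exp_one_lt_d9]
  have hL0 : 0 < log y := by linarith
  set L := log y with hLd
  set τ := |t| with hτ
  have hτ0 : 0 < τ := lt_of_lt_of_le po! ht1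
  have hcos : ∀ p : ℕ, cos (t * log p) = cos (τ * log p) := by
    intro p
    rcases abs_cases t with h | h <;> rw [hτ, h.1]
    rw [neg_mul, cos_neg]
  set ε := a * (τ / (1 + τ)) / L with hε
  have hε0 : 0 < ε := by positivity
  have hεt : ε / τ ≤ a / L := by
    rw [hε, show a * (τ / (1 + τ)) / L / τ = a / L * (1 / (1 + τ)) by field_simp]
    exact mul_le_of_le_one_right po! (by rw [div_le_one po!]; linarith)
  have hε1 : ε ≤ a / L := by
    rw [hε]
    gcongr
    exact mul_le_of_le_one_right ha.le (by rw [div_le_one po!]; linarith)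
  have hε2 : a / 2 / L ^ 2 ≤ ε := by
    have h1 : 1 ≤ τ * L := by rw [div_le_iff₀ hL0] at ht1; linarith
    have : 1 / (2 * L) ≤ τ / (1 + τ) := by rw [div_le_div_iff₀ po! po!]; nlinarith only [h1, hτ0, hL1]
    calc a / 2 / L ^ 2 = a * (1 / (2 * L)) / L := by field_simp
      _ ≤ _ := by rw [hε]; gcongr
  set P := fun n : ℕ => |τ * log n - 2 * π * round (τ * log n / (2 * π))| ≤ ε with hP
  set Bd := (primesLE y).filter (fun p : ℕ => κ * y < p ∧ P p) with hB
  set G := (primesLE y).filter (fun p : ℕ => (2 / π ^ 2) * (a / 2) ^ 2 / L ^ 4 ≤ 1 - cos (t * log p)) with hG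
  have hsub : primesLE y ⊆ primesLE (κ * y) ∪ (Bd ∪ G) := by
    intro p hp
    rw [Finset.mem_union, Finset.mem_union]
    by_cases h1 : κ * y < p
    · right
      by_cases h2 : P p
      · left; exact Finset.mem_filter.2 ⟨hp, h1, h2⟩
      · right
        refine Finset.mem_filter.2 ⟨hp, ?_⟩
        simp only [hP, not_le] at h2
        rw [hcos p]
        set j := round (τ * log p / (2 * π))
        have h3 : |τ * log p - 2 * π * j| ≤ π := by
          have h4 := abs_sub_round (τ * log p / (2 * π))
          have h5 : τ * log p - 2 * π * j = 2 * π * (τ * log p / (2 * π) - j) := by field_simp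
          rw [h5, abs_mul, abs_of_pos (by positivity : 0 < 2 * π)]
          calc _ ≤ 2 * π * (1 / 2) := by gcongr
            _ = _ := by ring
        have h6 := cos_le_one_sub_mul_cos_sq h3
        have h7 : cos (τ * log p - 2 * π * j) = cos (τ * log p) := by
          rw [mul_comm (2 * π)]; exact cos_sub_int_mul_two_pi _ _
        rw [h7, ← sq_abs (τ * log p - 2 * π * j)] at h6
        have h8 : (a / 2 / L ^ 2) ^ 2 ≤ |τ * log p - 2 * π * j| ^ 2 := pow_le_pow_left₀ po! (hε2.trans h2.le) 2
        have h9 : 2 / π ^ 2 * (a / 2) ^ 2 / L ^ 4 = 2 / π ^ 2 * (a / 2 / L ^ 2) ^ 2 := by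
          rw [div_pow (a / 2), mul_div_assoc, ← pow_mul]
        rw [h9]
        have h10 := mul_le_mul_of_nonneg_left h8 (by positivity : 0 ≤ 2 / π ^ 2)
        linarith
    · left
      exact (prime_mem po!).2 ⟨not_lt.1 h1, pr_of_mem hp⟩
  have hc : ((primesLE y).card:ℝ) ≤ (primesLE (κ * y)).card + (Bd.card + G.card) := by
    exact_mod_cast (Finset.card_le_card hsub).trans ((Finset.card_union_le _ _).trans (Nat.add_le_add_left (Finset.card_union_le _ _) _))
  have hbad := bad_count τ ε y κ hτ0 hε0 hκ hκ1 hy0 Bd fun n hn => by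
    have := Finset.mem_filter.1 hn
    exact ⟨this.2.1, ((prime_mem hy0.le).1 this.1).1, this.2.2⟩
  have hsm := hk (κ * y) li!
  have hkk := hk1 y hyy1
  have hlk : L / 2 ≤ log (κ * y) := by
    have h1 : √y ≤ κ * y := by
      rw [sqrt_le_left po!]
      nlinarith only [hyk, hy0]
    calc L / 2 = log (√y) := (log_sqrt hy0.le).symm
      _ ≤ _ := log_le_log po! h1
  set Y := y / L with hY
  have hY0 : 0 < Y := by positivity
  have hsm2 : C * (κ * y / log (κ * y)) ≤ 1 / 8 * Y := by
    calc _ ≤ C * (κ * y / (L / 2)) := by gcongr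
      _ = 2 * C * κ * Y := by rw [hY]; field_simp
      _ ≤ _ := by gcongr
  have hY32 : 32 ≤ Y := by
    rw [hY, le_div_iff₀ hL0]
    have h1 := log_le_two_sqrt y hy0
    have h2 : 64 ≤ √y := le_sqrt_of_sq_le li!
    have h3 := mul_self_sqrt hy0.le
    have h4 := mul_le_mul_of_nonneg_right h2 (sqrt_nonneg y)
    linarith
  have hb2 : (τ * l + 2) * (2 * ε * y / τ + 1) ≤ 3 / 16 * Y := by
    have e : (τ * l + 2) * (2 * ε * y / τ + 1) = 2 * l * (ε * y) + 4 * (ε / τ * y) + l * τ + 2 := by field_simp; ring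
    have h1 : ε * y ≤ a * Y := by
      calc _ ≤ a / L * y := by gcongr
        _ = _ := by rw [hY]; field_simp
    have h2 : ε / τ * y ≤ a * Y := by
      calc _ ≤ a / L * y := by gcongr
        _ = _ := by rw [hY]; field_simp
    have h3 : l * τ ≤ 1 / 16 * Y := by
      calc l * τ ≤ l * (1 / (16 * (l + 1)) * Y) := by gcongr
        _ = l / (l + 1) * (1 / 16 * Y) := by field_simp
        _ ≤ _ := mul_le_of_le_one_left po! (by rw [div_le_one po!]; linarith)
    rw [e]
    have h4 := mul_le_mul_of_nonneg_left h1 hl0.le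
    have h5 : l * (a * Y) * 2 + 4 * (a * Y) = 1 / 16 * Y := by rw [← hal]; ring
    linarith
  have e1 : y / (2 * L) = 1 / 2 * Y := by rw [hY]; field_simp
  have e2 : y / (8 * L) = 1 / 8 * Y := by rw [hY]; field_simp
  rw [e2]
  rw [e1] at hkk
  linarith
end
end HTP

namespace HTP
section
open Real MeasureTheory
open Complex (I)
lemma fac_exp_le (q z : ℝ) (hq : 0 < q) (hq1 : q < 1) (hz : 0 ≤ z) (hz2 : z ≤ 2) :
    exp (2 * (q * z)) ≤ 1 + 2 * q / (1 - q) ^ 2 * z := by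
  have h1 : 2 * q ≤ log (1 + q) - log (1 - q) := by
    have h := hasSum_log_sub_log_of_abs_lt_one (abs_lt.2 ⟨by linarith, hq1⟩)
    have := le_hasSum h 0 fun k _ => by positivity
    simpa using this
  have h2 : exp (4 * q) ≤ ((1 + q) / (1 - q)) ^ 2 := by
    have h3 : exp (2 * q) ≤ (1 + q) / (1 - q) := by
      rw [← log_div li! li!] at h1
      exact (le_log_iff_exp_le (div_pos li! li!)).1 h1
    calc _ = exp (2 * q) ^ 2 := by rw [← exp_nat_mul]; congr 1; push_cast; ring
      _ ≤ _ := pow_le_pow_left₀ (exp_pos _).le h3 2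
  have h4 := convexOn_exp.2 (Set.mem_univ (4 * q)) (Set.mem_univ 0) (by linarith : 0 ≤ z / 2) (by linarith : 0 ≤ 1 - z / 2) (by ring)
  simp only [smul_eq_mul, mul_zero, add_zero, exp_zero, mul_one] at h4
  rw [show z / 2 * (4 * q) = 2 * (q * z) by ring] at h4
  have h5 : ((1 + q) / (1 - q)) ^ 2 = 1 + 4 * q / (1 - q) ^ 2 := by
    have : 1 - q ≠ 0 := by linarith
    field_simp; ring
  rw [h5] at h2
  have h6 := mul_le_mul_of_nonneg_left h2 (by linarith : 0 ≤ z / 2)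
  calc _ ≤ _ := h4
    _ ≤ z / 2 * (1 + 4 * q / (1 - q) ^ 2) + (1 - z / 2) := by linarith
    _ = _ := by ring
lemma Phi_exp (α y x t : ℝ) (hα : 0 < α) :
    ‖Phi α y x t‖ ≤ exp (-∑ p ∈ primesLE y, p^~α * (1 - cos (t * log p))) := by
  refine le_of_sq_le_sq ?_ (exp_pos _).le
  rw [Phi_norm_sq α y x t hα, ← exp_nat_mul, mul_neg, Finset.mul_sum, ← Finset.sum_neg_distrib, exp_sum]
  refine Finset.prod_le_prod (fun p hp => inv_nonneg.2 (by linarith [Phi_fac_pos α t hα p (pr_of_mem hp)])) fun p hp => ?_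
  have hp' := pr_of_mem hp
  rw [exp_neg]
  refine inv_anti₀ (exp_pos _) ?_
  have := fac_exp_le _ (1 - cos (t * log p)) (q_pos α p hp') (prime_q_lt p hp' α hα) (by linarith [cos_le_one (t * log p)]) (by linarith [neg_one_le_cos (t * log p)])
  push_cast
  exact this
lemma Phi_small : ∃ c0 y0 : ℝ, 0 < c0 ∧ 2 ≤ y0 ∧ ∀ α x y t : ℝ, y0 ≤ y → 0 < α → α ≤ 1 → phi1 α y + log x = 0 →
    log y * log y ^ 7 ≤ log x → π / log y ≤ |t| → |t| ≤ c0 * (y / log y) → ‖Phi α y x t‖ ≤ exp (-(3 * log y)) := by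
  obtain ⟨c0, c, y1, hc0, hc, hc1, hy1, hg⟩ := good_count
  obtain ⟨C, y2, hC, hy2, hu⟩ := rel_u
  have hlit := (isLittleO_log_rpow_atTop (show (0:ℝ) < 3/28 by norm_num)).bound (show (0:ℝ) < 1 by norm_num)
  obtain ⟨y3, hy3⟩ := Filter.eventually_atTop.1 hlit
  refine ⟨c0, max (max y1 y2) (max y3 (max (exp (24 * C / c)) (exp (24 / c)))), hc0, hy1.trans ((le_max_left _ _).trans (le_max_left _ _)), fun α x y t hy hα hα1 h hx ht1 ht2 => ?_⟩
  simp only [max_le_iff] at hy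
  obtain ⟨⟨hyy1, hyy2⟩, hyy3, hyC, hyC2⟩ := hy
  have hy0 : 0 < y := by linarith
  have hLC := (le_log_iff_exp_le hy0).2 hyC
  have hLC2 := (le_log_iff_exp_le hy0).2 hyC2
  have hL : 0 < log y := log_pos li!
  have h3 := hy3 y hyy3
  set L := log y
  have h1 : 24 / c * L ^ 6 ≤ y ^ (1 - α) := by
    rcases le_or_gt (1/4) α with h4 | h4
    · have h5 := hu α x y hyy2 h4 hα1 h
      have h6 : L ^ 7 ≤ log x / L := by rw [le_div_iff₀ hL]; linarith
      have h7 : 24 * C / c * L ^ 6 ≤ C * y ^ (1 - α) := by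
        calc _ ≤ L * L ^ 6 := by gcongr
          _ = L ^ 7 := by ring
          _ ≤ _ := h6.trans h5
      refine le_of_mul_le_mul_left ?_ hC
      calc _ = 24 * C / c * L ^ 6 := by ring
        _ ≤ _ := h7
    · rw [one_mul, norm_of_nonneg hL.le, norm_of_nonneg po!] at h3
      calc 24 / c * L ^ 6 ≤ L * L ^ 6 := by gcongr
        _ = L ^ 7 := by ring
        _ ≤ (y ^ (3/28:ℝ)) ^ 7 := pow_le_pow_left₀ hL.le h3 7
        _ = y ^ (3/4:ℝ) := by rw [← rpow_natCast, ← rpow_mul hy0.le]; norm_num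
        _ ≤ _ := rpow_le_rpow_of_exponent_le li! li!
  refine (Phi_exp α y x t hα).trans (exp_le_exp.2 (neg_le_neg ?_))
  have h2 := hg y t hyy1 ht1 ht2
  set G := (primesLE y).filter (fun p : ℕ => c / L ^ 4 ≤ 1 - cos (t * log p))
  calc 3 * L = (24 / c * L ^ 6) * (c / (8 * L ^ 5)) := by field_simp; norm_num
    _ ≤ y ^ (1 - α) * (c / (8 * L ^ 5)) := by gcongr
    _ = y / (8 * L) * (y ^ (-α) * (c / L ^ 4)) := by rw [show 1 - α = 1 + -α by ring, rpow_add hy0, rpow_one]; field_simp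
    _ ≤ G.card * (y ^ (-α) * (c / L ^ 4)) := by gcongr
    _ = ∑ p ∈ G, (y ^ (-α) * (c / L ^ 4)) := by rw [Finset.sum_const, nsmul_eq_mul]
    _ ≤ ∑ p ∈ G, p^~α * (1 - cos (t * log p)) := by
      refine Finset.sum_le_sum fun p hp => ?_
      have hp1 := Finset.mem_filter.1 hp
      have hpp := (prime_mem hy0.le).1 hp1.1
      have : (0:ℝ) < p := by exact_mod_cast hpp.2.pos
      exact mul_le_mul (rpow_le_rpow_of_nonpos this hpp.1 li!) hp1.2 po! po!
    _ ≤ _ := Finset.sum_le_sum_of_subset_of_nonneg (Finset.filter_subset _ _) fun p hp _ =>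
      mul_nonneg (q_pos α p (pr_of_mem hp)).le (by linarith [cos_le_one (t * log p)])
end
end HTP

namespace HTP
section
open Real MeasureTheory
open Complex (I)
noncomputable def e0 (x y : ℝ) : ℝ := 1 / (log x / log y) + log y / y
def TailOK (C α x y : ℝ) : Prop := ∃ (β : ℝ) (r : ℕ), 0 < β ∧ 2 ≤ r ∧ r * (α * β) ≤ C * e0 x y ∧ α * β ≤ 1 / 2 ∧
  ∀ b : ℝ, |b| = β → ‖∫ t in (Set.Icc (-(π / log y)) (π / log y))ᶜ, Phi α y x t * ker α b r t‖ ≤ C * e0 x y / (α * √(phi2 α y))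
lemma ker_add (α b : ℝ) (n r : ℕ) (t : ℝ) : ‖ker α b (r + n) t‖ = ‖ker α b r t‖ * (‖1 + b * t * I‖ ^ n)⁻¹ := by
  unfold ker
  rw [pow_add, ← mul_assoc, mul_inv, norm_mul, norm_inv (_ ^ n), norm_pow]
lemma abs_bt_le (b t : ℝ) : |b * t| ≤ ‖1 + b * t * I‖ := by
  refine abs_le_of_sq_le_sq ?_ (norm_nonneg _)
  rw [norm_one_add]; linarith
lemma phi2_pos (α y : ℝ) (hα : 0 < α) (hy : 2 ≤ y) : 0 < phi2 α y := by
  rw [phi2_eq α y hα]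
  refine Finset.sum_pos (fun p hp => ?_) ⟨2, (prime_mem li!).2 ⟨by exact_mod_cast hy, Nat.prime_two⟩⟩
  have hp' := pr_of_mem hp
  have h1 := prime_q_lt p hp' α hα
  exact mul_pos (div_pos (q_pos α p hp') (pow_pos li! 2)) (pow_pos (log_prime_pos hp') 2)
lemma int_ker (b : ℝ) (hb : b ≠ 0) : Integrable (fun t : ℝ => (1 + (b * t) ^ 2)⁻¹) ∧ ∫ t : ℝ, (1 + (b * t) ^ 2)⁻¹ = π / |b| := by
  refine ⟨integrable_inv_one_add_sq.comp_mul_left' hb, ?_⟩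
  rw [Measure.integral_comp_mul_left (fun t : ℝ => (1 + t ^ 2)⁻¹) b, integral_univ_inv_one_add_sq, abs_inv, smul_eq_mul]
  ring
lemma tail_big : ∃ C y0 : ℝ, 0 < C ∧ 2 ≤ y0 ∧ ∀ α x y : ℝ, y0 ≤ y → 0 < α → α ≤ 1 → phi1 α y + log x = 0 →
    log y * log y ^ 7 ≤ log x → TailOK C α x y := by
  obtain ⟨c0, y1, hc0, hy1, hP⟩ := Phi_small
  obtain ⟨Ck, hCk, hk⟩ := card_le
  set C1 := 2 * Ck * exp 3 / c0 with hC1d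
  have hC1 : 0 < C1 := by positivity
  refine ⟨max C1 (7 / C1), max y1 (max (exp 3) (exp (4 * C1))), by positivity, hy1.trans (le_max_left _ _), fun α x y hy hα hα1 h hx => ?_⟩
  simp only [max_le_iff] at hy
  obtain ⟨hyy1, hye, hyC⟩ := hy
  have hy0 : 0 < y := by linarith
  have hL3 := (le_log_iff_exp_le hy0).2 hye
  have hLC := (le_log_iff_exp_le hy0).2 hyC
  have hyL : exp (log y) = y := exp_log hy0
  have hkk := hk y li!
  have hal := al_log α x y hα h
  have hsig := al_phi2 α y hα
  have hLy := log_le_sub_one_of_pos hy0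
  have hky : ((primesLE y).card:ℝ) ≤ y ^ 2 := by
    have : (primesLE y).card ≤ ⌊y⌋₊ := by
      have : primesLE y ⊆ Finset.Icc 1 ⌊y⌋₊ := by
        intro p hp
        have := mem_primesLE.1 hp
        exact Finset.mem_Icc.2 ⟨this.2.one_lt.le, this.1⟩
      simpa using Finset.card_le_card this
    have := (Nat.cast_le (α := ℝ).2 this).trans (Nat.floor_le hy0.le)
    exact this.trans (le_self_pow₀ li! two_ne_zero)
  have hPt := fun t => hP α x y t hyy1 hα hα1 h hx
  set L := log y with hL
  have hL0 : 0 < L := by linarith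
  have hlx : 0 < log x := lt_of_lt_of_le po! hx
  have he1 : L / log x ≤ e0 x y := by
    unfold e0; rw [one_div_div]; have : 0 ≤ log y / y := by positivity
    linarith
  have he2 : L / y ≤ e0 x y := by
    unfold e0; rw [one_div_div]; have : 0 ≤ log y / log x := by positivity
    linarith
  have he3 : e0 x y ≤ 2 := by
    unfold e0
    have h1 : log y / y ≤ 1 := by rw [div_le_one hy0]; linarith
    have h2 : 1 / (log x / log y) ≤ 1 := by
      rw [one_div_div, div_le_one hlx]
      exact (le_mul_of_one_le_right hL0.le (one_le_pow₀ li!)).trans hx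
    linarith
  set e := e0 x y
  have he0 : 0 < e := lt_of_lt_of_le po! he2
  set n := ⌈L⌉₊ with hn
  have hn1 : L ≤ n := Nat.le_ceil _
  have hn2 : (n:ℝ) + 2 ≤ 2 * L := by linarith [Nat.ceil_lt_add_one hL0.le]
  set β := C1 * e / ((n + 2) * α) with hβ
  have hβ0 : 0 < β := by positivity
  have hrab : ((n:ℝ) + 2) * (α * β) = C1 * e := by rw [hβ]; field_simp
  have hT : exp 3 ≤ β * (c0 * (y / L)) := by
    have h1 : α * log x * L ≤ Ck * y := by
      have := hal.trans hkk
      calc _ ≤ Ck * (y / L) * L := by gcongr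
        _ = _ := by field_simp
    calc exp 3 ≤ C1 * c0 * y / (2 * (α * log x * L)) := by
          rw [le_div_iff₀ po!, show C1 * c0 = 2 * Ck * exp 3 by rw [hC1d]; field_simp]
          have := mul_le_mul_of_nonneg_left h1 (exp_pos 3).le
          linarith
      _ = C1 * (L / log x) / (2 * L * α) * (c0 * (y / L)) := by field_simp
      _ ≤ _ := by rw [hβ]; gcongr
  refine ⟨β, n + 2, hβ0, by omega, ?_, ?_, fun b hb => ?_⟩
  · push_cast
    rw [hrab]; gcongr; exact le_max_left _ _
  · have h1 : α * β = C1 * e / (n + 2) := by rw [hβ]; field_simp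
    rw [h1, div_le_iff₀ po!]
    linarith [mul_le_mul_of_nonneg_left he3 hC1.le]
  · have hb0 : b ≠ 0 := by rintro rfl; simp at hb; linarith
    have hpt : ∀ t ∈ (Set.Icc (-(π / L)) (π / L))ᶜ, ‖Phi α y x t * ker α b (n + 2) t‖ ≤ α⁻¹ * exp (-(3 * L)) * (1 + (b * t) ^ 2)⁻¹ := by
      intro t ht
      have ht1 : π / L ≤ |t| := by
        by_contra hlt
        exact ht (abs_le.1 (not_le.1 hlt).le)
      rw [norm_mul]
      rcases le_or_gt |t| (c0 * (y / L)) with h1 | h1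
      · calc _ ≤ exp (-(3 * L)) * (α⁻¹ * (1 + (b * t) ^ 2)⁻¹) := mul_le_mul (hPt t ht1 h1) (ker_norm_le α b hα _ (by omega) t) (norm_nonneg _) (exp_pos _).le
          _ = _ := by ring
      · rw [add_comm n 2, ker_add]
        have h2 : exp 3 ≤ ‖1 + b * t * I‖ := by
          refine le_trans ?_ (abs_bt_le b t)
          rw [abs_mul, hb]
          exact hT.trans (by gcongr)
        have h3 : (‖1 + b * t * I‖ ^ n)⁻¹ ≤ exp (-(3 * L)) := by
          rw [exp_neg]
          refine inv_anti₀ (exp_pos _) (le_trans ?_ (pow_le_pow_left₀ (exp_pos _).le h2 n))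
          rw [← exp_nat_mul]
          exact exp_le_exp.2 li!
        calc _ ≤ 1 * ((α⁻¹ * (1 + (b * t) ^ 2)⁻¹) * exp (-(3 * L))) := by
              have := Phi_norm_le_one α y x t hα
              have := ker_norm_le α b hα 2 le_rfl t
              gcongr
          _ = _ := by ring
    obtain ⟨hi1, hi2⟩ := int_ker b hb0
    have hi3 := hi1.const_mul (α⁻¹ * exp (-(3 * L)))
    have hI : ‖∫ t in (Set.Icc (-(π / L)) (π / L))ᶜ, Phi α y x t * ker α b (n + 2) t‖ ≤ α⁻¹ * exp (-(3 * L)) * (π / β) := by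
      refine (norm_integral_le_of_norm_le hi3.integrableOn ((ae_restrict_iff' measurableSet_Icc.compl).2 (Filter.Eventually.of_forall hpt))).trans ?_
      refine (setIntegral_le_integral hi3 (Filter.Eventually.of_forall fun t => by positivity)).trans ?_
      rw [integral_const_mul, hi2, hb]
    refine hI.trans ?_
    have hs : α * √(phi2 α y) ≤ y := by
      refine le_of_sq_le_sq ?_ hy0.le
      rw [mul_pow, sq_sqrt (phi2_pos α y hα li!).le]; linarith
    have h0 := sqrt_pos.2 (phi2_pos α y hα li!)
    have hey : exp (-(3 * L)) = (y ^ 3)⁻¹ := by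
      rw [exp_neg, ← hyL, ← exp_nat_mul]; push_cast; rfl
    rw [hey, le_div_iff₀ po!, show α⁻¹ * (y ^ 3)⁻¹ * (π / β) = (y ^ 3)⁻¹ * π * (n + 2) / (C1 * e) by rw [← hrab]; field_simp]
    have h5 : (y ^ 3)⁻¹ * π * (n + 2) / (C1 * e) ≤ (y ^ 3)⁻¹ * 3.5 * (2 * L) / (C1 * e) := by
      have : π ≤ 3.5 := by linarith [pi_lt_d2]
      gcongr
    calc _ ≤ (y ^ 3)⁻¹ * 3.5 * (2 * L) / (C1 * e) * y := by gcongr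
      _ = 7 / C1 * (L / y) * (1 / y) / e := by field_simp; norm_num
      _ ≤ 7 / C1 * e * e / e := by
        have : 1 / y ≤ e := le_trans (by gcongr; linarith) he2
        gcongr
      _ = 7 / C1 * e := by field_simp
      _ ≤ _ := by gcongr; exact le_max_right _ _
end
end HTP

namespace HTP
section
open Real MeasureTheory
open Complex (I)
lemma Phi_mid : ∃ C y0 : ℝ, 0 < C ∧ 2 ≤ y0 ∧ ∀ α x y : ℝ, y0 ≤ y → 1 / 4 ≤ α → α ≤ 1 → phi1 α y + log x = 0 → 0 < log x → ∀ t : ℝ, t ≠ 0 →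
    ‖Phi α y x t‖ ≤ C / log y * (1 / |t| + log (2 + |t|)) ∧ (π / log y ≤ |t| → |t| ≤ log y ^ 21 →
    ‖Phi α y x t‖ ≤ C / log y * (1 / |t| + log (2 + |t|)) * ((log x / log y) ^ 10)⁻¹) := by
  obtain ⟨c, κ, y1, hc, hκ, hκ1, hy1, hb⟩ := zb_mid
  obtain ⟨C1, y2, hC1, hy2, hz⟩ := za_cons
  obtain ⟨C2, y3, hC2, hy3, hu⟩ := rel_u
  set n := ⌈10 / κ⌉₊ with hn
  set D := exp c * (n.factorial / c ^ n * C2 ^ 10) with hD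
  have hD0 : 0 < D := by positivity
  refine ⟨max C1 (C1 * D), max y1 (max y2 y3), by positivity, hy1.trans (le_max_left _ _), fun α x y hy hα hα1 h hx t ht => ?_⟩
  simp only [max_le_iff] at hy
  obtain ⟨hyy1, hyy2, hyy3⟩ := hy
  have hy0 : 0 < y := by linarith
  have hL : 0 < log y := log_pos li!
  have hα0 : 0 < α := by linarith
  have hza := hz y t hyy2 ht
  have hlog : 0 ≤ log (2 + |t|) := log_nonneg (by linarith [abs_nonneg t])
  have habs := abs_pos.2 ht
  have hzn : ∀ p : ℕ, 0 ≤ 1 - cos (t * log p) := fun p => by linarith [cos_le_one (t * log p)]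
  have hq : ∀ p ∈ primesLE y, ∀ X : ℝ, X ≤ (p:ℝ) ^ (1 - α) → (1 - cos (t * log p)) / p * X ≤ p^~α * (1 - cos (t * log p)) := by
    intro p hp X hX
    have hp0 : (0:ℝ) < p := by exact_mod_cast (pr_of_mem hp).pos
    have e : p^~α = (p:ℝ) ^ (1 - α) / p := by rw [show -α = (1 - α) - 1 by ring, rpow_sub_one hp0.ne']
    rw [e]
    have := mul_le_mul_of_nonneg_left hX (div_nonneg (hzn p) hp0.le)
    calc _ ≤ _ := this
      _ = _ := by ring
  have h1p : ∀ p ∈ primesLE y, 1 ≤ (p:ℝ) ^ (1 - α) := fun p hp =>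
    one_le_rpow (by exact_mod_cast (pr_of_mem hp).one_lt.le) li!
  have hP := Phi_exp α y x t hα0
  constructor
  · calc _ ≤ _ := hP
      _ ≤ exp (-∑ p ∈ primesLE y, (1 - cos (t * log p)) / p) := by
        refine exp_le_exp.2 (neg_le_neg (Finset.sum_le_sum fun p hp => ?_))
        have := hq p hp 1 (h1p p hp)
        rwa [mul_one] at this
      _ ≤ _ := hza
      _ ≤ _ := by gcongr; exact le_max_left _ _
  · intro ht1 ht2
    have hzb := hb y t hyy1 ht1 ht2
    set X := y ^ (1 - α) with hX
    have hX1 : 1 ≤ X := one_le_rpow li! li!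
    set Y := X ^ κ with hY
    have hY1 : 1 ≤ Y := one_le_rpow hX1 hκ.le
    have hsum : ∑ p ∈ primesLE y, (1 - cos (t * log p)) / p + c * (Y - 1) ≤ ∑ p ∈ primesLE y, p^~α * (1 - cos (t * log p)) := by
      calc _ ≤ ∑ p ∈ primesLE y, (1 - cos (t * log p)) / p + (∑ p ∈ (primesLE y).filter (fun p : ℕ => y ^ κ < p), (1 - cos (t * log p)) / p) * (Y - 1) := by
            have : 0 ≤ Y - 1 := by linarith
            gcongr
        _ = ∑ p ∈ primesLE y, ((1 - cos (t * log p)) / p + if y ^ κ < p then (1 - cos (t * log p)) / p * (Y - 1) else 0) := by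
            rw [Finset.sum_add_distrib, Finset.sum_mul, Finset.sum_filter]
        _ ≤ _ := by
            refine Finset.sum_le_sum fun p hp => ?_
            split_ifs with hlt
            · have h1 : Y ≤ (p:ℝ) ^ (1 - α) := by
                calc Y = (y ^ κ) ^ (1 - α) := by rw [hY, hX, ← rpow_mul hy0.le, ← rpow_mul hy0.le, mul_comm]
                  _ ≤ _ := rpow_le_rpow po! hlt.le li!
              calc _ = (1 - cos (t * log p)) / p * Y := by ring
                _ ≤ _ := hq p hp Y h1
            · have := hq p hp 1 (h1p p hp)
              linarith
    have hE : exp (-(c * (Y - 1))) ≤ D * ((log x / log y) ^ 10)⁻¹ := by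
      have h1 : (c * Y) ^ n / n.factorial ≤ exp (c * Y) := pow_div_factorial_le_exp _ po! n
      have h2 : X ^ 10 ≤ Y ^ n := by
        rw [hY, ← rpow_natCast X, ← rpow_natCast (X ^ κ), ← rpow_mul (by linarith : (0:ℝ) ≤ X) κ]
        refine rpow_le_rpow_of_exponent_le hX1 ?_
        have := Nat.le_ceil (10 / κ)
        rw [div_le_iff₀ hκ] at this
        push_cast; linarith
      have h3 := hu α x y hyy3 hα hα1 h
      have h4 : (log x / log y) ^ 10 ≤ (C2 * X) ^ 10 := pow_le_pow_left₀ po! h3 10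
      rw [show -(c * (Y - 1)) = c + -(c * Y) by ring, exp_add, hD, mul_assoc]
      gcongr
      rw [exp_neg, ← div_eq_mul_inv, le_div_iff₀ po!, inv_mul_le_iff₀ po!]
      calc _ ≤ (C2 * X) ^ 10 := h4
        _ = (c ^ n * X ^ 10 / n.factorial) * (n.factorial / c ^ n * C2 ^ 10) := by field_simp
        _ ≤ ((c * Y) ^ n / n.factorial) * (n.factorial / c ^ n * C2 ^ 10) := by rw [mul_pow c Y]; gcongr
        _ ≤ _ := by gcongr
    calc _ ≤ _ := hP
      _ ≤ exp (-∑ p ∈ primesLE y, (1 - cos (t * log p)) / p) * exp (-(c * (Y - 1))) := by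
        rw [← exp_add]; exact exp_le_exp.2 li!
      _ ≤ (C1 / log y * (1 / |t| + log (2 + |t|))) * (D * ((log x / log y) ^ 10)⁻¹) := by gcongr
      _ = (C1 * D) / log y * (1 / |t| + log (2 + |t|)) * ((log x / log y) ^ 10)⁻¹ := by ring
      _ ≤ _ := by gcongr; exact le_max_right _ _
end
end HTP

namespace HTP
open Complex in
lemma fac_deriv (q l t : ℝ) (hq : 0 < q) (hq1 : q < 1) : HasDerivAt (fun t : ℝ => fac q (t * l))
    (fac q (t * l) * (-I * (l * (q * cexp (-((t * l : ℝ) * I)) / (1 - q * cexp (-((t * l : ℝ) * I))))))) t := by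
  have hne : (1:ℂ) - q * cexp (-((t * l : ℝ) * I)) ≠ 0 := by
    intro h0
    have h1 : ‖(q:ℂ) * cexp (-((t * l : ℝ) * I))‖ = q := by
      rw [norm_mul, ← neg_mul, ← ofReal_neg, norm_exp_ofReal_mul_I, mul_one, norm_real, Real.norm_of_nonneg hq.le]
    rw [← sub_eq_zero.1 h0, norm_one] at h1
    linarith
  have h2 : HasDerivAt (fun t : ℝ => cexp (-((t * l : ℝ) * I))) (cexp (-((t * l : ℝ) * I)) * (-(l * I))) t := by
    have h3 : HasDerivAt (fun t : ℝ => -(((t * l : ℝ):ℂ) * I)) (-(l * I)) t := by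
      have := ((hasDerivAt_id t).mul_const l).ofReal_comp
      simp only [id, one_mul] at this
      exact (this.mul_const I).neg
    exact h3.cexp
  have h4 := ((h2.const_mul (q:ℂ)).const_sub 1).inv hne
  have h5 := h4.const_mul ((1:ℂ) - q)
  unfold fac
  simp only [div_eq_mul_inv]
  refine h5.congr_deriv ?_
  field_simp
  
open Complex in
noncomputable def VV (α y t : ℝ) : ℂ := ∑ p ∈ primesLE y, (Real.log p * (((p^~α : ℝ):ℂ) * cexp (-((t * Real.log p : ℝ) * I)) / (1 - ((p^~α : ℝ):ℂ) * cexp (-((t * Real.log p : ℝ) * I)))))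
open Complex in
lemma Phi_deriv (α y x t : ℝ) (hα : 0 < α) : HasDerivAt (fun t => Phi α y x t) (Phi α y x t * (I * (Real.log x - VV α y t))) t := by
  have key : ∀ s : Finset ℕ, (∀ p ∈ s, p.Prime) → HasDerivAt (fun t : ℝ => ∏ p ∈ s, fac (p^~α) (t * Real.log p))
      ((∏ p ∈ s, fac (p^~α) (t * Real.log p)) * (-I * ∑ p ∈ s, (Real.log p * (((p^~α : ℝ):ℂ) * cexp (-((t * Real.log p : ℝ) * I)) / (1 - ((p^~α : ℝ):ℂ) * cexp (-((t * Real.log p : ℝ) * I))))))) t := by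
    intro s
    induction s using Finset.induction_on with
    | empty => intro _; simpa using hasDerivAt_const t (1:ℂ)
    | insert a s ha ih =>
      intro hs
      have h1 := ih fun p hp => hs p (Finset.mem_insert_of_mem hp)
      have hpa := hs a (Finset.mem_insert_self _ _)
      have h2 := (fac_deriv (a^~α) (Real.log a) t (q_pos α a hpa) (prime_q_lt a hpa α hα)).mul h1
      simp only [Finset.prod_insert ha, Finset.sum_insert ha]
      refine h2.congr_deriv ?_
      ring
  have h1 := key (primesLE y) fun p hp => pr_of_mem hp
  have h2 : HasDerivAt (fun t : ℝ => cexp (t * Real.log x * I)) (cexp (t * Real.log x * I) * (Real.log x * I)) t := by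
    have h3 : HasDerivAt (fun t : ℝ => ((t:ℂ) * Real.log x * I)) (Real.log x * I) t := by
      have := (hasDerivAt_id t).ofReal_comp
      simp only [id, ofReal_one] at this
      simpa using (this.mul_const (Real.log x : ℂ)).mul_const I
    exact h3.cexp
  refine (h2.mul h1).congr_deriv ?_
  unfold Phi VV
  ring
open Complex in
lemma ker_deriv (α b t : ℝ) (hα : 3 / 4 ≤ α) (hb : |b| ≤ 1) : ∃ D : ℂ, HasDerivAt (fun t => ker α b 4 t) D t ∧ ‖D‖ ≤ 8 := by
  have hA : α ≤ ‖(α:ℂ) + t * I‖ := le_norm_al α t li!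
  have hB := one_le_norm b t
  have hA0 : (α:ℂ) + t * I ≠ 0 := by intro h; rw [h, norm_zero] at hA; linarith
  have hB0 : (1:ℂ) + b * t * I ≠ 0 := by intro h; rw [h, norm_zero] at hB; linarith
  have h0 := (hasDerivAt_id t).ofReal_comp
  simp only [id, ofReal_one] at h0
  have h1 : HasDerivAt (fun t : ℝ => (α:ℂ) + t * I) I t := by simpa using (h0.mul_const I).const_add (α:ℂ)
  have h2 : HasDerivAt (fun t : ℝ => (1:ℂ) + b * t * I) (b * I) t := by simpa using ((h0.const_mul (b:ℂ)).mul_const I).const_add (1:ℂ)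
  have h3 := (h1.mul (h2.pow 4)).inv (mul_ne_zero hA0 (pow_ne_zero 4 hB0))
  refine ⟨_, h3, ?_⟩
  have e : ∀ A B : ℂ, A ≠ 0 → B ≠ 0 → -(I * B ^ 4 + A * (((4:ℕ):ℂ) * B ^ (4 - 1) * (b * I))) / (A * B ^ 4) ^ 2 = -(I / (A ^ 2 * B ^ 4)) - 4 * b * I / (A * B ^ 5) := by
    intro A B hA hB
    field_simp
    norm_num
    ring
  have e2 := e _ _ hA0 hB0
  simp only [Pi.mul_apply, Pi.pow_apply]
  rw [e2]
  refine (norm_sub_le _ _).trans ?_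
  rw [norm_neg, norm_div, norm_div, norm_mul, norm_mul, norm_mul, norm_mul, norm_I, norm_pow, norm_pow, norm_pow, norm_real, Real.norm_eq_abs, show ‖(4:ℂ)‖ = 4 by simp]
  have h5 : 1 ≤ ‖(1:ℂ) + b * t * I‖ ^ 4 := one_le_pow₀ hB
  have h6 : 1 ≤ ‖(1:ℂ) + b * t * I‖ ^ 5 := one_le_pow₀ hB
  have h7 : (3/4:ℝ) ≤ ‖(α:ℂ) + t * I‖ := by linarith
  calc _ ≤ 1 / ((3/4:ℝ) ^ 2 * 1) + 4 * 1 * 1 / ((3/4) * 1) := by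
        gcongr
    _ ≤ 8 := by norm_num
lemma ibp (W R : ℝ → ℂ) (l a M L : ℝ) (ha : 0 < a) (ha1 : a ≤ 1) (hl : 0 < l) (hM : 0 ≤ M) (hL : 0 ≤ L)
    (hW : ∀ t ∈ Set.Icc a 1, HasDerivAt W (Complex.I * l * W t + R t) t) (hR : ∀ t ∈ Set.Icc a 1, ‖R t‖ ≤ M * (1 / t ^ 2 + L)) :
    ‖∫ t in a..1, W t‖ ≤ (‖W 1‖ + ‖W a‖ + M * (1 / a + L)) / l := by
  have hu : Set.uIcc a 1 = Set.Icc a 1 := Set.uIcc_of_le ha1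
  have hWc : ContinuousOn W (Set.uIcc a 1) := fun t ht => (hW t (hu ▸ ht)).continuousAt.continuousWithinAt
  have hWi := hWc.intervalIntegrable (μ := MeasureTheory.volume)
  set g := fun t => deriv W t - Complex.I * l * W t with hg
  have hgR : ∀ t ∈ Set.Icc a 1, g t = R t := fun t ht => by simp only [hg]; rw [(hW t ht).deriv]; ring
  have hFd : ∀ t ∈ Set.uIcc a 1, HasDerivAt (fun t : ℝ => M * (-t⁻¹ + L * t)) (M * (1 / t ^ 2 + L)) t := by
    intro t ht
    rw [hu] at ht
    have h0 : t ≠ 0 := by linarith [ht.1]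
    refine (((hasDerivAt_inv h0).neg.add ((hasDerivAt_id t).const_mul L)).const_mul M).congr_deriv ?_
    simp
  have hFc : ContinuousOn (fun t : ℝ => M * (1 / t ^ 2 + L)) (Set.uIcc a 1) := by
    intro t ht
    rw [hu] at ht
    have h0 : t ^ 2 ≠ 0 := pow_ne_zero 2 (by linarith [ht.1])
    exact ContinuousAt.continuousWithinAt (by fun_prop (disch := exact h0))
  have hFi := hFc.intervalIntegrable (μ := MeasureTheory.volume)
  have hgb : ∀ t ∈ Set.Ioc a 1, ‖g t‖ ≤ M * (1 / t ^ 2 + L) := fun t ht => by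
    have ht' : t ∈ Set.Icc a 1 := ⟨ht.1.le, ht.2⟩
    rw [hgR t ht']; exact hR t ht'
  have hWm : MeasureTheory.AEStronglyMeasurable W (MeasureTheory.volume.restrict (Set.uIoc a 1)) := hWi.def'.aestronglyMeasurable
  have hgm : MeasureTheory.AEStronglyMeasurable g (MeasureTheory.volume.restrict (Set.uIoc a 1)) :=
    (aestronglyMeasurable_deriv W _).sub (hWm.const_mul _)
  have hgi : IntervalIntegrable g MeasureTheory.volume a 1 := by
    refine hFi.mono_fun hgm ((MeasureTheory.ae_restrict_iff' measurableSet_uIoc).2 (Filter.Eventually.of_forall fun t ht => ?_))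
    rw [Set.uIoc_of_le ha1] at ht
    exact (hgb t ht).trans (le_abs_self _)
  have h1 : ∫ t in a..1, (Complex.I * l * W t + g t) = W 1 - W a :=
    intervalIntegral.integral_eq_sub_of_hasDerivAt (fun t ht => by
      rw [hgR t (hu ▸ ht)]; exact hW t (hu ▸ ht)) ((hWi.const_mul _).add hgi)
  rw [intervalIntegral.integral_add (hWi.const_mul _) hgi, intervalIntegral.integral_const_mul] at h1
  have h2 : ‖∫ t in a..1, g t‖ ≤ M * (1 / a + L) := by
    refine (intervalIntegral.norm_integral_le_of_norm_le ha1 (Filter.Eventually.of_forall hgb) hFi).trans ?_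
    rw [intervalIntegral.integral_eq_sub_of_hasDerivAt hFd hFi, ← mul_sub]
    refine mul_le_mul_of_nonneg_left ?_ hM
    rw [one_div]
    nlinarith
  rw [le_div_iff₀ hl]
  have h3 : ‖∫ t in a..1, W t‖ * l = ‖Complex.I * l * ∫ t in a..1, W t‖ := by
    rw [norm_mul, norm_mul, Complex.norm_I, Complex.norm_real, Real.norm_of_nonneg hl.le]; ring
  rw [h3, eq_sub_of_add_eq h1]
  refine (norm_sub_le _ _).trans ?_
  linarith [norm_sub_le (W 1) (W a)]
end HTP

namespace HTP
open Complex in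
lemma VV_bound : ∃ C : ℝ, 0 < C ∧ ∀ α y t : ℝ, 2 ≤ y → 3 / 4 ≤ α → α ≤ 1 → t ≠ 0 →
    ‖VV α y t‖ ≤ y ^ (1 - α) * (2 / |t| + C * (1 + ((1 - α) + |t|) * Real.log y)) + C := by
  obtain ⟨C, hC, hab⟩ := abel
  have hs : Summable fun n : ℕ => 32 * (n:ℝ) ^ (-(5/4):ℝ) := (Real.summable_nat_rpow.2 nn!).mul_left _
  have hT0 : 0 ≤ ∑' n : ℕ, 32 * (n:ℝ) ^ (-(5/4):ℝ) := tsum_nonneg fun n => by positivity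
  set T := ∑' n : ℕ, 32 * (n:ℝ) ^ (-(5/4):ℝ)
  refine ⟨C + T, by positivity, fun α y t hy hα hα1 ht => ?_⟩
  have hy0 : 0 < y := by linarith
  have hL : 0 ≤ Real.log y := Real.log_nonneg li!
  have habs := abs_pos.2 ht
  set w : ℂ := ((1 - α : ℝ) : ℂ) + ((-t : ℝ) : ℂ) * I with hw
  have hwre : w.re = 1 - α := by simp [hw]
  have hwim : w.im = -t := by simp [hw]
  have hw1 : |t| ≤ ‖w‖ := by
    have := abs_im_le_norm w
    rwa [hwim, abs_neg] at this
  have hw2 : ‖w‖ ≤ (1 - α) + |t| := by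
    have := norm_le_abs_re_add_abs_im w
    rwa [hwre, hwim, abs_neg, abs_of_nonneg (by linarith : 0 ≤ 1 - α)] at this
  have hw0 : w ≠ 0 := by intro h; rw [h, norm_zero] at hw1; linarith
  have h1 := hab y w li! (by rw [hwre]; linarith) hw0
  have hX : Real.exp (w.re * Real.log y) = y ^ (1 - α) := by rw [hwre, Real.rpow_def_of_pos hy0, mul_comm]
  rw [hX] at h1
  have h2 : VV α y t - ∑ p ∈ primesLE y, cexp (w * (Real.log p : ℝ)) * ((Real.log p / p : ℝ) : ℂ) =
      ∑ p ∈ primesLE y, Real.log p * ((((p^~α : ℝ):ℂ) * cexp (-((t * Real.log p : ℝ) * I))) ^ 2 / (1 - ((p^~α : ℝ):ℂ) * cexp (-((t * Real.log p : ℝ) * I)))) ∧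
      ‖∑ p ∈ primesLE y, Real.log p * ((((p^~α : ℝ):ℂ) * cexp (-((t * Real.log p : ℝ) * I))) ^ 2 / (1 - ((p^~α : ℝ):ℂ) * cexp (-((t * Real.log p : ℝ) * I))))‖ ≤ T := by
    have hnz : ∀ p ∈ primesLE y, ‖((p^~α : ℝ):ℂ) * cexp (-((t * Real.log p : ℝ) * I))‖ = p^~α := fun p hp => by
      rw [norm_mul, ← neg_mul, ← ofReal_neg, norm_exp_ofReal_mul_I, mul_one, norm_real, Real.norm_of_nonneg (q_pos α p (pr_of_mem hp)).le]
    constructor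
    · rw [VV, ← Finset.sum_sub_distrib]
      refine Finset.sum_congr rfl fun p hp => ?_
      have hp' := pr_of_mem hp
      have hp0 : (p:ℂ) ≠ 0 := by exact_mod_cast hp'.ne_zero
      have e : cexp (w * (Real.log p : ℝ)) * ((Real.log p / p : ℝ) : ℂ) = Real.log p * (((p^~α : ℝ):ℂ) * cexp (-((t * Real.log p : ℝ) * I))) := by
        have e1 : w * (Real.log p : ℝ) = (Real.log p : ℝ) + (((-(α * Real.log p) : ℝ):ℂ) + -((t * Real.log p : ℝ) * I)) := by
          rw [hw]; push_cast; ring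
        rw [e1, exp_add, exp_add, ← ofReal_exp, Real.exp_log (by exact_mod_cast hp'.pos), ← ofReal_exp, ← q_exp α p hp']
        push_cast
        field_simp
      rw [e]
      have hz := hnz p hp
      set z := ((p^~α : ℝ):ℂ) * cexp (-((t * Real.log p : ℝ) * I))
      have hz1 : 1 - z ≠ 0 := by
        intro h0
        rw [← sub_eq_zero.1 h0, norm_one] at hz
        linarith [prime_q_lt p hp' α li!]
      field_simp
      ring
    · refine (norm_sum_le _ _).trans (le_trans (Finset.sum_le_sum fun p hp => ?_) (hs.sum_le_tsum (primesLE y) fun n _ => by positivity))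
      have hp' := pr_of_mem hp
      have hp2 : (2:ℝ) ≤ p := by exact_mod_cast hp'.two_le
      have hz := hnz p hp
      have hq : p^~α ≤ 7 / 8 := by
        calc p^~α ≤ (p:ℝ) ^ (-(1/2):ℝ) := Real.rpow_le_rpow_of_exponent_le li! li!
          _ ≤ (2:ℝ) ^ (-(1/2):ℝ) := Real.rpow_le_rpow_of_nonpos nn! hp2 nn!
          _ ≤ 7 / 8 := by
            rw [Real.rpow_neg nn!, ← Real.sqrt_eq_rpow, inv_le_comm₀ po! nn!]
            exact Real.le_sqrt_of_sq_le nn!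
      have hq2 : p^~α ≤ (p:ℝ) ^ (-(3/4):ℝ) := Real.rpow_le_rpow_of_exponent_le li! li!
      set z := ((p^~α : ℝ):ℂ) * cexp (-((t * Real.log p : ℝ) * I))
      have h3 : 1 / 8 ≤ ‖1 - z‖ := by
        have := norm_sub_norm_le (1:ℂ) z
        rw [norm_one, hz] at this
        linarith
      have h4 : Real.log p ≤ (p:ℝ) ^ (1/4:ℝ) / (1/4) := Real.log_le_rpow_div li! nn!
      rw [norm_mul, norm_div, norm_pow, hz, norm_real, Real.norm_of_nonneg (log_prime_pos hp').le]
      calc _ ≤ (p:ℝ) ^ (1/4:ℝ) / (1/4) * (((p:ℝ) ^ (-(3/4):ℝ)) ^ 2 / (1 / 8)) := by gcongr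
        _ = 32 * ((p:ℝ) ^ (1/4:ℝ) * ((p:ℝ) ^ (-(3/4):ℝ)) ^ 2) := by ring
        _ = _ := by
          rw [← Real.rpow_natCast, ← Real.rpow_mul li!, ← Real.rpow_add li!]; norm_num
  have h3 : VV α y t = _ := sub_eq_iff_eq_add.1 h2.1
  rw [h3]
  refine (norm_add_le _ _).trans ?_
  have h4 : y ^ (1 - α) * (2 / ‖w‖ + C * (1 + ‖w‖ * Real.log y)) ≤ y ^ (1 - α) * (2 / |t| + (C + T) * (1 + ((1 - α) + |t|) * Real.log y)) := by
    gcongr; linarith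
  linarith [h2.2]
end HTP

namespace HTP
section
open Real MeasureTheory
open Complex (I)
set_option maxHeartbeats 1000000 in
lemma near : ∃ C y0 : ℝ, 0 < C ∧ 2 ≤ y0 ∧ ∀ α x y b : ℝ, y0 ≤ y → 0 < α → α ≤ 1 → phi1 α y + log x = 0 → log y ≤ log x →
    log x ≤ log y * log y ^ 7 → |b| ≤ 1 →
    ‖∫ t in (π / log y)..1, Phi α y x t * ker α b 4 t‖ ≤ C / (log y * (log x / log y) ^ 3) := by
  obtain ⟨C1, y1, hC1, hy1, hP⟩ := Phi_mid
  obtain ⟨C2, hC2, hV⟩ := VV_bound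
  obtain ⟨y2, hy2, hs⟩ := rel_small
  set K := 32 + 273 * C2 with hK
  set C4 := 3 * C1 * (4 / 3 * K + 8) with hC4
  refine ⟨8 * C1 + 2 * C4, max y1 (max y2 (exp 4)), by positivity, hy1.trans (le_max_left _ _), fun α x y b hy hα0 hα1 h hx1 hx2 hb => ?_⟩
  simp only [max_le_iff] at hy
  obtain ⟨hyy1, hyy2, hye⟩ := hy
  have hy0 : 0 < y := by linarith
  have hL4 := (le_log_iff_exp_le hy0).2 hye
  obtain ⟨hα, -, hX⟩ := hs α x y hyy2 hα0 hα1 h hx2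
  have hPt := hP α x y hyy1 li! hα1 h li!
  have hVt := fun t => hV α y t li! hα hα1
  have hlX : (1 - α) * log y ≤ y ^ (1 - α) := by
    rw [← log_rpow hy0]
    exact (log_le_sub_one_of_pos po!).trans li!
  set L := log y with hL
  have hL0 : 0 < L := by linarith
  set u := log x / L with hu
  have hu1 : 1 ≤ u := by rw [hu, le_div_iff₀ hL0]; linarith
  have hlx : log x = u * L := by rw [hu]; field_simp
  have hpi := pi_gt_three
  have hpi4 := pi_lt_four
  set a := π / L with ha
  have ha0 : 0 < a := by positivity
  have ha1 : a ≤ 1 := by rw [ha, div_le_one hL0]; linarith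
  have hPb : ∀ t ∈ Set.Icc a 1, ‖Phi α y x t‖ ≤ 3 * C1 / L * (u ^ 10)⁻¹ * (1 / t) := by
    intro t ht
    have ht0 : 0 < t := lt_of_lt_of_le ha0 ht.1
    have h1 := (hPt t ht0.ne').2 (by rw [abs_of_pos ht0]; exact ht.1) (by rw [abs_of_pos ht0]; exact ht.2.trans (one_le_pow₀ li!))
    rw [abs_of_pos ht0] at h1
    have h2 : log (2 + t) ≤ 2 * (1 / t) := by
      have := log_le_sub_one_of_pos (by linarith : 0 < 2 + t)
      have h3 : 1 ≤ 1 / t := by rw [le_div_iff₀ ht0]; linarith [ht.2]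
      linarith [ht.2]
    calc _ ≤ _ := h1
      _ ≤ C1 / L * (1 / t + 2 * (1 / t)) * (u ^ 10)⁻¹ := by gcongr
      _ = _ := by ring
  have hker : ∀ t, ‖ker α b 4 t‖ ≤ 4 / 3 := by
    intro t
    refine (ker_norm_le α b hα0 4 nn! t).trans ?_
    have h1 : α⁻¹ ≤ 4 / 3 := by rw [inv_le_comm₀ hα0 nn!]; linarith
    have h2 : (1 + (b * t) ^ 2)⁻¹ ≤ 1 := inv_le_one_of_one_le₀ (by linarith [sq_nonneg (b * t)])
    exact (mul_le_mul h1 h2 po! nn!).trans nn!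
  have hVb : ∀ t ∈ Set.Icc a 1, ‖VV α y t‖ ≤ K * u ^ 4 * (1 / t + t * L) := by
    intro t ht
    have ht0 : 0 < t := lt_of_lt_of_le ha0 ht.1
    have h1 := hVt t ht0.ne'
    rw [abs_of_pos ht0] at h1
    have h3 : 1 ≤ 1 / t := by rw [le_div_iff₀ ht0]; linarith [ht.2]
    have hv1 : 1 ≤ u ^ 2 := one_le_pow₀ hu1
    have htL : 0 ≤ t * L := by positivity
    set s := 1 / t + t * L with hsd
    have hs1 : 1 ≤ s := by linarith
    have h4 : 2 / t + C2 * (1 + (1 - α + t) * L) ≤ (2 + 17 * C2) * u ^ 2 * s := by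
      have h5 : (1 - α) * L ≤ 16 * u ^ 2 := hlX.trans hX
      have h6 : u ^ 2 ≤ u ^ 2 * s := le_mul_of_one_le_right po! hs1
      have h7 : s ≤ u ^ 2 * s := le_mul_of_one_le_left li! hv1
      have h8 : 2 / t + C2 * (1 + (1 - α + t) * L) = 2 * (1 / t) + C2 * (1 + t * L) + C2 * ((1 - α) * L) := by ring
      have h9 : C2 * (1 + t * L) ≤ C2 * (u ^ 2 * s) := mul_le_mul_of_nonneg_left li! hC2.le
      have h10 : C2 * ((1 - α) * L) ≤ C2 * (16 * (u ^ 2 * s)) := mul_le_mul_of_nonneg_left li! hC2.le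
      rw [h8]; linarith
    calc _ ≤ _ := h1
      _ ≤ 16 * u ^ 2 * ((2 + 17 * C2) * u ^ 2 * s) + C2 * (u ^ 4 * s) := by
        have h11 : 1 ≤ u ^ 4 * s := by
          exact one_le_mul_of_one_le_of_one_le (one_le_pow₀ hu1) li!
        have : 0 ≤ 1 - α := by linarith
        gcongr
        linarith [mul_le_mul_of_nonneg_left h11 hC2.le]
      _ = _ := by rw [hK]; ring
  choose D hD1 hD2 using fun t => ker_deriv α b t hα hb
  have hMain := ibp (fun t => Phi α y x t * ker α b 4 t)
    (fun t => -(I * VV α y t) * (Phi α y x t * ker α b 4 t) + Phi α y x t * D t) (log x) a (C4 / (L * u ^ 6)) L ha0 ha1 li! po! hL0.le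
    (fun t ht => ((Phi_deriv α y x t hα0).mul (hD1 t)).congr_deriv (by ring)) fun t ht => by
      have ht0 : 0 < t := lt_of_lt_of_le ha0 ht.1
      have h3 : 1 ≤ 1 / t := by rw [le_div_iff₀ ht0]; linarith [ht.2]
      have htL : 0 ≤ t * L := by positivity
      have e : -(I * VV α y t) * (Phi α y x t * ker α b 4 t) + Phi α y x t * D t = Phi α y x t * (D t - I * VV α y t * ker α b 4 t) := by ring
      have h5 : ‖D t - I * VV α y t * ker α b 4 t‖ ≤ (4 / 3 * K + 8) * (u ^ 4 * (1 / t + t * L)) := by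
        refine (norm_sub_le _ _).trans ?_
        rw [norm_mul, norm_mul, Complex.norm_I, one_mul]
        have h6 : 1 ≤ u ^ 4 * (1 / t + t * L) := by
          exact one_le_mul_of_one_le_of_one_le (one_le_pow₀ hu1) li!
        calc _ ≤ 8 * (u ^ 4 * (1 / t + t * L)) + K * u ^ 4 * (1 / t + t * L) * (4 / 3) := by
              have h7 := hVb t ht
              have h8 := hker t
              have h9 := hD2 t
              gcongr
              linarith
          _ = _ := by ring
      rw [e, norm_mul]
      calc _ ≤ 3 * C1 / L * (u ^ 10)⁻¹ * (1 / t) * ((4 / 3 * K + 8) * (u ^ 4 * (1 / t + t * L))) := by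
            have := hPb t ht
            gcongr
        _ = _ := by rw [hC4]; field_simp
  have hW : ∀ t ∈ Set.Icc a 1, ‖Phi α y x t * ker α b 4 t‖ ≤ 4 * C1 / L * (u ^ 10)⁻¹ * (1 / t) := by
    intro t ht
    rw [norm_mul]
    calc _ ≤ 3 * C1 / L * (u ^ 10)⁻¹ * (1 / t) * (4 / 3) := mul_le_mul (hPb t ht) (hker t) (norm_nonneg _) (by have := ht.1; have : 0 < t := li!; positivity)
      _ = _ := by ring
  refine hMain.trans ?_
  have h1 := hW 1 ⟨ha1, le_rfl⟩
  have h2 := hW a ⟨le_rfl, ha1⟩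
  have ha2 : 1 / a ≤ L := by rw [ha, one_div_div, div_le_iff₀ li!]; nlinarith
  have h10 : (u ^ 10)⁻¹ ≤ (u ^ 2)⁻¹ := inv_anti₀ po! (pow_le_pow_right₀ hu1 nn!)
  have h6 : (u ^ 6)⁻¹ ≤ (u ^ 2)⁻¹ := inv_anti₀ po! (pow_le_pow_right₀ hu1 nn!)
  have e1 : 4 * C1 / L * (u ^ 10)⁻¹ * (1 / 1) ≤ 4 * C1 * (u ^ 2)⁻¹ := by
    calc _ ≤ 4 * C1 / 1 * (u ^ 2)⁻¹ * (1 / 1) := by gcongr; linarith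
      _ = _ := by ring
  have e2 : 4 * C1 / L * (u ^ 10)⁻¹ * (1 / a) ≤ 4 * C1 * (u ^ 2)⁻¹ := by
    calc _ ≤ 4 * C1 / L * (u ^ 2)⁻¹ * L := by gcongr
      _ = _ := by field_simp
  have e3 : C4 / (L * u ^ 6) * (1 / a + L) ≤ 2 * C4 * (u ^ 2)⁻¹ := by
    calc _ ≤ C4 / (L * u ^ 6) * (L + L) := by gcongr
      _ = 2 * C4 * (u ^ 6)⁻¹ := by field_simp; ring
      _ ≤ _ := by gcongr
  rw [hlx]
  calc _ ≤ (4 * C1 * (u ^ 2)⁻¹ + 4 * C1 * (u ^ 2)⁻¹ + 2 * C4 * (u ^ 2)⁻¹) / (u * L) := by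
        gcongr
        · exact h1.trans e1
        · exact h2.trans e2
    _ = _ := by field_simp; ring
end
end HTP

namespace HTP
section
open Real MeasureTheory
open Complex (I)
lemma far : ∃ C y0 : ℝ, 0 < C ∧ 2 ≤ y0 ∧ ∀ α x y b : ℝ, y0 ≤ y → 0 < α → α ≤ 1 → phi1 α y + log x = 0 → log y ≤ log x →
    log x ≤ log y * log y ^ 7 → |b| = 1 / (log x / log y) →
    ‖∫ t in (Set.Icc (-1) 1)ᶜ, Phi α y x t * ker α b 4 t‖ ≤ C / (log y * (log x / log y) ^ 3) := by
  obtain ⟨C1, y1, hC1, hy1, hP⟩ := Phi_mid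
  obtain ⟨y2, hy2, hs⟩ := rel_small
  refine ⟨12 * C1, max y1 (max y2 (exp 4)), by positivity, hy1.trans (le_max_left _ _), fun α x y b hy hα0 hα1 h hx1 hx2 hb => ?_⟩
  simp only [max_le_iff] at hy
  obtain ⟨hyy1, hyy2, hye⟩ := hy
  have hy0 : 0 < y := by linarith
  have hL4 := (le_log_iff_exp_le hy0).2 hye
  obtain ⟨hα, -, -⟩ := hs α x y hyy2 hα0 hα1 h hx2
  have hPt := hP α x y hyy1 li! hα1 h li!
  set L := log y with hL
  have hL0 : 0 < L := by linarith
  set u := log x / L with hu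
  have hu1 : 1 ≤ u := by rw [hu, le_div_iff₀ hL0]; linarith
  have hu7 : u ≤ L ^ 7 := by rw [hu, div_le_iff₀ hL0]; linarith
  have hb0 : b ≠ 0 := by rintro rfl; rw [abs_zero] at hb; have : 0 < 1 / u := po!; linarith
  have hpt : ∀ t ∈ (Set.Icc (-1:ℝ) 1)ᶜ, ‖Phi α y x t * ker α b 4 t‖ ≤ 3 * C1 / L * (u ^ 4)⁻¹ * (1 + (b * t) ^ 2)⁻¹ := by
    intro t ht
    have ht1 : 1 < |t| := by
      by_contra hlt
      exact ht (abs_le.1 (not_lt.1 hlt))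
    have ht0 : t ≠ 0 := by rintro rfl; simp at ht1; linarith
    obtain ⟨h1, h2⟩ := hPt t ht0
    have hk : ‖ker α b 4 t‖ ≤ |t|⁻¹ * ((1 + (b * t) ^ 2)⁻¹ * (1 + (b * t) ^ 2)⁻¹) := by
      unfold ker
      rw [norm_inv, norm_mul, norm_pow, mul_inv, show ‖1 + b * t * I‖ ^ 4 = (‖1 + b * t * I‖ ^ 2) * (‖1 + b * t * I‖ ^ 2) by ring, norm_one_add, mul_inv]
      have := inv_anti₀ li! (le_norm_al' α t)
      gcongr
    have hg : (1 / |t| + log (2 + |t|)) * |t|⁻¹ ≤ 3 := by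
      have h3 := log_le_sub_one_of_pos (by linarith : 0 < 2 + |t|)
      have h4 : 1 / |t| ≤ 1 := by rw [div_le_one li!]; linarith
      rw [← div_eq_mul_inv, div_le_iff₀ li!]; linarith
    set g := 1 / |t| + log (2 + |t|)
    set k := (1 + (b * t) ^ 2)⁻¹ with hkd
    have hk0 : 0 < k := by positivity
    have hk1 : k ≤ 1 := inv_le_one_of_one_le₀ (by linarith [sq_nonneg (b * t)])
    have hPk : ∃ m : ℝ, 0 ≤ m ∧ ‖Phi α y x t‖ ≤ C1 / L * g * m ∧ m * k ≤ (u ^ 4)⁻¹ := by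
      rcases le_or_gt |t| (u ^ 3) with h3 | h3
      · refine ⟨(u ^ 10)⁻¹, by positivity, h2 ?_ (h3.trans ?_), ?_⟩
        · rw [div_le_iff₀ hL0]; nlinarith [pi_lt_four]
        · calc u ^ 3 ≤ (L ^ 7) ^ 3 := by gcongr
            _ = _ := by ring
        · have h5 : (u ^ 10)⁻¹ ≤ (u ^ 4)⁻¹ := inv_anti₀ po! (pow_le_pow_right₀ hu1 nn!)
          exact (mul_le_of_le_one_right po! hk1).trans h5
      · refine ⟨1, zero_le_one, by linarith, ?_⟩
        rw [one_mul]
        refine inv_anti₀ po! ?_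
        have h5 : u ^ 2 ≤ |b * t| := by
          rw [abs_mul, hb, one_div, inv_mul_eq_div, le_div_iff₀ li!]; nlinarith
        have h6 := pow_le_pow_left₀ po! h5 2
        rw [sq_abs] at h6
        linarith
    obtain ⟨m, hm0, hm1, hm2⟩ := hPk
    rw [norm_mul]
    calc _ ≤ (C1 / L * g * m) * (|t|⁻¹ * (k * k)) := mul_le_mul hm1 hk (norm_nonneg _) ((norm_nonneg _).trans hm1)
      _ = C1 / L * (g * |t|⁻¹) * (m * k) * k := by ring
      _ ≤ C1 / L * 3 * (u ^ 4)⁻¹ * k := by gcongr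
      _ = _ := by ring
  obtain ⟨hi1, hi2⟩ := int_ker b hb0
  have hi3 := hi1.const_mul (3 * C1 / L * (u ^ 4)⁻¹)
  refine (norm_integral_le_of_norm_le hi3.integrableOn ((ae_restrict_iff' measurableSet_Icc.compl).2 (Filter.Eventually.of_forall hpt))).trans ?_
  refine (setIntegral_le_integral hi3 (Filter.Eventually.of_forall fun t => by positivity)).trans ?_
  rw [integral_const_mul, hi2, hb]
  have := pi_lt_four
  calc _ ≤ 3 * C1 / L * (u ^ 4)⁻¹ * (4 / (1 / u)) := by gcongr
    _ = _ := by field_simp; norm_num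
lemma F_conj (α y x b t : ℝ) (r : ℕ) : Phi α y x (-t) * ker α b r (-t) = (starRingEnd ℂ) (Phi α y x t * ker α b r t) := by
  simp only [Phi, ker, fac, map_mul, map_prod, map_div₀, map_sub, map_one, map_inv₀, map_pow, map_add, ← Complex.exp_conj, Complex.conj_I, Complex.conj_ofReal, map_neg]
  push_cast
  congr 2
  · congr 1; ring
  · refine Finset.prod_congr rfl fun p _ => ?_
    congr 4; ring
  · congr 2 <;> ring
lemma tail_mid : ∃ C y0 : ℝ, 0 < C ∧ 2 ≤ y0 ∧ ∀ α x y : ℝ, y0 ≤ y → 0 < α → α ≤ 1 → phi1 α y + log x = 0 →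
    3 * log y ≤ log x → log x ≤ log y * log y ^ 7 → TailOK C α x y := by
  obtain ⟨C1, y1, hC1, hy1, hN⟩ := near
  obtain ⟨C2, y2, hC2, hy2, hF⟩ := far
  obtain ⟨y3, hy3, hs⟩ := rel_small
  refine ⟨4 + 3 * (2 * C1 + C2), max y1 (max y2 (max y3 (exp 4))), by positivity, hy1.trans (le_max_left _ _), fun α x y hy hα0 hα1 h hx1 hx2 => ?_⟩
  simp only [max_le_iff] at hy
  obtain ⟨hyy1, hyy2, hyy3, hye⟩ := hy
  have hy0 : 0 < y := by linarith
  have hL4 := (le_log_iff_exp_le hy0).2 hye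
  obtain ⟨hα, hph, -⟩ := hs α x y hyy3 hα0 hα1 h hx2
  have hph0 := phi2_pos α y hα0 li!
  have hNb := fun b hb => hN α x y b hyy1 hα0 hα1 h li! hx2 hb
  have hFb := fun b hb => hF α x y b hyy2 hα0 hα1 h li! hx2 hb
  set L := log y with hL
  have hL0 : 0 < L := by linarith
  have he1 : 1 / (log x / L) ≤ e0 x y := by
    unfold e0; have : 0 ≤ log y / y := by positivity
    linarith
  set u := log x / L with hu
  have hu3 : 3 ≤ u := by rw [hu, le_div_iff₀ hL0]; linarith
  have hlx : log x = u * L := by rw [hu]; field_simp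
  have hpi4 := pi_lt_four
  set a := π / L with ha
  have ha0 : 0 < a := div_pos pi_pos hL0
  have ha1 : a ≤ 1 := by rw [ha, div_le_one hL0]; linarith
  refine ⟨1 / u, 4, by positivity, by norm_num, ?_, ?_, fun b hb => ?_⟩
  · push_cast
    have : α * (1 / u) ≤ 1 * e0 x y := by gcongr
    have : 0 ≤ e0 x y := le_trans po! he1
    nlinarith [mul_nonneg hC1.le this, mul_nonneg hC2.le this]
  · rw [mul_one_div, div_le_iff₀ li!]; linarith
  · have hb0 : b ≠ 0 := by
      rintro rfl; rw [abs_zero] at hb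
      have : 0 < 1 / u := by positivity
      linarith
    have h1 := hNb b (by rw [hb, div_le_one li!]; linarith)
    have h2 := hFb b hb
    have hi := F_int α b y x hα0 hb0 4 nn!
    set F := fun t => Phi α y x t * ker α b 4 t with hFd
    have e1 : (Set.Icc (-a) a)ᶜ = (Set.Icc (-1) 1)ᶜ ∪ (Set.Ico (-1) (-a) ∪ Set.Ioc a 1) := by
      ext t; simp only [Set.mem_compl_iff, Set.mem_Icc, Set.mem_union, Set.mem_Ico, Set.mem_Ioc, not_and_or, not_le]
      grind
    have d1 : Disjoint (Set.Icc (-1:ℝ) 1)ᶜ (Set.Ico (-1) (-a) ∪ Set.Ioc a 1) := by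
      rw [Set.disjoint_left]; intro t h3 h4
      apply h3
      rcases h4 with h4 | h4
      · exact ⟨h4.1, by linarith [h4.2]⟩
      · exact ⟨by linarith [h4.1], h4.2⟩
    have d2 : Disjoint (Set.Ico (-1:ℝ) (-a)) (Set.Ioc a 1) := by
      rw [Set.disjoint_left]; intro t h3 h4
      linarith [h3.2, h4.1]
    rw [e1, setIntegral_union d1 (measurableSet_Ico.union measurableSet_Ioc) hi.integrableOn hi.integrableOn,
      setIntegral_union d2 measurableSet_Ioc hi.integrableOn hi.integrableOn]
    have e2 : ∫ t in Set.Ioc a 1, F t = ∫ t in a..1, F t := (intervalIntegral.integral_of_le ha1).symm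
    have e3 : ‖∫ t in Set.Ico (-1) (-a), F t‖ = ‖∫ t in a..1, F t‖ := by
      rw [integral_Ico_eq_integral_Ioc, ← intervalIntegral.integral_of_le li!, ← intervalIntegral.integral_comp_neg,
        intervalIntegral.integral_of_le ha1, intervalIntegral.integral_of_le ha1, ← Complex.norm_conj (∫ t in Set.Ioc a 1, F t), ← integral_conj]
      simp only [hFd, F_conj]
    rw [e2]
    refine (norm_add_le _ _).trans ((add_le_add h2 ((norm_add_le _ _).trans (add_le_add (e3.le.trans h1) h1))).trans ?_)
    have hsq : √(phi2 α y) ≤ 3 * L * u := by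
      refine sqrt_le_iff.2 ⟨by positivity, hph.trans ?_⟩
      rw [hlx]; nlinarith [mul_pos hL0 hL0, mul_pos (mul_pos hL0 hL0) (by linarith : 0 < u)]
    have hsq0 := sqrt_pos.2 hph0
    calc _ = (2 * C1 + C2) / (L * u ^ 3) := by ring
      _ ≤ (2 * C1 + C2) / (L * u ^ 2) := by
        gcongr
        · linarith
        · norm_num
      _ = 3 * (2 * C1 + C2) * (1 / u) / (1 * (3 * L * u)) := by field_simp
      _ ≤ _ := by
        have : 0 ≤ e0 x y := le_trans po! he1
        gcongr
        linarith
end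
end HTP

namespace HTP
section
open Real MeasureTheory
open Complex (I)
lemma tail : ∃ C y0 : ℝ, 0 < C ∧ 2 ≤ y0 ∧ ∀ α x y : ℝ, y0 ≤ y → 0 < α → α ≤ 1 → phi1 α y + log x = 0 →
    3 * log y ≤ log x → TailOK C α x y := by
  obtain ⟨C1, y1, hC1, hy1, h1⟩ := tail_big
  obtain ⟨C2, y2, hC2, hy2, h2⟩ := tail_mid
  refine ⟨C1 + C2, y1 + y2, by linarith, by linarith, fun α x y hy hα hα1 h hx => ?_⟩
  have hL := log_pos (by linarith : 1 < y)
  have he : 0 ≤ e0 x y := by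
    have : 0 < log x := by linarith
    have : 0 < y := by linarith
    unfold e0; positivity
  have hm : ∀ C' : ℝ, C' ≤ C1 + C2 → TailOK C' α x y → TailOK (C1 + C2) α x y := by
    rintro C' hC ⟨β, r, g1, g2, g3, g4, g5⟩
    exact ⟨β, r, g1, g2, g3.trans (by gcongr), g4, fun b hb => (g5 b hb).trans (by gcongr)⟩
  rcases le_total (log y * log y ^ 7) (log x) with h3 | h3
  · exact hm C1 li! (h1 α x y li! hα hα1 h h3)
  · exact hm C2 li! (h2 α x y li! hα hα1 h hx h3)
lemma HT_eq (x y α : ℝ) : HT x y α = x ^ α * zetaSmooth α y * (1 / (α * (√(2 * π) * √(phi2 α y)))) := by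
  unfold HT; rw [sqrt_mul po!]; ring
set_option maxHeartbeats 1000000 in
lemma large : ∃ C δ y0 : ℝ, 0 < C ∧ 0 < δ ∧ 2 ≤ y0 ∧ ∀ α x y : ℝ, y0 ≤ y → 0 < x → 0 < α → phi1 α y + log x = 0 →
    3 * log y ≤ log x → e0 x y ≤ δ → |(smoothCount x y : ℝ) - HT x y α| ≤ C * e0 x y * HT x y α := by
  obtain ⟨C, y1, hC, hy1, hT⟩ := tail
  obtain ⟨Cm, hCm, hM⟩ := main_term C hC.le
  obtain ⟨Cb, y2, hCb, hy2, hB⟩ := rel_B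
  obtain ⟨y3, hy3, hal⟩ := al_lt_one
  set C5 := Cm * Cb + C with hC5
  have hC50 : 0 < C5 := by positivity
  set D := 1 + 4 * Cb + C + C5 with hD
  have hD0 : 0 < D := by positivity
  refine ⟨2 * C + C5 + 2 * C * C5, 1 / D, y1 + y2 + y3, by positivity, by positivity, by linarith, fun α x y hy hx hα h h3 he => ?_⟩
  have hL := log_pos (by linarith : 1 < y)
  have hα1 := hal α x y li! hα h h3
  obtain ⟨β, r, hβ, hr, hrb, hab, hI⟩ := hT α x y li! hα hα1.le h h3
  have hB' := hB α x y li! hα h h3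
  rw [← e0] at hB'
  have hph0 := phi2_pos α y hα li!
  have hred := reduction α y x β hα hx li! hβ li! r hr
  have he0 : 0 < e0 x y := by
    have : 0 < log x := by linarith
    have : 0 < y := by linarith
    unfold e0; positivity
  set e := e0 x y with hee
  have hDe : D * e ≤ 1 := by rwa [mul_comm, ← le_div_iff₀ hD0]
  have g1 := mul_pos hC he0
  have g2 := mul_pos hCb he0
  have g3 := mul_pos hC50 he0
  have hDe' : e + 4 * (Cb * e) + C * e + C5 * e ≤ 1 := by rw [hD] at hDe; linarith
  have h4B : 4 * (log y + 1 / α) ^ 2 ≤ phi2 α y := by linarith [mul_le_mul_of_nonneg_right (by linarith : Cb * e ≤ 1 / 4) hph0.le]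
  have hrB : (r:ℝ) * β ≤ C * (log y + 1 / α) := by
    have : (r:ℝ) * β ≤ C * (1 / α) := by
      rw [mul_one_div, le_div_iff₀ hα]
      have : C * e ≤ C * 1 := by gcongr; linarith
      linarith
    linarith [mul_pos hC hL]
  set σ := √(phi2 α y) with hσ
  have hσ0 : 0 < σ := sqrt_pos.2 hph0
  set s := √(2 * π) with hs
  have hs1 : 1 ≤ s := by rw [hs, one_le_sqrt]; linarith [pi_gt_three]
  have hss : s * s = 2 * π := mul_self_sqrt po!
  set H := 1 / (α * (s * σ)) with hH
  have hH0 : 0 < H := by positivity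
  have hJ : ∀ b : ℝ, |b| = β → |(1 / (2 * π)) * (∫ t, Phi α y x t * ker α b r t).re - H| ≤ C5 * e * H := by
    intro b hb
    have hb0 : b ≠ 0 := by rintro rfl; simp at hb; linarith
    have j1 := hM α b x y _ r hα li! rfl (by rw [hb]; exact hrB) h h4B
    have j2 := hI b hb
    have j4 : |(∫ t in (Set.Icc (-(π / log y)) (π / log y))ᶜ, Phi α y x t * ker α b r t).re| ≤ C * e / (α * σ) :=
      (Complex.abs_re_le_norm _).trans j2
    rw [← integral_add_compl (measurableSet_Icc (a := -(π / log y)) (b := π / log y)) (F_int α b y x hα hb0 r hr), Complex.add_re]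
    set a1 := (∫ t in Set.Icc (-(π / log y)) (π / log y), Phi α y x t * ker α b r t).re
    set a2 := (∫ t in (Set.Icc (-(π / log y)) (π / log y))ᶜ, Phi α y x t * ker α b r t).re
    have j3 : |α * a1 - s / σ| ≤ Cm * (Cb * e) / σ := by
      refine j1.trans ?_
      gcongr
      rwa [div_le_iff₀ hph0]
    have j5 : |a1 - s / (σ * α)| ≤ Cm * Cb * e / (α * σ) := by
      have : a1 - s / (σ * α) = (α * a1 - s / σ) / α := by field_simp
      rw [this, abs_div, abs_of_pos hα, div_le_iff₀ hα]
      refine j3.trans (le_of_eq ?_); field_simp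
    have j6 : 1 / (2 * π) * (a1 + a2) - H = ((a1 - s / (σ * α)) + a2) / (s * s) := by
      rw [← hss, hH]; field_simp; ring
    rw [j6, abs_div, abs_of_pos (by positivity : 0 < s * s), div_le_iff₀ po!]
    calc _ ≤ Cm * Cb * e / (α * σ) + C * e / (α * σ) := (abs_add_le _ _).trans (add_le_add j5 j4)
      _ = C5 * e * H * s := by rw [hC5, hH]; field_simp
      _ ≤ C5 * e * H * (s * s) := mul_le_mul_of_nonneg_left (le_mul_of_one_le_left li! hs1) po!
  have hJ1 := abs_le.1 (hJ β (abs_of_pos hβ))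
  have hJ2 := abs_le.1 (hJ (-β) (by rw [abs_neg, abs_of_pos hβ]))
  rw [HT_eq, ← hs, ← hσ, ← hH]
  have hζ := zetaSmooth_pos α y hα
  have hx0 : 0 < x ^ α := by positivity
  set M := x ^ α * zetaSmooth α y
  have hM0 : 0 < M := by positivity
  set J1 := (1 / (2 * π)) * (∫ t, Phi α y x t * ker α β r t).re
  set J2 := (1 / (2 * π)) * (∫ t, Phi α y x t * ker α (-β) r t).re
  have hab0 : 0 < α * β := by positivity
  have k1 : 1 - C * e ≤ (1 - α * β) ^ r := by
    have := one_add_mul_le_pow (by linarith : -2 ≤ -(α * β)) r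
    rw [← sub_eq_add_neg] at this
    linarith
  have k2 : (1 + α * β) ^ r ≤ 1 + 2 * (C * e) := by
    have q1 : (1 + α * β) ^ r ≤ exp (r * (α * β)) := by
      rw [exp_nat_mul]; gcongr; linarith [add_one_le_exp (α * β)]
    have q2 : exp (r * (α * β)) ≤ exp (C * e) := exp_le_exp.2 hrb
    have q3 := abs_exp_sub_one_sub_id_le (x := C * e) (by rw [abs_of_pos g1]; linarith)
    have q4 := (abs_le.1 q3).2
    have q5 : (C * e) ^ 2 ≤ C * e := pow_le_of_le_one g1.le li! nn!
    linarith
  have k3 : (1 - C * e) * ((1 - C5 * e) * H) ≤ (1 - α * β) ^ r * J1 := by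
    have : 0 ≤ (1 - C5 * e) * H := mul_nonneg li! hH0.le
    exact mul_le_mul k1 li! this (pow_nonneg li! _)
  have k4 : (1 + α * β) ^ r * J2 ≤ (1 + 2 * (C * e)) * ((1 + C5 * e) * H) := by
    have : 0 ≤ (1 - C5 * e) * H := mul_nonneg li! hH0.le
    exact mul_le_mul k2 li! li! li!
  have k5 := mul_le_mul_of_nonneg_left k3 hM0.le
  have k6 := mul_le_mul_of_nonneg_left k4 hM0.le
  have he1 : e ≤ 1 := by linarith
  have hMH : 0 < M * H := by positivity
  have k7 : C * e * (C5 * e) ≤ C * C5 * e := by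
    have := mul_le_mul_of_nonneg_left he1 (mul_pos (mul_pos hC hC50) he0).le
    linarith
  have k8 := mul_le_mul_of_nonneg_right k7 hMH.le
  have k9 := mul_pos g1 hMH
  have k10 := mul_pos (mul_pos g1 g3) hMH
  have k11 := mul_pos (mul_pos g1 hC50) hMH
  rw [abs_le]
  constructor
  · linarith [hred.1]
  · linarith [hred.2]
end
end HTP

namespace HTP
section
open Real MeasureTheory
open Complex (I)
lemma Psi_le (x y : ℝ) (hx : 0 ≤ x) : (smoothCount x y : ℝ) ≤ x := by
  have h : smoothCount x y ≤ Nat.card (Set.Icc 1 ⌊x⌋₊ : Set ℕ) := by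
    refine Nat.card_mono (s := {n : ℕ | 0 < n ∧ (n : ℝ) ≤ x ∧ ∀ p : ℕ, p.Prime → p ∣ n → (p : ℝ) ≤ y}) (Set.finite_Icc _ _) fun n hn => ?_
    exact ⟨hn.1, Nat.le_floor hn.2.1⟩
  have h2 : Nat.card (Set.Icc 1 ⌊x⌋₊ : Set ℕ) = ⌊x⌋₊ := by simp
  rw [h2] at h
  exact (Nat.cast_le.2 h).trans (Nat.floor_le hx)
lemma rankin (α x y : ℝ) (hα : 0 < α) (hx : 0 < x) (hy : 0 ≤ y) : (smoothCount x y : ℝ) ≤ 9 / 4 * (x ^ α * zetaSmooth α y) := by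
  have hβ : 0 < 1 / (2 * α) := by positivity
  have hab : α * (1 / (2 * α)) = 1 / 2 := by field_simp
  have h := (reduction α y x (1 / (2 * α)) hα hx hy hβ (by rw [hab]; norm_num) 2 le_rfl).2
  rw [hab] at h
  refine h.trans ?_
  obtain ⟨hi1, hi2⟩ := int_ker (-(1 / (2 * α))) li!
  have h1 : ‖∫ t, Phi α y x t * ker α (-(1 / (2 * α))) 2 t‖ ≤ 2 * π := by
    refine (norm_integral_le_of_norm_le (hi1.const_mul α⁻¹) (Filter.Eventually.of_forall fun t => ?_)).trans (le_of_eq ?_)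
    · rw [norm_mul]
      exact (mul_le_of_le_one_left (norm_nonneg _) (Phi_norm_le_one α y x t hα)).trans (ker_norm_le α _ hα 2 le_rfl t)
    · rw [integral_const_mul, hi2, abs_neg, abs_of_pos hβ]; field_simp
  have h2 := (Complex.re_le_norm _).trans h1
  have hM : 0 < x ^ α * zetaSmooth α y := mul_pos po! (zetaSmooth_pos α y hα)
  have hp := pi_pos
  calc _ ≤ x ^ α * zetaSmooth α y * ((1 + 1 / 2) ^ 2 * (1 / (2 * π) * (2 * π))) := by gcongr
    _ = _ := by field_simp; ring
lemma s_le : √(2 * π) ≤ 3 := sqrt_le_iff.2 ⟨by norm_num, by linarith [pi_lt_four]⟩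
lemma HT_pos (α x y : ℝ) (hα : 0 < α) (hx : 0 < x) (hy : 2 ≤ y) : 0 < HT x y α := by
  rw [HT_eq]
  have := zetaSmooth_pos α y hα
  have := sqrt_pos.2 (phi2_pos α y hα hy)
  positivity
lemma small1 (Y : ℝ) (hY : 2 ≤ Y) (α x y : ℝ) (hα : 0 < α) (hx : 0 < x) (hy : 2 ≤ y) (hyY : y ≤ Y) : (smoothCount x y : ℝ) ≤ 7 * Y * HT x y α := by
  have h1 := rankin α x y hα hx li!
  have hk : ((primesLE y).card:ℝ) ≤ Y := by
    have h2 : (primesLE y).card ≤ ⌊y⌋₊ := by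
      have : primesLE y ⊆ Finset.Icc 1 ⌊y⌋₊ := fun p hp => Finset.mem_Icc.2 ⟨(pr_of_mem hp).one_lt.le, (mem_primesLE.1 hp).1⟩
      simpa using Finset.card_le_card this
    exact ((Nat.cast_le (α := ℝ).2 h2).trans (Nat.floor_le li!)).trans hyY
  have hs : α * √(phi2 α y) ≤ Y := by
    refine le_of_sq_le_sq ?_ li!
    rw [mul_pow, sq_sqrt (phi2_pos α y hα hy).le]
    have := al_phi2 α y hα
    nlinarith
  rw [HT_eq]
  have := zetaSmooth_pos α y hα
  have h0 := sqrt_pos.2 (phi2_pos α y hα hy)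
  have hM : 0 < x ^ α * zetaSmooth α y := by positivity
  have h3 : α * (√(2 * π) * √(phi2 α y)) ≤ 3 * Y := by
    calc _ = √(2 * π) * (α * √(phi2 α y)) := by ring
      _ ≤ _ := mul_le_mul s_le hs po! nn!
  calc _ ≤ _ := h1
    _ ≤ 7 / 3 * (x ^ α * zetaSmooth α y) := by linarith
    _ = 7 * Y * (x ^ α * zetaSmooth α y * (1 / (3 * Y))) := by field_simp
    _ ≤ _ := by gcongr
lemma zeta_lower (α y c : ℝ) (hα : 0 < α) (hy : 1 ≤ y) (hc : 0 ≤ c) (hc1 : c ≤ 1) (h : c ≤ y ^ (1 - α)) : c * log y ≤ zetaSmooth α y := by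
  have h1 := (euler_sum α y 0 hα).2
  have h2 : ∏ p ∈ primesLE y, fac (p^~α) (0 * log p) = 1 := by
    refine Finset.prod_eq_one fun p hp => ?_
    have h3 := prime_q_lt p (pr_of_mem hp) α hα
    have h4 : (1:ℂ) - ((p^~α : ℝ) : ℂ) ≠ 0 := by
      have : (1:ℝ) - p^~α ≠ 0 := by linarith
      exact_mod_cast this
    unfold fac
    rw [zero_mul, Complex.ofReal_zero, zero_mul, neg_zero, Complex.exp_zero, mul_one, div_self h4]
  rw [h2, mul_one] at h1
  have h3 : HasSum (fun n : Nat.smoothNumbers (⌊y⌋₊+1) => ((n:ℕ):ℝ)^(-α)) (zetaSmooth α y) := by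
    rw [← Complex.hasSum_ofReal]
    convert h1 using 2
    simp
  have h4 := (hasSum_subtype_iff_indicator (f := fun n : ℕ => n^~α)).1 h3
  have h5 := sum_le_hasSum (Finset.Icc 1 ⌊y⌋₊) (fun n _ => Set.indicator_nonneg (fun m _ => by positivity) n) h4
  refine le_trans ?_ h5
  have h6 : log y ≤ ∑ n ∈ Finset.Icc 1 ⌊y⌋₊, ((n:ℝ))⁻¹ := by
    have := log_le_harmonic_floor y li!
    rw [harmonic_eq_sum_Icc] at this
    push_cast at this
    exact this
  refine (mul_le_mul_of_nonneg_left h6 hc).trans ?_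
  rw [Finset.mul_sum]
  refine Finset.sum_le_sum fun n hn => ?_
  have hn' := Finset.mem_Icc.1 hn
  have hn1 : (1:ℝ) ≤ n := by exact_mod_cast hn'.1
  have hny : (n:ℝ) ≤ y := (Nat.le_floor_iff li!).1 hn'.2
  rw [Set.indicator_of_mem (Nat.mem_smoothNumbers_of_lt (by omega) (by omega)), show -α = (1 - α) - 1 by ring, rpow_sub_one li!, div_eq_mul_inv]
  gcongr
  rcases le_total α 1 with h7 | h7
  · exact hc1.trans (one_le_rpow hn1 li!)
  · exact h.trans (rpow_le_rpow_of_nonpos li! hny li!)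
lemma al_gt : ∃ y0 : ℝ, 2 ≤ y0 ∧ ∀ α x y : ℝ, y0 ≤ y → 1 < α → phi1 α y + log x = 0 → log y ≤ log x →
    1 / 4 ≤ y ^ (1 - α) ∧ α ≤ 2 ∧ phi2 α y ≤ 8 * log y ^ 2 := by
  obtain ⟨C, hC, hM⟩ := mertens
  set D := 4 * ∑' n : ℕ, 1 / (n:ℝ) ^ (3 / 2 : ℝ) with hD
  have hD0 : 0 ≤ D := mul_nonneg nn! (tsum_nonneg fun n => by positivity)
  refine ⟨max 2 (exp (4 * (C + D) + 4)), le_max_left _ _, fun α x y hy hα h hu => ?_⟩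
  have hy2 := (le_max_left _ _).trans hy
  have hy0 : 0 < y := by linarith
  have hL : 4 * (C + D) + 4 ≤ log y := (le_log_iff_exp_le li!).2 ((le_max_right _ _).trans hy)
  have h1 := (abs_le.1 (hM y li!)).2
  have hs1 : 1 ≤ √y := one_le_sqrt.2 li!
  have h2 := (abs_le.1 (hM (√y) hs1)).2
  rw [log_sqrt hy0.le] at h2
  have h3 := sum_log_sq (primesLE y) (fun p hp => pr_of_mem hp)
  rw [log_x_eq α x y li! h] at hu
  set z := y ^ ((1 - α) / 2) with hz
  have hz0 : 0 < z := by positivity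
  have hz1 : z ≤ 1 := rpow_le_one_of_one_le_of_nonpos li! li!
  have hq : ∀ p ∈ primesLE y, p^~α ≤ 1 / p := fun p hp => by
    rw [one_div, ← rpow_neg_one]
    exact rpow_le_rpow_of_exponent_le (by exact_mod_cast (pr_of_mem hp).one_lt.le) li!
  have h4 : ∑ p ∈ primesLE y, log p * (p^~α / (1 - p^~α)) ≤
      ∑ p ∈ primesLE y, (z * (log p / p) + log p / (p * ((p:ℝ) - 1)) + if (p:ℝ) ≤ √y then (1 - z) * (log p / p) else 0) := by
    refine Finset.sum_le_sum fun p hp => ?_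
    have hp' := pr_of_mem hp
    have hp2 : (2:ℝ) ≤ p := by exact_mod_cast hp'.two_le
    have hl := log_prime_pos hp'
    have hq1 := hq p hp
    have hq0 := q_pos α p hp'
    have hp1 : 1 / (p:ℝ) < 1 := by rw [div_lt_one li!]; linarith
    have e1 : p^~α / (1 - p^~α) = p^~α + p^~α * p^~α / (1 - p^~α) := by
      have : 1 - p^~α ≠ 0 := by linarith
      field_simp; ring
    have e2 : p^~α * p^~α / (1 - p^~α) ≤ 1 / (p * ((p:ℝ) - 1)) := by
      calc _ ≤ 1 / p * (1 / p) / (1 - 1 / (p:ℝ)) := by gcongr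
        _ = _ := by
          have : (p:ℝ) - 1 ≠ 0 := by linarith
          have : (p:ℝ) ≠ 0 := by linarith
          field_simp
    have e3 : log p * p^~α ≤ z * (log p / p) + if (p:ℝ) ≤ √y then (1 - z) * (log p / p) else 0 := by
      split_ifs with hps
      · have := mul_le_mul_of_nonneg_left hq1 hl.le
        linarith [mul_one_div (log p) (p:ℝ)]
      · have : p^~α ≤ z * (1 / p) := by
          rw [show -α = (1 - α) - 1 by ring, rpow_sub_one li!, div_eq_mul_one_div]
          gcongr
          rw [hz, show (1 - α) / 2 = 1 / 2 * (1 - α) by ring, rpow_mul hy0.le, ← sqrt_eq_rpow]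
          exact rpow_le_rpow_of_nonpos li! li! li!
        calc _ ≤ log p * (z * (1 / p)) := by gcongr
          _ = _ := by ring
    rw [e1, mul_add]
    have e4 := mul_le_mul_of_nonneg_left e2 hl.le
    rw [mul_one_div] at e4
    linarith
  rw [Finset.sum_add_distrib, Finset.sum_add_distrib, ← Finset.mul_sum, ← Finset.sum_filter, ← Finset.mul_sum] at h4
  have h5 : ∑ p ∈ (primesLE y).filter (fun p : ℕ => (p:ℝ) ≤ √y), log p / p ≤ ∑ p ∈ primesLE (√y), log p / p := by
    refine Finset.sum_le_sum_of_subset_of_nonneg (fun p hp => ?_) fun p hp _ => by positivity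
    have := Finset.mem_filter.1 hp
    exact (prime_mem li!).2 ⟨this.2, pr_of_mem this.1⟩
  have hL0 : 0 < log y := by linarith
  have h6 : 1 / 2 ≤ z := by
    have a1 := mul_le_mul_of_nonneg_left h1 hz0.le
    have a2 := mul_le_mul_of_nonneg_left (h5.trans (sub_le_iff_le_add.1 h2)) (sub_nonneg.2 hz1)
    have a3 : log y * (1 / 2) ≤ log y * z := by linarith
    exact le_of_mul_le_mul_left a3 hL0
  have h7 : 1 / 4 ≤ y ^ (1 - α) := by
    rw [show 1 - α = (1 - α) / 2 + (1 - α) / 2 by ring, rpow_add hy0, ← hz]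
    nlinarith
  refine ⟨h7, ?_, ?_⟩
  · have a1 := log_le_log nn! h7
    rw [log_rpow hy0, one_div, log_inv] at a1
    have a2 := log_le_sub_one_of_pos (by norm_num : (0:ℝ) < 4)
    by_contra hlt
    nlinarith
  · rw [phi2_eq α y li!]
    calc _ ≤ ∑ p ∈ primesLE y, 4 * log y * (log p / p) := by
          refine Finset.sum_le_sum fun p hp => ?_
          have hp' := pr_of_mem hp
          have hp2 : (2:ℝ) ≤ p := by exact_mod_cast hp'.two_le
          have hl := log_prime_pos hp'
          have hly := log_le_of_mem hy0.le hp
          have hq1 := hq p hp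
          have hp1 : 1 / (p:ℝ) ≤ 1 / 2 := by gcongr
          have a4 : ((1:ℝ) / 2) ^ 2 ≤ (1 - p^~α) ^ 2 := by gcongr; linarith
          calc _ ≤ 1 / p / (1 / 2) ^ 2 * (log y * log p) := by
                rw [sq (log p)]; gcongr
            _ = _ := by ring
      _ = 4 * log y * ∑ p ∈ primesLE y, log p / p := by rw [Finset.mul_sum]
      _ ≤ 4 * log y * (2 * log y) := by gcongr; linarith
      _ = _ := by ring
lemma small2 (U : ℝ) (hU : 1 ≤ U) : ∃ C y0 : ℝ, 0 < C ∧ 2 ≤ y0 ∧ ∀ α x y : ℝ, y0 ≤ y → 0 < α → 0 < x → phi1 α y + log x = 0 →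
    log y ≤ log x → log x ≤ U * log y → (smoothCount x y : ℝ) ≤ C * HT x y α := by
  obtain ⟨y1, hy1, h1⟩ := al_gt
  obtain ⟨y2, hy2, h2⟩ := rel_small
  set E := (16 * U ^ 2) ^ U with hE
  have hE1 : 1 ≤ E := one_le_rpow (by nlinarith) li!
  refine ⟨72 * E * U, y1 + y2 + exp U, by positivity, by linarith [exp_pos U], fun α x y hy hα hx h h3 h4 => ?_⟩
  have hEp := exp_pos U
  have hy0 : 0 < y := by linarith
  have hL := (le_log_iff_exp_le hy0).2 (by linarith : exp U ≤ y)
  have hL0 : 0 < log y := by linarith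
  have key : x ^ (1 - α) ≤ E ∧ α ≤ 2 ∧ phi2 α y ≤ 9 * U ^ 2 * log y ^ 2 ∧ 1 / 4 ≤ y ^ (1 - α) := by
    rcases le_or_gt α 1 with hα1 | hα1
    · have h5 : log x ≤ log y * log y ^ 7 := by
        have : U ≤ log y ^ 7 := hL.trans (le_self_pow₀ li! nn!)
        nlinarith
      obtain ⟨g1, g2, g3⟩ := h2 α x y li! hα hα1 h h5
      have hu : log x / log y ≤ U := by rwa [div_le_iff₀ hL0]
      have hu0 : 0 ≤ log x / log y := div_nonneg li! hL0.le
      refine ⟨?_, by linarith, ?_, ?_⟩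
      · calc x ^ (1 - α) ≤ (y ^ U) ^ (1 - α) := by
              refine rpow_le_rpow hx.le ?_ li!
              rw [← log_le_log_iff hx po!, log_rpow hy0]; exact h4
          _ = (y ^ (1 - α)) ^ U := by rw [← rpow_mul hy0.le, ← rpow_mul hy0.le, mul_comm]
          _ ≤ _ := by
            refine rpow_le_rpow po! (g3.trans ?_) li!
            gcongr
      · refine g2.trans ?_
        calc _ ≤ 8 * log y * (U * log y) := by gcongr
          _ = 8 * U * 1 * log y ^ 2 := by ring
          _ ≤ 9 * U * U * log y ^ 2 := by gcongr; norm_num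
          _ = _ := by ring
      · exact le_trans nn! (one_le_rpow (by linarith : 1 ≤ y) (by linarith : 0 ≤ 1 - α))
    · obtain ⟨g1, g2, g3⟩ := h1 α x y li! hα1 h h3
      refine ⟨?_, g2, ?_, g1⟩
      · refine le_trans (rpow_le_one_of_one_le_of_nonpos ?_ li!) hE1
        by_contra hlt
        linarith [log_neg hx (not_le.1 hlt)]
      · refine g3.trans ?_
        gcongr
        nlinarith
  obtain ⟨k1, k2, k3, k4⟩ := key
  have hz := zeta_lower α y (1 / 4) hα li! nn! nn! k4
  have hs : √(phi2 α y) ≤ 3 * U * log y := sqrt_le_iff.2 ⟨by positivity, k3.trans (le_of_eq (by ring))⟩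
  have hs0 := sqrt_pos.2 (phi2_pos α y hα li!)
  have hz0 := zetaSmooth_pos α y hα
  refine (Psi_le x y hx.le).trans ?_
  rw [HT_eq]
  have h5 : α * (√(2 * π) * √(phi2 α y)) ≤ 2 * (3 * (3 * U * log y)) := by
    have := s_le
    gcongr
  calc x = x ^ α * x ^ (1 - α) := by rw [← rpow_add hx]; simp
    _ ≤ x ^ α * E := by gcongr
    _ = 72 * E * U * (x ^ α * (1 / 4 * log y) * (1 / (2 * (3 * (3 * U * log y))))) := by field_simp; norm_num
    _ ≤ _ := by gcongr
end
end HTP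

theorem hildebrand_tenenbaum_estimate :
    ∃ C : ℝ, 0 < C ∧ ∀ x y α : ℝ, 2 ≤ y → y ≤ x → 0 < α →
      phi1 α y + Real.log x = 0 →
      |(smoothCount x y : ℝ) - HT x y α| ≤
        C * (1 / (Real.log x / Real.log y) + Real.log y / y) * HT x y α := by
  obtain ⟨C1, δ, y1, hC1, hδ, hy1, hlarge⟩ := HTP.large
  set U := 3 + 2 / δ with hU
  have hU3 : 3 ≤ U := by have : 0 < 2 / δ := by positivity
                         linarith
  obtain ⟨C2, y2, hC2, hy2, hsmall⟩ := HTP.small2 U li!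
  set Y := max (max y1 y2) ((4 / δ) ^ 2) with hYd
  have hY2 : 2 ≤ Y := hy1.trans ((le_max_left _ _).trans (le_max_left _ _))
  have hl2 := Real.log_pos (by norm_num : (1:ℝ) < 2)
  refine ⟨C1 + (C2 + 1) * U + (7 * Y + 1) * (Y / Real.log 2), by positivity, fun x y α hy hyx hα h => ?_⟩
  have hy0 : 0 < y := by linarith
  have hx0 : 0 < x := by linarith
  have hL0 := Real.log_pos (by linarith : 1 < y)
  have hxy := Real.log_le_log hy0 hyx
  have hlx : 0 < Real.log x := by linarith
  have hH := HTP.HT_pos α x y hα hx0 hy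
  rw [← HTP.e0]
  have he1 : Real.log y / Real.log x ≤ HTP.e0 x y := by
    unfold HTP.e0; rw [one_div_div]; have : 0 ≤ Real.log y / y := by positivity
    linarith
  have he2 : Real.log y / y ≤ HTP.e0 x y := by
    unfold HTP.e0; rw [one_div_div]; have : 0 ≤ Real.log y / Real.log x := by positivity
    linarith
  have he0 : 0 < HTP.e0 x y := lt_of_lt_of_le po! he1
  have fin : ∀ c d : ℝ, 0 ≤ c → (smoothCount x y : ℝ) ≤ c * HT x y α → 1 ≤ d * HTP.e0 x y →
      |(smoothCount x y : ℝ) - HT x y α| ≤ (c + 1) * d * HTP.e0 x y * HT x y α := by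
    intro c d hc h1 h2
    have h3 : (0:ℝ) ≤ smoothCount x y := Nat.cast_nonneg _
    calc _ ≤ (c + 1) * 1 * HT x y α := by rw [abs_le]; constructor <;> linarith [mul_nonneg hc hH.le]
      _ ≤ (c + 1) * (d * HTP.e0 x y) * HT x y α := by gcongr
      _ = _ := by ring
  have hmono : ∀ K : ℝ, K ≤ C1 + (C2 + 1) * U + (7 * Y + 1) * (Y / Real.log 2) →
      K * HTP.e0 x y * HT x y α ≤ (C1 + (C2 + 1) * U + (7 * Y + 1) * (Y / Real.log 2)) * HTP.e0 x y * HT x y α := fun K hK => by gcongr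
  have p1 : 0 < (C2 + 1) * U := by positivity
  have p2 : 0 < (7 * Y + 1) * (Y / Real.log 2) := by positivity
  rcases le_total y Y with hyY | hyY
  · refine (fin (7 * Y) (Y / Real.log 2) po! (HTP.small1 Y hY2 α x y hα hx0 hy hyY) ?_).trans (hmono _ li!)
    have : Real.log 2 / Y ≤ Real.log y / y := by
      have := Real.log_le_log nn! hy
      gcongr
    calc 1 = Y / Real.log 2 * (Real.log 2 / Y) := by field_simp
      _ ≤ _ := by gcongr; linarith
  · simp only [hYd, max_le_iff] at hyY
    obtain ⟨⟨hyy1, hyy2⟩, hyδ⟩ := hyY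
    rcases le_total (Real.log x) (U * Real.log y) with hxU | hxU
    · refine (fin C2 U hC2.le (hsmall α x y hyy2 hα hx0 h hxy hxU) ?_).trans (hmono _ li!)
      calc 1 ≤ U * (Real.log y / Real.log x) := by rw [mul_div_assoc', le_div_iff₀ hlx]; linarith
        _ ≤ _ := by gcongr
    · refine (hlarge α x y hyy1 hx0 hα h (by nlinarith) ?_).trans (hmono _ li!)
      have q1 : 1 / (Real.log x / Real.log y) ≤ δ / 2 := by
        rw [one_div_div, div_le_iff₀ hlx]
        have : 2 / δ * Real.log y ≤ Real.log x := by rw [hU] at hxU; linarith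
        rw [div_mul_eq_mul_div, div_le_iff₀ hδ] at this
        linarith
      have q2 : Real.log y / y ≤ δ / 2 := by
        have a1 := HTP.log_le_two_sqrt y li!
        have a2 : 4 / δ ≤ √y := Real.le_sqrt_of_sq_le hyδ
        rw [div_le_iff₀ hδ] at a2
        rw [div_le_iff₀ hy0]
        nlinarith [Real.mul_self_sqrt hy0.le, Real.sqrt_nonneg y]
      unfold HTP.e0; linarith
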